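/- Let d ≥ 2 and let P ⊂ ℝ^d be a convex polytope (the convex hull of a finite set) with nonempty interior. Then for μ_d-almost every L ∈ 𝒮_d and for every ε > 0, there exist C > 0 and t₀ ≥ 2 such that for all t ≥ t₀, sup_{X ∈ ℝ^d} |card(L ∩ (t·P + X)) − t^d·Vol(P)| ≤ C·(log t)^{d−1+ε}, where t·P + X = {t·p + X : p ∈ P} and Vol(P) is the Lebesgue volume of P. -/

import Mathlib

noncomputable section

open MeasureTheory

/-- `SL_d(ℝ)`. -/
abbrev SLR (d : ℕ) := Matrix.SpecialLinearGroup (Fin d) ℝ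

/-- `SL_d(ℤ)` viewed as a subgroup of `SL_d(ℝ)` (the range of the coefficientwise
integer-cast homomorphism `SL_d(ℤ) →* SL_d(ℝ)`). -/
def SLZ (d : ℕ) : Subgroup (SLR d) :=
  (Matrix.SpecialLinearGroup.map (n := Fin d) (Int.castRingHom ℝ)).range

instance (d : ℕ) : MeasurableSpace (Matrix (Fin d) (Fin d) ℝ) :=
  inferInstanceAs (MeasurableSpace (Fin d → Fin d → ℝ))

instance (d : ℕ) : MeasurableSpace (SLR d) :=
  inferInstanceAs (MeasurableSpace {A : Matrix (Fin d) (Fin d) ℝ // A.det = 1})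

/-- The space of unimodular lattices `𝒮_d = SL_d(ℝ)/SL_d(ℤ)`; the coset of
`g ∈ SL_d(ℝ)` corresponds to the lattice `g·ℤ^d`. -/
abbrev LatticeSpace (d : ℕ) := SLR d ⧸ SLZ d

/-- The vector `g·v ∈ ℝ^d` for `g ∈ SL_d(ℝ)` and `v ∈ ℤ^d`: a point of the
lattice `g·ℤ^d`. -/
def latVec {d : ℕ} (g : SLR d) (v : Fin d → ℤ) : EuclideanSpace ℝ (Fin d) :=
  (WithLp.equiv 2 (Fin d → ℝ)).symm (g.1.mulVec fun i => (v i : ℝ))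

/-- The minimal norm `‖L‖ = inf {‖l‖ : l ∈ L ∖ {0}}` of the lattice `L = g·ℤ^d`. -/
def gMin {d : ℕ} (g : SLR d) : ℝ :=
  sInf {r : ℝ | ∃ v : Fin d → ℤ, latVec g v ≠ 0 ∧ ‖latVec g v‖ = r}

/-- The lattice `g·ℤ^d ⊆ ℝ^d` associated to `g ∈ SL_d(ℝ)`. -/
def gLat {d : ℕ} (g : SLR d) : Set (EuclideanSpace ℝ (Fin d)) :=
  {x | ∃ v : Fin d → ℤ, x = latVec g v}

section
open scoped ENNReal Matrix

/-- The lattice point `h • n` of `h • ℤ^d`. -/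
def lv {d : ℕ} (h : Matrix (Fin d) (Fin d) ℝ) (n : Fin d → ℤ) : Fin d → ℝ :=
  h.mulVec fun i => (n i : ℝ)

lemma lv_add {d : ℕ} (h : Matrix (Fin d) (Fin d) ℝ) (m n : Fin d → ℤ) :
    lv h (m + n) = lv h m + lv h n := by
  simp only [lv, ← Matrix.mulVec_add]; congr 1; ext i; simp

@[simp] lemma lv_zero {d : ℕ} (h : Matrix (Fin d) (Fin d) ℝ) : lv h 0 = 0 := by
  ext i; simp [lv, Matrix.mulVec, dotProduct]

lemma lv_neg {d : ℕ} (h : Matrix (Fin d) (Fin d) ℝ) (n : Fin d → ℤ) :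
    lv h (-n) = -lv h n := by
  simp only [lv, ← Matrix.mulVec_neg]; congr 1; ext i; simp

lemma lv_sub {d : ℕ} (h : Matrix (Fin d) (Fin d) ℝ) (m n : Fin d → ℤ) :
    lv h (m - n) = lv h m - lv h n := by
  rw [sub_eq_add_neg, lv_add, lv_neg, sub_eq_add_neg]

lemma lv_mul {d : ℕ} (A h : Matrix (Fin d) (Fin d) ℝ) (n : Fin d → ℤ) :
    lv (A * h) n = A.mulVec (lv h n) := by
  simp [lv, Matrix.mulVec_mulVec]

lemma exists_norm_le_mul_norm_lv {d : ℕ} {h : Matrix (Fin d) (Fin d) ℝ} (hh : h.det ≠ 0) :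
    ∃ C > 0, ∀ n : Fin d → ℤ, ‖(fun i => (n i : ℝ))‖ ≤ C * ‖lv h n‖ := by
  let f : (Fin d → ℝ) →L[ℝ] (Fin d → ℝ) := LinearMap.toContinuousLinearMap (Matrix.mulVecLin h⁻¹)
  refine ⟨‖f‖ + 1, by positivity, fun n => ?_⟩
  have h1 : f (lv h n) = fun i => (n i : ℝ) := by
    simp [f, lv, Matrix.mulVec_mulVec, Matrix.nonsing_inv_mul _ (isUnit_iff_ne_zero.2 hh)]
  rw [← h1]
  refine (f.le_opNorm _).trans ?_
  gcongr
  linarith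

lemma lv_injective {d : ℕ} {h : Matrix (Fin d) (Fin d) ℝ} (hh : h.det ≠ 0) :
    Function.Injective (lv h) := by
  intro m n hmn
  obtain ⟨C, hC, hb⟩ := exists_norm_le_mul_norm_lv hh
  have h1 := hb (m - n)
  rw [lv_sub, hmn, sub_self, norm_zero, mul_zero, norm_le_zero_iff] at h1
  ext i
  have := congrFun h1 i
  simp at this
  have h2 : ((m i : ℝ)) = n i := by linarith
  exact_mod_cast h2

lemma finite_int_norm_le {d : ℕ} (R : ℝ) :
    {n : Fin d → ℤ | ‖(fun i => (n i : ℝ))‖ ≤ R}.Finite := by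
  refine (Set.finite_Icc (fun _ => -⌈R⌉ : Fin d → ℤ) (fun _ => ⌈R⌉)).subset fun n hn => ?_
  have : ∀ i, |(n i : ℝ)| ≤ R := fun i => (norm_le_pi_norm (fun i => (n i : ℝ)) i).trans hn
  refine ⟨fun i => ?_, fun i => ?_⟩
  · have h1 := (abs_le.1 (this i)).1
    have h2 := Int.le_ceil R
    have : (-⌈R⌉ : ℝ) ≤ n i := by linarith
    exact_mod_cast this
  · have h1 := (abs_le.1 (this i)).2
    have h2 := Int.le_ceil R
    have : (n i : ℝ) ≤ ⌈R⌉ := by linarith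
    exact_mod_cast this

lemma finite_lv_norm_le {d : ℕ} {h : Matrix (Fin d) (Fin d) ℝ} (hh : h.det ≠ 0)
    (x : Fin d → ℝ) (R : ℝ) : {n : Fin d → ℤ | ‖x - lv h n‖ ≤ R}.Finite := by
  obtain ⟨C, hC, hb⟩ := exists_norm_le_mul_norm_lv hh
  refine (finite_int_norm_le (C * (R + ‖x‖))).subset fun n hn => (hb n).trans ?_
  have hn' : ‖x - lv h n‖ ≤ R := hn
  have : ‖lv h n‖ ≤ R + ‖x‖ := by
    calc ‖lv h n‖ = ‖x - (x - lv h n)‖ := by congr 1; abel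
      _ ≤ ‖x‖ + ‖x - lv h n‖ := norm_sub_le _ _
      _ ≤ _ := by linarith
  gcongr

/-- Every point is within sup-distance `ρ` of the lattice `h • ℤ^d`. -/
def Covers {d : ℕ} (h : Matrix (Fin d) (Fin d) ℝ) (ρ : ℝ) : Prop :=
  ∀ x : Fin d → ℝ, ∃ n : Fin d → ℤ, ‖x - lv h n‖ ≤ ρ

/-- The number of lattice points within distance `ρ` of `x`. -/
def latCount {d : ℕ} (h : Matrix (Fin d) (Fin d) ℝ) (ρ : ℝ) (x : Fin d → ℝ) : ℝ≥0∞ :=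
  ∑' n : Fin d → ℤ, (Metric.closedBall (0 : Fin d → ℝ) ρ).indicator 1 (x - lv h n)

/-- A partition-of-unity kernel for the lattice `h • ℤ^d`. -/
def kerE {d : ℕ} (h : Matrix (Fin d) (Fin d) ℝ) (ρ : ℝ) (x : Fin d → ℝ) : ℝ≥0∞ :=
  (Metric.closedBall (0 : Fin d → ℝ) ρ).indicator 1 x * (latCount h ρ x)⁻¹

lemma latCount_sub {d : ℕ} (h : Matrix (Fin d) (Fin d) ℝ) (ρ : ℝ) (x : Fin d → ℝ)
    (m : Fin d → ℤ) : latCount h ρ (x - lv h m) = latCount h ρ x := by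
  unfold latCount
  rw [← (Equiv.addLeft m).tsum_eq
    fun n => (Metric.closedBall (0 : Fin d → ℝ) ρ).indicator (1 : (Fin d → ℝ) → ℝ≥0∞) (x - lv h n)]
  simp [lv_add, sub_sub]

lemma one_le_latCount {d : ℕ} {h : Matrix (Fin d) (Fin d) ℝ} {ρ : ℝ} (hc : Covers h ρ)
    (x : Fin d → ℝ) : 1 ≤ latCount h ρ x := by
  obtain ⟨n, hn⟩ := hc x
  refine le_trans ?_ (ENNReal.le_tsum n)
  rw [Set.indicator_of_mem (by simpa using hn)]
  simp

lemma latCount_ne_top {d : ℕ} {h : Matrix (Fin d) (Fin d) ℝ} (hh : h.det ≠ 0) (ρ : ℝ)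
    (x : Fin d → ℝ) : latCount h ρ x ≠ ∞ := by
  unfold latCount
  rw [tsum_eq_sum (s := (finite_lv_norm_le hh x ρ).toFinset)]
  · refine (ENNReal.sum_lt_top.2 fun n _ => ?_).ne
    exact (Set.indicator_le_self' (by simp) _).trans_lt (by simp)
  · intro n hn
    rw [Set.indicator_of_notMem]
    simpa using hn

lemma measurable_latCount {d : ℕ} (h : Matrix (Fin d) (Fin d) ℝ) (ρ : ℝ) :
    Measurable (latCount h ρ) := by
  unfold latCount
  refine Measurable.tsum fun n => ?_
  exact (measurable_one.indicator Metric.isClosed_closedBall.measurableSet).comp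
    (measurable_id.sub_const _)

lemma measurable_kerE {d : ℕ} (h : Matrix (Fin d) (Fin d) ℝ) (ρ : ℝ) :
    Measurable (kerE h ρ) :=
  (measurable_one.indicator Metric.isClosed_closedBall.measurableSet).mul
    (measurable_latCount h ρ).inv

lemma tsum_kerE_sub {d : ℕ} {h : Matrix (Fin d) (Fin d) ℝ} (hh : h.det ≠ 0) {ρ : ℝ}
    (hc : Covers h ρ) (x : Fin d → ℝ) : ∑' n, kerE h ρ (x - lv h n) = 1 := by
  simp only [kerE, latCount_sub]
  rw [ENNReal.tsum_mul_right]
  exact ENNReal.mul_inv_cancel (one_pos.trans_le (one_le_latCount hc x)).ne'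
    (latCount_ne_top hh ρ x)

lemma tsum_kerE_add {d : ℕ} {h : Matrix (Fin d) (Fin d) ℝ} (hh : h.det ≠ 0) {ρ : ℝ}
    (hc : Covers h ρ) (x : Fin d → ℝ) : ∑' n, kerE h ρ (x + lv h n) = 1 := by
  rw [← tsum_kerE_sub hh hc x, ← (Equiv.neg _).tsum_eq]
  simp [lv_neg, sub_eq_add_neg]

lemma kerE_le_one {d : ℕ} {h : Matrix (Fin d) (Fin d) ℝ} {ρ : ℝ}
    (hc : Covers h ρ) (x : Fin d → ℝ) : kerE h ρ x ≤ 1 := by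
  unfold kerE
  have h1 : (Metric.closedBall (0 : Fin d → ℝ) ρ).indicator (1 : (Fin d → ℝ) → ℝ≥0∞) x ≤ 1 :=
    Set.indicator_le_self' (by simp) _
  calc _ ≤ (1 : ℝ≥0∞) * 1 := by
        gcongr
        exact ENNReal.inv_le_one.2 (one_le_latCount hc x)
    _ = 1 := one_mul _

lemma kerE_eq_zero {d : ℕ} {h : Matrix (Fin d) (Fin d) ℝ} {ρ : ℝ} {x : Fin d → ℝ}
    (hx : ρ < ‖x‖) : kerE h ρ x = 0 := by
  unfold kerE
  rw [Set.indicator_of_notMem (by simpa using hx), zero_mul]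

lemma lintegral_kerE {d : ℕ} {h : Matrix (Fin d) (Fin d) ℝ} (hh : h.det ≠ 0) {ρ : ℝ}
    (hc : Covers h ρ) : ∫⁻ x, kerE h ρ x = ENNReal.ofReal |h.det| := by
  let b : Module.Basis (Fin d) ℝ (Fin d → ℝ) :=
    (Pi.basisFun ℝ (Fin d)).map (Matrix.toLinearEquiv' h (Matrix.invertibleOfIsUnitDet h
      (isUnit_iff_ne_zero.2 hh)))
  have hb : Matrix.of b = h.transpose := by
    ext i j
    have : b i = h.mulVec (Pi.single i 1) := by
      simp only [b, Module.Basis.map_apply, Pi.basisFun_apply]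
      rfl
    simp [this]
  have hvol : volume (ZSpan.fundamentalDomain b) = ENNReal.ofReal |h.det| := by
    rw [ZSpan.volume_fundamentalDomain, hb, Matrix.det_transpose]
  have hfd := ZSpan.isAddFundamentalDomain' b (volume : Measure (Fin d → ℝ))
  let e : (Fin d → ℤ) ≃ (Submodule.span ℤ (Set.range b)).toAddSubgroup :=
    (b.restrictScalars ℤ).equivFun.symm.toEquiv
  have he : ∀ n, ((e n : _) : Fin d → ℝ) = lv h n := by
    intro n
    simp only [e, LinearEquiv.coe_toEquiv, Module.Basis.equivFun_symm_apply]
    change (((∑ i, n i • (b.restrictScalars ℤ) i :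
      Submodule.span ℤ (Set.range b))) : Fin d → ℝ) = _
    simp only [Submodule.coe_sum, Submodule.coe_smul, Module.Basis.restrictScalars_apply]
    ext j
    have hbij : ∀ i, b i j = h j i := fun i => by
      have := congrFun (congrFun hb i) j
      simpa using this
    simp [lv, Matrix.mulVec, dotProduct, hbij, mul_comm]
  have : Countable (Submodule.span ℤ (Set.range b)).toAddSubgroup := e.symm.injective.countable
  rw [hfd.lintegral_eq_tsum'', ← e.tsum_eq, ← lintegral_tsum]
  · have : ∀ x, ∑' n, kerE h ρ (e n +ᵥ x) = 1 := by
      intro x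
      rw [← tsum_kerE_add hh hc x]
      congr 1
      ext n
      rw [AddSubgroup.vadd_def, he, vadd_eq_add, add_comm]
    simp only [this]
    simp [hvol]
  · intro n
    simp only [AddSubgroup.vadd_def]
    exact ((measurable_kerE h ρ).comp (measurable_const_add _)).aemeasurable

/-- Packing bound: a lattice with covering radius `ρ` has few points in a ball. -/
lemma card_lv_le {d : ℕ} {h : Matrix (Fin d) (Fin d) ℝ} (hh : h.det ≠ 0) {ρ : ℝ}
    (hc : Covers h ρ) (hρ : 0 ≤ ρ) {R : ℝ} (hR : 0 ≤ R) (p : Fin d → ℝ)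
    (S : Finset (Fin d → ℤ)) (hS : ∀ n ∈ S, ‖lv h n - p‖ ≤ R) :
    (S.card : ℝ) * |h.det| ≤ (2 * (R + ρ)) ^ d := by
  have h1 : (S.card : ℝ≥0∞) * ENNReal.ofReal |h.det| ≤ ENNReal.ofReal ((2 * (R + ρ)) ^ d) := by
    calc (S.card : ℝ≥0∞) * ENNReal.ofReal |h.det|
        = ∑ n ∈ S, ∫⁻ x, kerE h ρ (x - lv h n) := by
          simp_rw [lintegral_sub_right_eq_self (kerE h ρ), lintegral_kerE hh hc]
          simp
      _ = ∫⁻ x, ∑ n ∈ S, kerE h ρ (x - lv h n) :=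
          (lintegral_finsetSum _ fun n _ =>
            (measurable_kerE h ρ).comp (measurable_id.sub_const _)).symm
      _ ≤ ∫⁻ x, (Metric.closedBall p (R + ρ)).indicator 1 x := by
          refine lintegral_mono fun x => ?_
          by_cases hx : x ∈ Metric.closedBall p (R + ρ)
          · rw [Set.indicator_of_mem hx]
            exact (ENNReal.sum_le_tsum S).trans (tsum_kerE_sub hh hc x).le
          · rw [Set.indicator_of_notMem hx]
            refine (Finset.sum_eq_zero fun n hn => kerE_eq_zero ?_).le
            by_contra! hlt
            apply hx
            rw [mem_closedBall_iff_norm]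
            calc ‖x - p‖ = ‖(x - lv h n) + (lv h n - p)‖ := by congr 1; abel
              _ ≤ _ := norm_add_le _ _
              _ ≤ _ := by linarith [hS n hn]
      _ = _ := by
          rw [lintegral_indicator_one Metric.isClosed_closedBall.measurableSet,
            Real.volume_pi_closedBall _ (by positivity), Fintype.card_fin]
  have h2 : (S.card : ℝ≥0∞) * ENNReal.ofReal |h.det| = ENNReal.ofReal (S.card * |h.det|) := by
    rw [ENNReal.ofReal_mul (by positivity), ENNReal.ofReal_natCast]
  rw [h2] at h1
  exact (ENNReal.ofReal_le_ofReal_iff (by positivity)).1 h1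

/-- The normalized lattice discrepancy of `f`. -/
def latErr {d : ℕ} (h : Matrix (Fin d) (Fin d) ℝ) (f : (Fin d → ℝ) → ℝ) : ℝ :=
  |h.det| * ∑' n : Fin d → ℤ, f (lv h n) - ∫ x, f x

/-- Bounded integrable functions of bounded support. -/
structure BddInt {d : ℕ} (f : (Fin d → ℝ) → ℝ) : Prop where
  integrable : Integrable f
  bdd : ∃ C, ∀ x, |f x| ≤ C
  supp : ∃ R, ∀ x, R < ‖x‖ → f x = 0

/-- All `M`-fold differences of `f` with steps in the `ρ`-ball are bounded by `c`. -/
def DiffBdd {d : ℕ} (ρ c : ℝ) : ℕ → ((Fin d → ℝ) → ℝ) → Prop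
  | 0, f => ∀ x, |f x| ≤ c
  | M + 1, f => ∀ y, ‖y‖ ≤ ρ → DiffBdd ρ c M fun x => f x - f (x - y)

/-- The averaging kernel with total mass one. -/
def kerR {d : ℕ} (h : Matrix (Fin d) (Fin d) ℝ) (ρ : ℝ) (x : Fin d → ℝ) : ℝ :=
  (kerE h ρ x).toReal / |h.det|

/-- Averaging against `kerR`. -/
def latAvg {d : ℕ} (h : Matrix (Fin d) (Fin d) ℝ) (ρ : ℝ) (f : (Fin d → ℝ) → ℝ)
    (x : Fin d → ℝ) : ℝ :=
  ∫ y, kerR h ρ y * f (x - y)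

section
variable {d : ℕ} {h : Matrix (Fin d) (Fin d) ℝ} {ρ : ℝ} {f : (Fin d → ℝ) → ℝ}

lemma BddInt.sub_translate (hf : BddInt f) (y : Fin d → ℝ) :
    BddInt fun x => f x - f (x - y) := by
  obtain ⟨C, hC⟩ := hf.bdd
  obtain ⟨R, hR⟩ := hf.supp
  refine ⟨hf.integrable.sub (hf.integrable.comp_sub_right y), ⟨C + C, fun x => ?_⟩,
    ⟨R + ‖y‖, fun x hx => ?_⟩⟩
  · exact (abs_sub _ _).trans (add_le_add (hC _) (hC _))
  · rw [hR x (by linarith [norm_nonneg y]), hR (x - y), sub_zero]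
    have := norm_sub_norm_le x y
    linarith

lemma kerR_nonneg (x : Fin d → ℝ) : 0 ≤ kerR h ρ x := by unfold kerR; positivity

lemma kerR_eq_zero {x : Fin d → ℝ} (hx : ρ < ‖x‖) : kerR h ρ x = 0 := by
  simp [kerR, kerE_eq_zero hx]

lemma integrable_kerR (hh : h.det ≠ 0) (hc : Covers h ρ) : Integrable (kerR h ρ) := by
  refine Integrable.div_const (integrable_toReal_of_lintegral_ne_top
    (measurable_kerE h ρ).aemeasurable ?_) _
  rw [lintegral_kerE hh hc]; simp

lemma integral_kerR (hh : h.det ≠ 0) (hc : Covers h ρ) : ∫ x, kerR h ρ x = 1 := by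
  unfold kerR
  rw [integral_div, integral_toReal (measurable_kerE h ρ).aemeasurable, lintegral_kerE hh hc,
    ENNReal.toReal_ofReal (abs_nonneg _), div_self (abs_ne_zero.2 hh)]
  exact Filter.Eventually.of_forall fun x => (kerE_le_one hc x).trans_lt (by simp)

lemma avg_eq_convolution (x : Fin d → ℝ) :
    latAvg h ρ f x =
      convolution (kerR h ρ) f (ContinuousLinearMap.mul ℝ ℝ) volume x :=
  rfl

lemma integrable_kerR_mul (hh : h.det ≠ 0) (hc : Covers h ρ) (hf : BddInt f) (x : Fin d → ℝ) :
    Integrable fun y => kerR h ρ y * f (x - y) := by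
  obtain ⟨C, hC⟩ := hf.bdd
  refine (integrable_kerR hh hc).mul_bdd (c := C) ?_ (Filter.Eventually.of_forall fun y => hC _)
  exact (hf.integrable.comp_sub_left x).aestronglyMeasurable

lemma avg_abs_le (hh : h.det ≠ 0) (hc : Covers h ρ) {c : ℝ} (x : Fin d → ℝ)
    (hC : ∀ y, ‖y‖ ≤ ρ → |f (x - y)| ≤ c) : |latAvg h ρ f x| ≤ c := by
  calc |latAvg h ρ f x| ≤ ∫ y, kerR h ρ y * c := by
        rw [← Real.norm_eq_abs, latAvg]
        refine norm_integral_le_of_norm_le ((integrable_kerR hh hc).mul_const c)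
          (Filter.Eventually.of_forall fun y => ?_)
        rw [norm_mul, Real.norm_of_nonneg (kerR_nonneg y)]
        by_cases hy : ‖y‖ ≤ ρ
        · exact mul_le_mul_of_nonneg_left (hC y hy) (kerR_nonneg y)
        · simp [kerR_eq_zero (not_le.1 hy)]
    _ = c := by rw [integral_mul_const, integral_kerR hh hc, one_mul]

lemma avg_eq_zero {p : Fin d → ℝ} {R : ℝ} (hR : ∀ x, R < ‖x - p‖ → f x = 0) {x : Fin d → ℝ}
    (hx : R + ρ < ‖x - p‖) : latAvg h ρ f x = 0 := by
  unfold latAvg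
  rw [integral_eq_zero_of_ae]
  refine Filter.Eventually.of_forall fun y => ?_
  by_cases hy : ‖y‖ ≤ ρ
  · change kerR h ρ y * f (x - y) = 0
    rw [hR (x - y), mul_zero]
    have := norm_sub_norm_le (x - p) y
    rw [sub_right_comm]
    linarith
  · simp [kerR_eq_zero (not_le.1 hy)]

lemma BddInt.avg (hf : BddInt f) (hh : h.det ≠ 0) (hc : Covers h ρ) : BddInt (latAvg h ρ f) := by
  obtain ⟨C, hC⟩ := hf.bdd
  obtain ⟨R, hR⟩ := hf.supp
  refine ⟨(integrable_kerR hh hc).integrable_convolution (ContinuousLinearMap.mul ℝ ℝ)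
    hf.integrable,
    ⟨C, fun x => avg_abs_le hh hc x fun y _ => hC _⟩, ⟨R + ρ, fun x hx => ?_⟩⟩
  exact avg_eq_zero (p := 0) (R := R) (by simpa using hR) (by simpa using hx)

lemma integral_avg (hh : h.det ≠ 0) (hc : Covers h ρ) (hf : BddInt f) :
    ∫ x, latAvg h ρ f x = ∫ x, f x := by
  simp_rw [avg_eq_convolution]
  rw [integral_convolution _ (integrable_kerR hh hc) hf.integrable, integral_kerR hh hc]
  simp

lemma BddInt.finite_support (hf : BddInt f) (hh : h.det ≠ 0) :
    (Function.support fun n : Fin d → ℤ => f (lv h n)).Finite := by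
  obtain ⟨R, hR⟩ := hf.supp
  refine (finite_lv_norm_le hh 0 R).subset fun n hn => ?_
  by_contra hlt
  exact hn (hR _ (by simpa using hlt))

lemma BddInt.summable (hf : BddInt f) (hh : h.det ≠ 0) :
    Summable fun n : Fin d → ℤ => f (lv h n) :=
  summable_of_hasFiniteSupport (hf.finite_support hh)

lemma tsum_avg (hh : h.det ≠ 0) (hc : Covers h ρ) (hf : BddInt f) :
    |h.det| * ∑' n : Fin d → ℤ, latAvg h ρ f (lv h n) = ∫ x, f x := by
  obtain ⟨R, hR⟩ := hf.supp
  set S := (finite_lv_norm_le hh 0 (R + ρ)).toFinset with hS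
  have hSm : ∀ n, n ∉ S → R + ρ < ‖lv h n‖ := by
    intro n hn; simpa [hS] using hn
  rw [tsum_eq_sum (s := S)]
  swap
  · intro n hn
    refine avg_eq_zero (p := 0) (R := R) (by simpa using hR) (by simpa using hSm n hn)
  have h1 : ∀ n, latAvg h ρ f (lv h n) = ∫ y, kerR h ρ (lv h n - y) * f y := by
    intro n
    unfold latAvg
    rw [← integral_sub_left_eq_self (fun y => kerR h ρ y * f (lv h n - y)) volume (lv h n)]
    simp
  simp_rw [h1]
  rw [← integral_finsetSum, ← integral_const_mul]
  · congr 1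
    ext y
    rw [← Finset.sum_mul]
    by_cases hy : R < ‖y‖
    · rw [hR y hy]; simp
    · have h2 : ∑ n ∈ S, kerE h ρ (lv h n - y) = 1 := by
        rw [← tsum_kerE_add hh hc (-y), tsum_eq_sum (s := S)]
        · simp [sub_eq_neg_add]
        · intro n hn
          apply kerE_eq_zero
          have := norm_sub_norm_le (lv h n) y
          rw [← sub_eq_neg_add]
          linarith [hSm n hn]
      have h3 : ∑ n ∈ S, kerR h ρ (lv h n - y) = 1 / |h.det| := by
        simp only [kerR]
        rw [← Finset.sum_div, ← ENNReal.toReal_sum, h2]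
        · simp
        · exact fun n _ => ((kerE_le_one hc _).trans_lt (by simp)).ne
      rw [h3, ← mul_assoc, mul_one_div_cancel (abs_ne_zero.2 hh), one_mul]
  · intro n _
    have := (integrable_kerR_mul hh hc hf (lv h n)).comp_sub_left (lv h n)
    simpa using this

lemma latErr_sub_avg (hh : h.det ≠ 0) (hc : Covers h ρ) (hf : BddInt f) :
    latErr h (fun x => f x - latAvg h ρ f x) = latErr h f := by
  unfold latErr
  rw [integral_sub hf.integrable (hf.avg hh hc).integrable, integral_avg hh hc hf,
    (hf.summable hh).tsum_sub ((hf.avg hh hc).summable hh), mul_sub, tsum_avg hh hc hf]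
  ring

lemma sub_avg_eq (hh : h.det ≠ 0) (hc : Covers h ρ) (hf : BddInt f) (x : Fin d → ℝ) :
    f x - latAvg h ρ f x = ∫ y, kerR h ρ y * (f x - f (x - y)) := by
  simp_rw [mul_sub]
  rw [integral_sub ((integrable_kerR hh hc).mul_const _) (integrable_kerR_mul hh hc hf x),
    integral_mul_const, integral_kerR hh hc, one_mul]
  rfl

lemma DiffBdd.sub_avg (hh : h.det ≠ 0) (hc : Covers h ρ) {c : ℝ} (M : ℕ) :
    ∀ {f : (Fin d → ℝ) → ℝ}, BddInt f → DiffBdd ρ c (M + 1) f →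
      DiffBdd ρ c M fun x => f x - latAvg h ρ f x := by
  induction M with
  | zero =>
    intro f hf hd x
    change |f x - latAvg h ρ f x| ≤ c
    rw [sub_avg_eq hh hc hf]
    calc |∫ y, kerR h ρ y * (f x - f (x - y))| ≤ ∫ y, kerR h ρ y * c := by
          rw [← Real.norm_eq_abs]
          refine norm_integral_le_of_norm_le ((integrable_kerR hh hc).mul_const c)
            (Filter.Eventually.of_forall fun y => ?_)
          rw [norm_mul, Real.norm_of_nonneg (kerR_nonneg y)]
          by_cases hy : ‖y‖ ≤ ρ
          · exact mul_le_mul_of_nonneg_left (hd y hy x) (kerR_nonneg y)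
          · simp [kerR_eq_zero (not_le.1 hy)]
      _ = c := by rw [integral_mul_const, integral_kerR hh hc, one_mul]
  | succ M ih =>
    intro f hf hd z hz
    have h1 : (fun x => (fun x => f x - latAvg h ρ f x) x -
        (fun x => f x - latAvg h ρ f x) (x - z)) =
        fun x => (f x - f (x - z)) - latAvg h ρ (fun x => f x - f (x - z)) x := by
      ext x
      have : latAvg h ρ (fun x => f x - f (x - z)) x = latAvg h ρ f x - latAvg h ρ f (x - z) := by
        unfold latAvg
        rw [← integral_sub (integrable_kerR_mul hh hc hf x)
          (integrable_kerR_mul hh hc hf (x - z))]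
        congr 1
        ext y
        rw [mul_sub, sub_right_comm]
      simp only [this]
      ring
    rw [h1]
    exact ih (hf.sub_translate z) (hd z hz)

lemma abs_latErr_le_sum (f : (Fin d → ℝ) → ℝ) :
    |latErr h f| ≤ |h.det| * |∑' n : Fin d → ℤ, f (lv h n)| + |∫ x, f x| := by
  unfold latErr
  refine (abs_sub _ _).trans ?_
  rw [abs_mul, abs_abs]

/-- Trivial bound on sum and integral of a bounded function supported in a ball. -/
lemma abs_latErr_le_of_bdd (hh : h.det ≠ 0) (hc : Covers h ρ) (hρ : 0 ≤ ρ) {p : Fin d → ℝ}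
    {R c : ℝ} (hR : 0 ≤ R) (hb : ∀ x, |f x| ≤ c) (hs : ∀ x, R < ‖x - p‖ → f x = 0) :
    |latErr h f| ≤ 2 * c * (2 * (R + ρ)) ^ d := by
  have hc0 : 0 ≤ c := (abs_nonneg _).trans (hb 0)
  refine (abs_latErr_le_sum f).trans ?_
  have h1 : |h.det| * |∑' n : Fin d → ℤ, f (lv h n)| ≤ c * (2 * (R + ρ)) ^ d := by
    set S := (finite_lv_norm_le hh p R).toFinset with hS
    have hSm : ∀ n, n ∈ S ↔ ‖p - lv h n‖ ≤ R := by
      intro n; simp [hS]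
    rw [tsum_eq_sum (s := S) fun n hn => hs _ (by rw [hSm, not_le] at hn; rwa [norm_sub_rev])]
    have h2 : |∑ n ∈ S, f (lv h n)| ≤ S.card * c := by
      refine (Finset.abs_sum_le_sum_abs _ _).trans ?_
      refine (Finset.sum_le_card_nsmul S _ c fun n _ => hb _).trans (by simp)
    have h3 := card_lv_le hh hc hρ hR p S fun n hn => by
      rw [norm_sub_rev]; exact (hSm n).1 hn
    calc |h.det| * |∑ n ∈ S, f (lv h n)| ≤ |h.det| * (S.card * c) := by gcongr
      _ = c * (S.card * |h.det|) := by ring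
      _ ≤ _ := by gcongr
  have h2 : |∫ x, f x| ≤ c * (2 * (R + ρ)) ^ d := by
    rw [← setIntegral_eq_integral_of_forall_compl_eq_zero (s := Metric.closedBall p R)
      fun x hx => hs x (by rwa [mem_closedBall_iff_norm, not_le] at hx)]
    have := norm_setIntegral_le_of_norm_le_const (μ := volume) (s := Metric.closedBall p R)
      (f := f) (C := c) (by rw [Real.volume_pi_closedBall _ hR]; simp) fun x _ => hb x
    refine (this : |_| ≤ _).trans ?_
    rw [Measure.real, Real.volume_pi_closedBall _ hR, Fintype.card_fin,
      ENNReal.toReal_ofReal (by positivity)]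
    gcongr
    linarith
  linarith

/-- Discrepancy of a function with small iterated differences. -/
lemma abs_latErr_le_of_diffBdd (hh : h.det ≠ 0) (hc : Covers h ρ) (hρ : 0 ≤ ρ) {p : Fin d → ℝ}
    {c : ℝ} (M : ℕ) :
    ∀ {f : (Fin d → ℝ) → ℝ} {R : ℝ}, 0 ≤ R → BddInt f → DiffBdd ρ c M f →
      (∀ x, R < ‖x - p‖ → f x = 0) →
      |latErr h f| ≤ 2 * c * (2 * (R + (M + 1) * ρ)) ^ d := by
  induction M with
  | zero =>
    intro f R hR hf hd hs
    simpa using abs_latErr_le_of_bdd hh hc hρ hR hd hs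
  | succ M ih =>
    intro f R hR hf hd hs
    rw [← latErr_sub_avg hh hc hf]
    have hA := hf.avg hh hc
    have hbd : BddInt fun x => f x - latAvg h ρ f x := by
      obtain ⟨C, hC⟩ := hf.bdd
      obtain ⟨C', hC'⟩ := hA.bdd
      obtain ⟨r, hr⟩ := hf.supp
      obtain ⟨r', hr'⟩ := hA.supp
      refine ⟨hf.integrable.sub hA.integrable, ⟨C + C', fun x => ?_⟩, ⟨max r r', fun x hx => ?_⟩⟩
      · exact (abs_sub _ _).trans (add_le_add (hC _) (hC' _))
      · rw [hr x ((le_max_left _ _).trans_lt hx), hr' x ((le_max_right _ _).trans_lt hx), sub_zero]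
    have := ih (R := R + ρ) (by positivity) hbd (hd.sub_avg hh hc M hf) fun x hx => by
      rw [hs x (by linarith), avg_eq_zero hs hx, sub_zero]
    refine this.trans_eq ?_
    push_cast
    ring

end

/-- Vectors pairing integrally with every element of `L`. -/
def dualSet {V : Type} [NormedAddCommGroup V] [InnerProductSpace ℝ V] (L : AddSubgroup V) : Set V :=
  {w | ∀ x ∈ L, ∃ k : ℤ, inner ℝ x w = k}

lemma exists_inner_eq_one {V : Type} [NormedAddCommGroup V] [InnerProductSpace ℝ V]
    {L : AddSubgroup V} {w : V} (hw : w ∈ dualSet L)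
    (hspan : Submodule.span ℝ (L : Set V) = ⊤) {m : ℝ}
    (hm : ∀ y ∈ dualSet L, y ≠ 0 → m ≤ ‖y‖) (hwm : ‖w‖ < 2 * m) (hw0 : w ≠ 0) :
    ∃ x ∈ L, inner ℝ x w = 1 := by
  choose! k hk using hw
  let φ : L →+ ℤ :=
    { toFun := fun x => k x
      map_zero' := by
        have := hk 0 L.zero_mem
        rw [inner_zero_left] at this
        exact_mod_cast this.symm
      map_add' := fun x y => by
        have h := hk (x + y) (L.add_mem x.2 y.2)
        rw [inner_add_left, hk x x.2, hk y y.2] at h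
        exact_mod_cast h.symm }
  obtain ⟨a, ha⟩ := Int.subgroup_cyclic φ.range
  have hmem : ∀ z : ℤ, z ∈ φ.range ↔ ∃ n : ℤ, n * a = z := by
    intro z
    rw [ha, AddSubgroup.mem_closure_singleton]
    simp
  have ha0 : a ≠ 0 := by
    rintro rfl
    apply hw0
    have h0 : ∀ x ∈ L, inner ℝ x w = 0 := by
      intro x hx
      obtain ⟨n, hn⟩ := (hmem (k x)).1 ⟨⟨x, hx⟩, rfl⟩
      rw [hk x hx, ← hn]; simp
    have h1 : ∀ x ∈ Submodule.span ℝ (L : Set V), inner ℝ x w = 0 := by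
      intro x hx
      induction hx using Submodule.span_induction with
      | mem x hx => exact h0 x hx
      | zero => simp
      | add x y _ _ hx hy => rw [inner_add_left, hx, hy, add_zero]
      | smul c x _ hx => rw [real_inner_smul_left, hx, mul_zero]
    exact inner_self_eq_zero.1 (h1 w (hspan ▸ Submodule.mem_top))
  have haR : (a : ℝ) ≠ 0 := by exact_mod_cast ha0
  have hdiv : (a : ℝ)⁻¹ • w ∈ dualSet L := by
    intro x hx
    obtain ⟨n, hn⟩ := (hmem (k x)).1 ⟨⟨x, hx⟩, rfl⟩
    refine ⟨n, ?_⟩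
    rw [real_inner_smul_right, hk x hx, ← hn]
    push_cast
    field_simp
  have hle := hm _ hdiv (by simp [ha0, hw0])
  rw [norm_smul, norm_inv, Real.norm_eq_abs] at hle
  have hapos : 0 < |(a : ℝ)| := abs_pos.2 haR
  have hle' : m * |(a : ℝ)| ≤ ‖w‖ := by
    rw [inv_mul_eq_div, le_div_iff₀ hapos] at hle
    exact hle
  have hmpos : 0 < m := by
    have := norm_pos_iff.2 hw0
    linarith
  have h2 : |(a : ℝ)| < 2 := by
    by_contra! h
    nlinarith
  have h3 : |a| < 2 := by exact_mod_cast h2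
  have h4 : a = 1 ∨ a = -1 := by
    have := abs_lt.1 h3
    omega
  obtain ⟨x, hx⟩ := (hmem 1).2 (by
    rcases h4 with h | h
    · exact ⟨1, by rw [h]; norm_num⟩
    · exact ⟨-1, by rw [h]; norm_num⟩)
  refine ⟨x, x.2, ?_⟩
  rw [hk x x.2]
  have : k x = 1 := hx
  rw [this]; simp

/-- Transference: a lower bound for the dual lattice bounds the covering radius. -/
theorem exists_norm_sub_le_of_dualSet (n : ℕ) :
    ∀ (V : Type) [NormedAddCommGroup V] [InnerProductSpace ℝ V] [FiniteDimensional ℝ V]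
      (L : AddSubgroup V) (m : ℝ), Module.finrank ℝ V = n → 0 < m →
      Submodule.span ℝ (L : Set V) = ⊤ → Submodule.span ℝ (dualSet L) = ⊤ →
      (∀ y ∈ dualSet L, y ≠ 0 → m ≤ ‖y‖) → ∀ x : V, ∃ l ∈ L, ‖x - l‖ ≤ (2 ^ n - 1) / m := by
  induction n with
  | zero =>
    intro V _ _ _ L m hV hm hL hD hb x
    have := Module.finrank_zero_iff.1 hV
    exact ⟨0, L.zero_mem, by simp [Subsingleton.elim x 0]⟩
  | succ n ih =>
    intro V _ _ _ L m₀ hV hm₀ hL hD hb₀ x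
    let N : Set ℝ := {r | ∃ y ∈ dualSet L, y ≠ 0 ∧ ‖y‖ = r}
    have hNb : BddBelow N := ⟨m₀, by rintro r ⟨y, hy, hy0, rfl⟩; exact hb₀ y hy hy0⟩
    have hNne : N.Nonempty := by
      by_contra hemp
      have h0 : ∀ y ∈ dualSet L, y = 0 := by
        intro y hy
        by_contra hy0
        exact hemp ⟨_, y, hy, hy0, rfl⟩
      have : Submodule.span ℝ (dualSet L) = ⊥ := Submodule.span_eq_bot.2 h0
      rw [hD] at this
      have h1 : Module.finrank ℝ (⊤ : Submodule ℝ V) = 0 := by rw [this]; simp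
      rw [finrank_top] at h1
      omega
    set m := sInf N with hmdef
    have hm₀m : m₀ ≤ m := le_csInf hNne (by rintro r ⟨y, hy, hy0, rfl⟩; exact hb₀ y hy hy0)
    have hm : 0 < m := hm₀.trans_le hm₀m
    have hb : ∀ y ∈ dualSet L, y ≠ 0 → m ≤ ‖y‖ := fun y hy hy0 => csInf_le hNb ⟨y, hy, hy0, rfl⟩
    obtain ⟨_, ⟨w, hw, hw0, rfl⟩, hwm⟩ := exists_lt_of_csInf_lt hNne
      (show sInf N < 6 / 5 * m by rw [← hmdef]; linarith)
    obtain ⟨x₁, hx₁, hx₁w⟩ := exists_inner_eq_one hw hL hb (by linarith) hw0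
    let V₀ : Submodule ℝ V := (Submodule.span ℝ {w})ᗮ
    have hV₀ : ∀ y, y ∈ V₀ ↔ inner ℝ y w = 0 := by
      intro y
      rw [Submodule.mem_orthogonal_singleton_iff_inner_left]
    let L₀ : AddSubgroup V₀ := L.comap V₀.subtype.toAddMonoidHom
    have hL₀ : ∀ y : V₀, y ∈ L₀ ↔ (y : V) ∈ L := fun y => Iff.rfl
    have hfin : Module.finrank ℝ V₀ = n := by
      have h1 := Submodule.finrank_add_finrank_orthogonal (Submodule.span ℝ {w})
      rw [finrank_span_singleton hw0, hV] at h1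
      change Module.finrank ℝ ((Submodule.span ℝ {w})ᗮ : Submodule ℝ V) = n
      omega
    let Q : V →ₗ[ℝ] V₀ :=
      { toFun := fun y => ⟨y - (inner ℝ y w : ℝ) • x₁, by
          rw [hV₀, inner_sub_left, real_inner_smul_left, hx₁w]; ring⟩
        map_add' := fun y z => by
          ext; simp only [inner_add_left, add_smul, Submodule.coe_add]; abel
        map_smul' := fun c y => by
          ext; simp only [real_inner_smul_left, mul_smul, smul_sub, RingHom.id_apply,
            Submodule.coe_smul] }
    have hQ : ∀ y : V₀, Q y = y := by
      intro y
      ext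
      change (y : V) - (inner ℝ (y : V) w : ℝ) • x₁ = y
      rw [(hV₀ y).1 y.2, zero_smul, sub_zero]
    have hspan₀ : Submodule.span ℝ (L₀ : Set V₀) = ⊤ := by
      rw [eq_top_iff]
      have h1 : Submodule.map Q (Submodule.span ℝ (L : Set V)) = ⊤ := by
        rw [hL, Submodule.map_top, LinearMap.range_eq_top]
        exact fun y => ⟨y, hQ y⟩
      rw [← h1, Submodule.map_span]
      refine Submodule.span_mono ?_
      rintro _ ⟨y, hy, rfl⟩
      change y - (inner ℝ y w : ℝ) • x₁ ∈ L
      obtain ⟨k, hk⟩ := hw y hy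
      rw [hk, Int.cast_smul_eq_zsmul]
      exact L.sub_mem hy (L.zsmul_mem hx₁ k)
    have hdual₀ : Submodule.span ℝ (dualSet L₀) = ⊤ := by
      rw [eq_top_iff]
      have h1 : Submodule.map (V₀.orthogonalProjectionOnto : V →ₗ[ℝ] V₀)
          (Submodule.span ℝ (dualSet L)) = ⊤ := by
        rw [hD, Submodule.map_top, LinearMap.range_eq_top]
        exact fun y => ⟨y, Submodule.orthogonalProjectionOnto_mem_subspace_eq_self y⟩
      rw [← h1, Submodule.map_span]
      refine Submodule.span_mono ?_
      rintro _ ⟨y, hy, rfl⟩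
      intro z hz
      obtain ⟨k, hk⟩ := hy z hz
      refine ⟨k, ?_⟩
      rw [← hk]
      exact Submodule.inner_orthogonalProjectionOnto_eq_of_mem_left z y
    have hb₁ : ∀ y ∈ dualSet L₀, y ≠ 0 → m / 2 ≤ ‖y‖ := by
      intro y hy hy0
      set s : ℝ := round (inner ℝ x₁ (y : V)) - inner ℝ x₁ (y : V) with hs
      have hs2 : |s| ≤ 1 / 2 := by
        rw [hs, abs_sub_comm]; exact abs_sub_round _
      have hyw : inner ℝ (y : V) w = 0 := (hV₀ y).1 y.2
      have hmem : (y : V) + s • w ∈ dualSet L := by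
        intro z hz
        obtain ⟨k, hk⟩ := hw z hz
        have hz0 : Q z ∈ L₀ := by
          change z - (inner ℝ z w : ℝ) • x₁ ∈ L
          rw [hk, Int.cast_smul_eq_zsmul]
          exact L.sub_mem hz (L.zsmul_mem hx₁ k)
        obtain ⟨j, hj⟩ := hy _ hz0
        have hj' : inner ℝ z (y : V) - k * inner ℝ x₁ (y : V) = j := by
          rw [← hj, ← hk, ← real_inner_smul_left, ← inner_sub_left]
          rfl
        refine ⟨j + k * round (inner ℝ x₁ (y : V)), ?_⟩
        rw [inner_add_right, real_inner_smul_right, hk]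
        push_cast
        rw [← hj', hs]
        ring
      have hsq : ‖(y : V) + s • w‖ ^ 2 = ‖(y : V)‖ ^ 2 + s ^ 2 * ‖w‖ ^ 2 := by
        rw [norm_add_sq_real, real_inner_smul_right, hyw, norm_smul, mul_pow, Real.norm_eq_abs,
          sq_abs]
        ring
      have hy1 : 0 < ‖(y : V)‖ := norm_pos_iff.2 (by simpa using hy0)
      have hne : (y : V) + s • w ≠ 0 := by
        intro h0
        rw [h0, norm_zero] at hsq
        nlinarith [sq_nonneg (s * ‖w‖), pow_pos hy1 2]
      have h1 := hb _ hmem hne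
      have h2 : m ^ 2 ≤ ‖(y : V)‖ ^ 2 + s ^ 2 * ‖w‖ ^ 2 := by
        rw [← hsq]; gcongr
      have h3 : s ^ 2 ≤ 1 / 4 := by
        rw [← sq_abs]; nlinarith [abs_nonneg s]
      have h4 : ‖w‖ ^ 2 ≤ (6 / 5 * m) ^ 2 := by gcongr
      have h5 : s ^ 2 * ‖w‖ ^ 2 ≤ 1 / 4 * (6 / 5 * m) ^ 2 := by gcongr
      change m / 2 ≤ ‖(y : V)‖
      nlinarith
    have hww : 0 < ‖w‖ := norm_pos_iff.2 hw0
    set k : ℤ := round (inner ℝ x w) with hk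
    set a : ℝ := inner ℝ x w - k with ha
    have ha2 : |a| ≤ 1 / 2 := abs_sub_round _
    have hz : x - (k : ℝ) • x₁ - (a / ‖w‖ ^ 2) • w ∈ V₀ := by
      rw [hV₀, inner_sub_left, inner_sub_left, real_inner_smul_left, real_inner_smul_left, hx₁w,
        real_inner_self_eq_norm_sq]
      field_simp
      rw [ha]; ring
    obtain ⟨l, hl, hle⟩ := ih V₀ L₀ (m / 2) hfin (by positivity) hspan₀ hdual₀ hb₁ ⟨_, hz⟩
    refine ⟨k • x₁ + l, L.add_mem (L.zsmul_mem hx₁ k) hl, ?_⟩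
    have e : x - (k • x₁ + (l : V)) =
        (x - (k : ℝ) • x₁ - (a / ‖w‖ ^ 2) • w - l) + (a / ‖w‖ ^ 2) • w := by
      rw [Int.cast_smul_eq_zsmul]; abel
    rw [e]
    refine (norm_add_le _ _).trans ?_
    have h1 : ‖x - (k : ℝ) • x₁ - (a / ‖w‖ ^ 2) • w - l‖ ≤ (2 ^ n - 1) / (m / 2) := hle
    have h2 : ‖(a / ‖w‖ ^ 2) • w‖ ≤ 1 / m := by
      rw [norm_smul, norm_div, norm_pow, norm_norm, Real.norm_eq_abs]
      have : |a| / ‖w‖ ^ 2 * ‖w‖ = |a| / ‖w‖ := by field_simp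
      rw [this]
      have := hb w hw hw0
      gcongr
      linarith
    calc _ ≤ (2 ^ n - 1) / (m / 2) + 1 / m := add_le_add h1 h2
      _ = (2 ^ (n + 1) - 1) / m := by field_simp; ring
      _ ≤ _ := by
        have : (1 : ℝ) ≤ 2 ^ (n + 1) := one_le_pow₀ (by norm_num)
        gcongr

/-- The covering radius of `h • ℤ^d` is controlled by the shortest dual vector. -/
theorem covers_of_dual {d : ℕ} {h : Matrix (Fin d) (Fin d) ℝ} (hh : h.det ≠ 0) {m : ℝ} (hm : 0 < m)
    (hb : ∀ n : Fin d → ℤ, n ≠ 0 → m ≤ ‖lv h⁻¹.transpose n‖) : Covers h (2 ^ d / m) := by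
  have hu : IsUnit h.det := isUnit_iff_ne_zero.2 hh
  let E := EuclideanSpace ℝ (Fin d)
  let L : AddSubgroup E :=
    { carrier := {x | ∃ n : Fin d → ℤ, x = WithLp.toLp 2 (lv h n)}
      zero_mem' := ⟨0, by rw [lv_zero]; rfl⟩
      add_mem' := by
        rintro _ _ ⟨m, rfl⟩ ⟨n, rfl⟩
        exact ⟨m + n, by rw [lv_add]; rfl⟩
      neg_mem' := by
        rintro _ ⟨m, rfl⟩
        exact ⟨-m, by rw [lv_neg]; rfl⟩ }
  have hin : ∀ x y : E, inner ℝ x y = y.ofLp ⬝ᵥ x.ofLp := by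
    intro x y
    exact EuclideanSpace.inner_eq_star_dotProduct x y
  have hlv : ∀ (M : Matrix (Fin d) (Fin d) ℝ) (n : Fin d → ℤ) (y : Fin d → ℝ),
      y ⬝ᵥ lv M n = M.transpose.mulVec y ⬝ᵥ fun i => (n i : ℝ) := by
    intro M n y
    rw [lv, Matrix.dotProduct_mulVec, Matrix.mulVec_transpose]
  have hdual : ∀ y ∈ dualSet L, ∃ n : Fin d → ℤ, y = WithLp.toLp 2 (lv h⁻¹.transpose n) := by
    intro y hy
    have h1 : ∀ i, ∃ k : ℤ, h.transpose.mulVec y.ofLp i = k := by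
      intro i
      obtain ⟨k, hk⟩ := hy (WithLp.toLp 2 (lv h (Pi.single i 1))) ⟨_, rfl⟩
      refine ⟨k, ?_⟩
      rw [hin, hlv] at hk
      rw [← hk]
      have : (fun j => ((Pi.single i 1 : Fin d → ℤ) j : ℝ)) = Pi.single i 1 := by
        ext j
        by_cases hj : j = i
        · subst hj; simp
        · simp [hj]
      rw [this, dotProduct_single, mul_one]
    choose n hn using h1
    refine ⟨n, ?_⟩
    have h2 : h.transpose.mulVec y.ofLp = fun i => (n i : ℝ) := funext hn
    rw [lv, ← h2, Matrix.mulVec_mulVec, ← Matrix.transpose_mul, Matrix.mul_nonsing_inv _ hu]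
    simp
  have hdual' : ∀ n : Fin d → ℤ, WithLp.toLp 2 (lv h⁻¹.transpose n) ∈ dualSet L := by
    rintro n _ ⟨m, rfl⟩
    refine ⟨n ⬝ᵥ m, ?_⟩
    rw [hin, hlv, lv, Matrix.mulVec_mulVec, ← Matrix.transpose_mul, Matrix.nonsing_inv_mul _ hu]
    simp [dotProduct]
  have hspan : ∀ (M : Matrix (Fin d) (Fin d) ℝ), M.det ≠ 0 → ∀ S : Set E,
      (∀ n : Fin d → ℤ, WithLp.toLp 2 (lv M n) ∈ S) → Submodule.span ℝ S = ⊤ := by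
    intro M hM S hS
    rw [eq_top_iff]
    intro y _
    have h1 : y = ∑ i, (M⁻¹.mulVec y.ofLp i) • (WithLp.toLp 2 (lv M (Pi.single i 1)) : E) := by
      have h2 : y.ofLp = M.mulVec (M⁻¹.mulVec y.ofLp) := by
        rw [Matrix.mulVec_mulVec, Matrix.mul_nonsing_inv _ (isUnit_iff_ne_zero.2 hM)]; simp
      have h3 : ∀ i, lv M (Pi.single i 1) = M.col i := by
        intro i
        have : (fun j => ((Pi.single i 1 : Fin d → ℤ) j : ℝ)) = Pi.single i 1 := by
          ext j
          by_cases hj : j = i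
          · subst hj; simp
          · simp [hj]
        rw [lv, this, Matrix.mulVec_single_one]
      ext j
      conv_lhs => rw [h2]
      simp only [h3, WithLp.ofLp_sum, WithLp.ofLp_smul, Finset.sum_apply, Pi.smul_apply,
        smul_eq_mul, Matrix.col_apply]
      rw [Matrix.mulVec, dotProduct]
      exact Finset.sum_congr rfl fun i _ => mul_comm _ _
    rw [h1]
    exact Submodule.sum_mem _ fun i _ => Submodule.smul_mem _ _ (Submodule.subset_span (hS _))
  intro x
  obtain ⟨_, ⟨n, rfl⟩, hn⟩ := exists_norm_sub_le_of_dualSet d E L m (by simp [E]) hm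
    (hspan h hh _ fun n => ⟨n, rfl⟩)
    (hspan h⁻¹.transpose (by
      rw [Matrix.det_transpose, Matrix.det_nonsing_inv, Ring.inverse_eq_inv]
      exact inv_ne_zero hh) _ hdual')
    (fun y hy hy0 => by
      obtain ⟨n, rfl⟩ := hdual y hy
      refine (hb n ?_).trans ?_
      · rintro rfl
        apply hy0
        rw [lv_zero]; rfl
      · refine (pi_norm_le_iff_of_nonneg (norm_nonneg _)).2 fun i => ?_
        exact PiLp.norm_apply_le (WithLp.toLp 2 (lv h⁻¹.transpose n) : E) i)
    (WithLp.toLp 2 x)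
  refine ⟨n, ?_⟩
  have h1 : ‖x - lv h n‖ ≤ ‖WithLp.toLp 2 x - (WithLp.toLp 2 (lv h n) : E)‖ :=
    (pi_norm_le_iff_of_nonneg (norm_nonneg _)).2 fun i =>
      PiLp.norm_apply_le (WithLp.toLp 2 x - (WithLp.toLp 2 (lv h n) : E)) i
  refine h1.trans (hn.trans ?_)
  gcongr
  linarith

/-- Inverse transpose, the action on dual lattices. -/
def dualMat {d : ℕ} (g : SLR d) : Matrix (Fin d) (Fin d) ℝ := (g.1⁻¹)ᵀ

section
variable {d : ℕ}

lemma det_dualMat (g : SLR d) : (dualMat g).det = 1 := by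
  rw [dualMat, Matrix.det_transpose, Matrix.det_nonsing_inv, g.2, Ring.inverse_one]

lemma dualMat_mul (g h : SLR d) : dualMat (g * h) = dualMat g * dualMat h := by
  simp only [dualMat, Matrix.SpecialLinearGroup.coe_mul]
  rw [Matrix.mul_inv_rev, Matrix.transpose_mul]

lemma exists_lv_dualMat_eq (γ : Matrix.SpecialLinearGroup (Fin d) ℤ) (n : Fin d → ℤ) :
    ∃ m : Fin d → ℤ, lv (dualMat (Matrix.SpecialLinearGroup.map (Int.castRingHom ℝ) γ)) n =
      fun i => (m i : ℝ) := by
  refine ⟨(γ⁻¹).1ᵀ.mulVec n, ?_⟩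
  have h1 : dualMat (Matrix.SpecialLinearGroup.map (Int.castRingHom ℝ) γ) =
      ((γ⁻¹).1ᵀ).map (Int.castRingHom ℝ) := by
    rw [dualMat, Matrix.transpose_map]
    congr 1
    apply Matrix.inv_eq_left_inv
    have h2 := congrArg (fun A : Matrix.SpecialLinearGroup (Fin d) ℤ =>
      A.1.map (Int.castRingHom ℝ)) (inv_mul_cancel γ)
    simp only [Matrix.SpecialLinearGroup.coe_mul, Matrix.map_mul] at h2
    refine Eq.trans ?_ (h2.trans ?_)
    · rfl
    · simp
  rw [h1]
  ext i
  simp [lv, Matrix.mulVec, dotProduct]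

/-- Lattices whose transformed dual meets `B`. -/
def hitSet (M : Matrix (Fin d) (Fin d) ℝ) (B : Set (Fin d → ℝ)) : Set (LatticeSpace d) :=
  {x | ∃ n : Fin d → ℤ, lv (M * dualMat x.out) n ∈ B}

lemma mk_mem_hitSet {M : Matrix (Fin d) (Fin d) ℝ} {B : Set (Fin d → ℝ)} (g : SLR d) :
    (QuotientGroup.mk g : LatticeSpace d) ∈ hitSet M B ↔ ∃ n, lv (M * dualMat g) n ∈ B := by
  obtain ⟨⟨_, γ, rfl⟩, hγ⟩ := QuotientGroup.mk_out_eq_mul (SLZ d) g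
  simp only [hitSet, Set.mem_ofPred_eq, hγ]
  constructor
  · rintro ⟨n, hn⟩
    obtain ⟨m, hm⟩ := exists_lv_dualMat_eq γ n
    refine ⟨m, ?_⟩
    rw [dualMat_mul, ← mul_assoc, lv_mul, hm] at hn
    exact hn
  · rintro ⟨n, hn⟩
    obtain ⟨m, hm⟩ := exists_lv_dualMat_eq γ⁻¹ n
    refine ⟨m, ?_⟩
    have h1 : lv (dualMat (Matrix.SpecialLinearGroup.map (Int.castRingHom ℝ) γ)) m =
        fun i => (n i : ℝ) := by
      rw [lv, ← hm, ← lv_mul, ← dualMat_mul, ← map_mul, mul_inv_cancel, map_one]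
      simp [lv, dualMat]
    rw [dualMat_mul, ← mul_assoc, lv_mul, h1]
    exact hn

lemma measurable_slr_apply (i j : Fin d) : Measurable fun g : SLR d => g.1 i j := by
  have h1 : Measurable fun g : SLR d => g.1 := measurable_subtype_coe
  have h2 : Measurable fun A : Matrix (Fin d) (Fin d) ℝ => A i j :=
    (measurable_pi_apply j).comp (measurable_pi_apply i)
  exact h2.comp h1

lemma measurable_dualMat_apply (i j : Fin d) : Measurable fun g : SLR d => dualMat g i j := by
  have h1 : ∀ g : SLR d, dualMat g i j = (g.1.updateRow i (Pi.single j 1)).det := by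
    intro g
    rw [dualMat, Matrix.transpose_apply, Matrix.inv_def, g.2, Ring.inverse_one, one_smul,
      Matrix.adjugate_apply]
  simp_rw [h1, Matrix.det_apply, Matrix.updateRow_apply]
  refine Finset.measurable_sum _ fun σ _ => Measurable.const_smul ?_ _
  refine Finset.measurable_prod _ fun k _ => ?_
  by_cases h : σ k = i
  · simp [h]
  · simpa [h] using measurable_slr_apply (σ k) k

lemma measurableSet_hitSet (M : Matrix (Fin d) (Fin d) ℝ) {B : Set (Fin d → ℝ)}
    (hB : MeasurableSet B) : MeasurableSet (hitSet M B) := by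
  rw [measurableSet_quotient]
  have h1 : (Quotient.mk'' ⁻¹' hitSet M B : Set (SLR d)) =
      ⋃ n : Fin d → ℤ, (fun g => lv (M * dualMat g) n) ⁻¹' B := by
    ext g
    rw [Set.mem_iUnion]
    exact mk_mem_hitSet g
  rw [h1]
  refine MeasurableSet.iUnion fun n => ?_
  have h2 : Measurable fun g : SLR d => lv (M * dualMat g) n := by
    refine measurable_pi_lambda _ fun i => ?_
    simp only [lv, Matrix.mulVec, dotProduct, Matrix.mul_apply]
    exact Finset.measurable_sum _ fun j _ => (Finset.measurable_sum _ fun k _ =>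
      (measurable_dualMat_apply k j).const_mul _).mul_const _
  exact h2 hB

lemma smul_preimage_hitSet (h : SLR d) (M : Matrix (Fin d) (Fin d) ℝ) (B : Set (Fin d → ℝ)) :
    (h • ·) ⁻¹' hitSet M B = hitSet (M * dualMat h) B := by
  ext x
  obtain ⟨g, rfl⟩ := QuotientGroup.mk_surjective x
  change (QuotientGroup.mk (h * g) : LatticeSpace d) ∈ hitSet M B ↔ _
  rw [mk_mem_hitSet, mk_mem_hitSet, dualMat_mul, mul_assoc]

/-- Invariant measures on the space of lattices. -/
def IsInv (μ : Measure (LatticeSpace d)) : Prop :=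
  ∀ (g : SLR d) (s : Set (LatticeSpace d)), μ ((g • ·) ⁻¹' s) = μ s

lemma IsInv.measure_hitSet {μ : Measure (LatticeSpace d)} (hμ : IsInv μ)
    {K M : Matrix (Fin d) (Fin d) ℝ} (hK : K.det = 1) (hM : M.det ≠ 0) (B : Set (Fin d → ℝ)) :
    μ (hitSet (K * M) B) = μ (hitSet M B) := by
  have hu : IsUnit M.det := isUnit_iff_ne_zero.2 hM
  have hd : (M⁻¹ * K * M).det = 1 := by
    rw [Matrix.det_mul, Matrix.det_mul, hK, mul_one, ← Matrix.det_mul, Matrix.nonsing_inv_mul _ hu,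
      Matrix.det_one]
  let h : SLR d := ⟨((M⁻¹ * K * M)⁻¹)ᵀ, by
    rw [Matrix.det_transpose, Matrix.det_nonsing_inv, hd, Ring.inverse_one]⟩
  have hh : dualMat h = M⁻¹ * K * M := by
    change (((M⁻¹ * K * M)⁻¹)ᵀ⁻¹)ᵀ = _
    rw [Matrix.transpose_nonsing_inv, Matrix.transpose_transpose, Matrix.nonsing_inv_nonsing_inv]
    rw [hd]; exact isUnit_one
  rw [← hμ h (hitSet M B), smul_preimage_hitSet, hh, ← mul_assoc, ← mul_assoc,
    Matrix.mul_nonsing_inv _ hu, one_mul]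

end

lemma card_le_four_of_lt_add {S : Finset ℕ} (h : ∀ k ∈ S, ∀ l ∈ S, k < l + 4) : S.card ≤ 4 := by
  rcases S.eq_empty_or_nonempty with rfl | hne
  · simp
  · have : S ⊆ Finset.Ico (S.min' hne) (S.min' hne + 4) := fun k hk =>
      Finset.mem_Ico.2 ⟨S.min'_le k hk, h k hk _ (S.min'_mem hne)⟩
    simpa using Finset.card_le_card this

lemma card_filter_abs_add_mul_lt {a b c : ℝ} (N : ℕ) (hac : c ≤ 2 * |a|) (ha : a ≠ 0) :
    (Finset.univ.filter fun k : Fin N => |b + k * a| < c).card ≤ 4 := by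
  rw [← Finset.card_map Fin.valEmbedding]
  refine card_le_four_of_lt_add ?_
  simp only [Finset.mem_map, Finset.mem_filter, Finset.mem_univ, true_and, Fin.valEmbedding_apply]
  rintro _ ⟨k, hk, rfl⟩ _ ⟨l, hl, rfl⟩
  have ha' : 0 < |a| := abs_pos.2 ha
  have h1 : |((k : ℕ) : ℝ) - (l : ℕ)| * |a| < 4 * |a| := by
    rw [← abs_mul]
    have : ((k : ℕ) - (l : ℕ) : ℝ) * a = (b + k * a) - (b + l * a) := by ring
    rw [this]
    refine (abs_sub _ _).trans_lt ?_
    linarith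
  have h2 := lt_of_mul_lt_mul_right h1 ha'.le
  have h3 := (abs_lt.1 h2).2
  have : ((k : ℕ) : ℝ) < (l : ℕ) + 4 := by linarith
  exact_mod_cast this

section
variable {d : ℕ}

/-- The part of the box of radius `r` on which the coordinate `i₀` is not small. -/
def sliceBox (i₀ : Fin d) (r : ℝ) : Set (Fin d → ℝ) := {v | r / 2 ≤ |v i₀| ∧ ∀ i, |v i| < r}

lemma measurableSet_sliceBox (i₀ : Fin d) (r : ℝ) : MeasurableSet (sliceBox i₀ r) := by
  have h : sliceBox i₀ r = {v | r / 2 ≤ |v i₀|} ∩ ⋂ i, {v | |v i| < r} := by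
    ext; simp [sliceBox]
  rw [h]
  refine (measurableSet_le measurable_const ?_).inter
    (MeasurableSet.iInter fun i => measurableSet_lt ?_ measurable_const)
  · exact (measurable_pi_apply i₀).abs
  · exact (measurable_pi_apply i).abs

/-- The shear followed by the diagonal contraction of the coordinate `i₀`. -/
def shearMat (i₀ : Fin d) (T : ℝ) (c : Fin d → ℝ) : Matrix (Fin d) (Fin d) ℝ :=
  Matrix.diagonal (Function.update (fun _ => T) i₀ (T ^ (d - 1))⁻¹) *
    (1 + Matrix.vecMulVec (Function.update c i₀ 0) (Pi.single i₀ 1))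

lemma det_shearMat (i₀ : Fin d) {T : ℝ} (hT : T ≠ 0) (c : Fin d → ℝ) :
    (shearMat i₀ T c).det = 1 := by
  rw [shearMat, Matrix.det_mul, Matrix.det_diagonal, Finset.prod_update_of_mem (Finset.mem_univ _),
    Finset.prod_const, Matrix.vecMulVec_eq Unit, Matrix.det_one_add_replicateCol_mul_replicateRow,
    Finset.card_sdiff_of_subset (by simp)]
  simp [hT]

lemma shearMat_mulVec_self (i₀ : Fin d) (T : ℝ) (c v : Fin d → ℝ) :
    (shearMat i₀ T c).mulVec v i₀ = (T ^ (d - 1))⁻¹ * v i₀ := by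
  rw [shearMat, ← Matrix.mulVec_mulVec, Matrix.mulVec_diagonal, Matrix.add_mulVec,
    Matrix.vecMulVec_mulVec]
  simp

lemma shearMat_mulVec_of_ne {i₀ i : Fin d} (hi : i ≠ i₀) (T : ℝ) (c v : Fin d → ℝ) :
    (shearMat i₀ T c).mulVec v i = T * (v i + c i * v i₀) := by
  rw [shearMat, ← Matrix.mulVec_mulVec, Matrix.mulVec_diagonal, Matrix.add_mulVec,
    Matrix.vecMulVec_mulVec]
  simp [hi, mul_comm]

end

section
variable {d : ℕ}

lemma one_le_norm_intCast {n : Fin d → ℤ} (hn : n ≠ 0) : 1 ≤ ‖(fun i => (n i : ℝ))‖ := by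
  obtain ⟨i, hi⟩ := Function.ne_iff.1 hn
  refine le_trans ?_ (norm_le_pi_norm _ i)
  rw [Real.norm_eq_abs]
  exact_mod_cast Int.one_le_abs hi

lemma det_inv_transpose_ne_zero {h : Matrix (Fin d) (Fin d) ℝ} (hh : h.det ≠ 0) :
    (h⁻¹)ᵀ.det ≠ 0 := by
  rw [Matrix.det_transpose, Matrix.det_nonsing_inv, Ring.inverse_eq_inv]
  exact inv_ne_zero hh

lemma exists_le_norm_lv {h : Matrix (Fin d) (Fin d) ℝ} (hh : h.det ≠ 0) :
    ∃ m > 0, ∀ n : Fin d → ℤ, n ≠ 0 → m ≤ ‖lv h n‖ := by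
  obtain ⟨C, hC, hb⟩ := exists_norm_le_mul_norm_lv hh
  refine ⟨C⁻¹, by positivity, fun n hn => ?_⟩
  rw [inv_le_iff_one_le_mul₀ hC, mul_comm]
  exact (one_le_norm_intCast hn).trans (hb n)

lemma exists_covers {h : Matrix (Fin d) (Fin d) ℝ} (hh : h.det ≠ 0) : ∃ ρ, 0 ≤ ρ ∧ Covers h ρ := by
  obtain ⟨m, hm, hb⟩ := exists_le_norm_lv (det_inv_transpose_ne_zero hh)
  exact ⟨2 ^ d / m, by positivity, covers_of_dual hh hm hb⟩

open Classical in
/-- Few shears bring a lattice point into the slice box. -/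
lemma card_shear_hit_le {A : Matrix (Fin d) (Fin d) ℝ} (hA : A.det ≠ 0) {ρ : ℝ} (hρ : 0 ≤ ρ)
    (hc : Covers A ρ) {r : ℝ} (hr : 0 < r) (i₀ : Fin d) {T N : ℕ} (hT : 1 ≤ T) (hN : N = T ^ d)
    (hTρ : ρ ≤ 2 * (r * T ^ (d - 1))) :
    ((Finset.univ.filter fun y : Fin d → Fin N => ∃ n : Fin d → ℤ,
      (shearMat i₀ T fun i => ((y i : ℕ) : ℝ) / N).mulVec (lv A n) ∈ sliceBox i₀ r).card : ℝ)
      * |A.det| ≤ 32 ^ d * r ^ d * N ^ d := by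
  have hT0 : (0 : ℝ) < T := by exact_mod_cast hT
  have hT1 : (1 : ℝ) ≤ T := by exact_mod_cast hT
  have hd : 0 < d := i₀.pos
  have hNT : (N : ℝ) = T ^ d := by rw [hN]; push_cast; rfl
  have hN0 : (0 : ℝ) < N := by rw [hNT]; positivity
  set S : ℝ := r * T ^ (d - 1) with hS
  have hS0 : 0 < S := by positivity
  have hNS : (N : ℝ) = T * (S / r) := by
    rw [hNT, hS, mul_div_cancel_left₀ _ hr.ne', mul_comm, ← pow_succ]
    congr 1; omega
  set V := (finite_lv_norm_le hA 0 (2 * S)).toFinset with hV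
  let W := V.filter fun n => S / 2 ≤ |lv A n i₀|
  let F : (Fin d → ℤ) → (i : Fin d) → Finset (Fin N) := fun n i =>
    if i = i₀ then Finset.univ else
      Finset.univ.filter fun k => |lv A n i + k * (lv A n i₀ / N)| < r / T
  have hsub : (Finset.univ.filter fun y : Fin d → Fin N => ∃ n : Fin d → ℤ,
      (shearMat i₀ T fun i => ((y i : ℕ) : ℝ) / N).mulVec (lv A n) ∈ sliceBox i₀ r) ⊆
      W.biUnion fun n => Fintype.piFinset (F n) := by
    intro y hy
    obtain ⟨n, hn1, hn2⟩ := (Finset.mem_filter.1 hy).2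
    rw [shearMat_mulVec_self, abs_mul, abs_of_pos (by positivity)] at hn1
    have h0 := hn2 i₀
    rw [shearMat_mulVec_self, abs_mul, abs_of_pos (by positivity)] at h0
    have hlow : S / 2 ≤ |lv A n i₀| := by
      rw [inv_mul_eq_div, le_div_iff₀ (by positivity)] at hn1
      rw [hS]; linarith
    have hup : |lv A n i₀| < S := by
      rw [inv_mul_eq_div, div_lt_iff₀ (by positivity)] at h0
      exact h0
    have hi : ∀ i, i ≠ i₀ → |lv A n i + (y i : ℕ) * (lv A n i₀ / N)| < r / T := by
      intro i hi
      have h1 := hn2 i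
      rw [shearMat_mulVec_of_ne hi, abs_mul, abs_of_pos hT0] at h1
      rw [lt_div_iff₀ hT0, mul_comm]
      rwa [div_mul_eq_mul_div, mul_div_assoc] at h1
    refine Finset.mem_biUnion.2 ⟨n, Finset.mem_filter.2 ⟨?_, hlow⟩, ?_⟩
    · rw [hV, Set.Finite.mem_toFinset, Set.mem_ofPred_eq, zero_sub, norm_neg,
        pi_norm_le_iff_of_nonneg (by positivity)]
      intro i
      rw [Real.norm_eq_abs]
      by_cases h : i = i₀
      · rw [h]; linarith
      · have h1 := hi i h
        have h2 : |(y i : ℕ) * (lv A n i₀ / N)| ≤ S := by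
          rw [abs_mul, abs_div, Nat.abs_cast, Nat.abs_cast, mul_div_assoc',
            div_le_iff₀ hN0, mul_comm]
          have : ((y i : ℕ) : ℝ) ≤ N := by exact_mod_cast (y i).2.le
          gcongr
        have h3 : r / T ≤ S := by
          rw [div_le_iff₀ hT0, hS]
          have : (1 : ℝ) ≤ T ^ (d - 1) := one_le_pow₀ hT1
          nlinarith [mul_le_mul this hT1 (by norm_num) (by positivity)]
        have h4 : lv A n i = (lv A n i + (y i : ℕ) * (lv A n i₀ / N)) -
          (y i : ℕ) * (lv A n i₀ / N) := by ring
        rw [h4]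
        refine (abs_sub _ _).trans ?_
        linarith
    · rw [Fintype.mem_piFinset]
      intro i
      by_cases h : i = i₀
      · simp [F, h]
      · simpa [F, h] using hi i h
  have hF : ∀ n ∈ W, (Fintype.piFinset (F n)).card ≤ N * 4 ^ d := by
    intro n hn
    have hlow : S / 2 ≤ |lv A n i₀| := (Finset.mem_filter.1 hn).2
    rw [Fintype.card_piFinset, ← Finset.mul_prod_erase _ _ (Finset.mem_univ i₀)]
    refine Nat.mul_le_mul (by simp [F]) ?_
    refine (Finset.prod_le_pow_card _ _ 4 fun i hi => ?_).trans
      (Nat.pow_le_pow_right (by norm_num) ?_)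
    · have hi' := Finset.ne_of_mem_erase hi
      simp only [F, if_neg hi']
      refine card_filter_abs_add_mul_lt N ?_ ?_
      · rw [abs_div, Nat.abs_cast, div_le_iff₀ hT0, mul_assoc, div_mul_eq_mul_div, hNS]
        rw [mul_div_assoc', le_div_iff₀ (by positivity)]
        have : r * (T * (S / r)) = T * S := by field_simp
        rw [this]
        nlinarith
      · have : 0 < |lv A n i₀| := by linarith
        exact div_ne_zero (abs_pos.1 this) hN0.ne'
    · exact (Finset.card_le_univ _).trans (by simp)
  have hW : (W.card : ℝ) * |A.det| ≤ (2 * (2 * S + ρ)) ^ d :=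
    card_lv_le hA hc hρ (by positivity) 0 W fun n hn => by
      have := (Finset.mem_filter.1 hn).1
      rw [hV, Set.Finite.mem_toFinset, Set.mem_ofPred_eq] at this
      rwa [sub_zero, ← norm_neg, ← zero_sub]
  have hcard := (Finset.card_le_card hsub).trans
    ((Finset.card_biUnion_le).trans (Finset.sum_le_card_nsmul _ _ _ hF))
  rw [smul_eq_mul] at hcard
  have hcard' : ((Finset.univ.filter fun y : Fin d → Fin N => ∃ n : Fin d → ℤ,
      (shearMat i₀ T fun i => ((y i : ℕ) : ℝ) / N).mulVec (lv A n) ∈ sliceBox i₀ r).card : ℝ) ≤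
      W.card * (N * 4 ^ d) := by exact_mod_cast hcard
  calc _ ≤ W.card * (N * 4 ^ d) * |A.det| := by gcongr
    _ = W.card * |A.det| * (N * 4 ^ d) := by ring
    _ ≤ (8 * S) ^ d * (N * 4 ^ d) := by
      gcongr
      refine hW.trans (pow_le_pow_left₀ (by positivity) ?_ _)
      linarith
    _ = 32 ^ d * (S ^ d * N) := by
      rw [mul_pow]
      have : (32 : ℝ) ^ d = 8 ^ d * 4 ^ d := by rw [← mul_pow]; norm_num
      rw [this]; ring
    _ = _ := by
      have h1 : (T : ℝ) ^ (d - 1) * T = T ^ d := by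
        rw [← pow_succ]; congr 1; omega
      rw [hS, mul_pow, hNT, ← h1, mul_pow, mul_assoc]
      rw [show ((T : ℝ) ^ (d - 1) * T) = T ^ d from h1]
      ring

open Classical in
lemma IsInv.measure_sliceBox_le (hd : 2 ≤ d) {μ : Measure (LatticeSpace d)} [IsProbabilityMeasure μ]
    (hμ : IsInv μ) {M : Matrix (Fin d) (Fin d) ℝ} (hM : M.det ≠ 0) {r : ℝ} (hr : 0 < r)
    (i₀ : Fin d) :
    μ (hitSet M (sliceBox i₀ r)) ≤ ENNReal.ofReal (32 ^ d * r ^ d / |M.det|) := by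
  let N : ℕ → ℕ := fun T => (T + 1) ^ d
  let K : (T : ℕ) → (Fin d → Fin (N T)) → Matrix (Fin d) (Fin d) ℝ := fun T y =>
    shearMat i₀ (T + 1 : ℕ) fun i => ((y i : ℕ) : ℝ) / N T
  let H : (T : ℕ) → (Fin d → Fin (N T)) → Set (LatticeSpace d) := fun T y =>
    hitSet (K T y * M) (sliceBox i₀ r)
  let f : ℕ → LatticeSpace d → ℝ≥0∞ := fun T x =>
    (∑ y, (H T y).indicator 1 x) / (N T : ℝ≥0∞) ^ d
  have hN0 : ∀ T, (N T : ℝ≥0∞) ^ d ≠ 0 := fun T => by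
    simp [N]
  have hNt : ∀ T, (N T : ℝ≥0∞) ^ d ≠ ∞ := fun T => by simp
  have hHm : ∀ T y, MeasurableSet (H T y) := fun T y =>
    measurableSet_hitSet _ (measurableSet_sliceBox i₀ r)
  have hμH : ∀ T y, μ (H T y) = μ (hitSet M (sliceBox i₀ r)) := fun T y =>
    hμ.measure_hitSet (det_shearMat i₀ (by positivity) _) hM _
  have hcard : ∀ T, (Finset.univ : Finset (Fin d → Fin (N T))).card = (N T) ^ d := by simp
  have hfm : ∀ T, Measurable (f T) := fun T =>
    (Finset.measurable_sum _ fun y _ => measurable_one.indicator (hHm T y)).div_const _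
  have hlint : ∀ T, ∫⁻ x, f T x ∂μ = μ (hitSet M (sliceBox i₀ r)) := by
    intro T
    simp only [f, div_eq_mul_inv]
    rw [lintegral_mul_const _ (Finset.measurable_sum _ fun y _ =>
      measurable_one.indicator (hHm T y)), lintegral_finsetSum _ fun y _ =>
      measurable_one.indicator (hHm T y)]
    simp_rw [lintegral_indicator_one (hHm T _), hμH T, Finset.sum_const, hcard]
    rw [nsmul_eq_mul, Nat.cast_pow, mul_comm, ← mul_assoc, ENNReal.inv_mul_cancel (hN0 T) (hNt T),
      one_mul]
  have hbound : ∀ T x, f T x ≤ 1 := by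
    intro T x
    refine ENNReal.div_le_of_le_mul ?_
    calc ∑ y, (H T y).indicator 1 x ≤ ∑ y : Fin d → Fin (N T), (1 : ℝ≥0∞) := by
          refine Finset.sum_le_sum fun y _ => Set.indicator_le_self' (by simp) _
      _ = _ := by simp
  have hev : ∀ x, ∀ᶠ T in Filter.atTop, f T x ≤ ENNReal.ofReal (32 ^ d * r ^ d / |M.det|) := by
    intro x
    have hA : (M * dualMat x.out).det = M.det := by
      rw [Matrix.det_mul, det_dualMat, mul_one]
    obtain ⟨ρ, hρ, hc⟩ := exists_covers (h := M * dualMat x.out) (by rwa [hA])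
    have hlim : ∀ᶠ T : ℕ in Filter.atTop, ρ / (2 * r) ≤ T :=
      tendsto_natCast_atTop_atTop.eventually_ge_atTop _
    filter_upwards [hlim] with T hT
    have h1 := card_shear_hit_le (A := M * dualMat x.out) (by rwa [hA]) hρ hc hr i₀
      (T := T + 1) (N := N T) (by omega) rfl ?_
    · rw [hA, ← le_div_iff₀ (abs_pos.2 hM)] at h1
      refine ENNReal.div_le_of_le_mul ?_
      have h2 : ∑ y, (H T y).indicator (1 : LatticeSpace d → ℝ≥0∞) x = ENNReal.ofReal
          ((Finset.univ.filter fun y : Fin d → Fin (N T) => ∃ n : Fin d → ℤ,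
          (shearMat i₀ (T + 1 : ℕ) fun i => ((y i : ℕ) : ℝ) / N T).mulVec
            (lv (M * dualMat x.out) n) ∈ sliceBox i₀ r).card : ℝ) := by
        rw [ENNReal.ofReal_natCast, Finset.card_filter, Nat.cast_sum]
        refine Finset.sum_congr rfl fun y _ => ?_
        rw [apply_ite Nat.cast, Nat.cast_one, Nat.cast_zero]
        simp only [Set.indicator_apply, H, hitSet, Set.mem_ofPred_eq, K, mul_assoc _ M,
          lv_mul _ (M * _),
          Pi.one_apply]
      rw [h2, ← ENNReal.ofReal_natCast, ← ENNReal.ofReal_pow (by positivity),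
        ← ENNReal.ofReal_mul (by positivity)]
      refine ENNReal.ofReal_le_ofReal (h1.trans_eq ?_)
      ring
    · have h2 : ((T + 1 : ℕ) : ℝ) ≤ ((T + 1 : ℕ) : ℝ) ^ (d - 1) := by
        have : ((T + 1 : ℕ) : ℝ) ^ 1 ≤ ((T + 1 : ℕ) : ℝ) ^ (d - 1) :=
          pow_le_pow_right₀ (by norm_cast; omega) (by omega)
        simpa using this
      rw [div_le_iff₀ (by positivity)] at hT
      push_cast at h2 ⊢
      nlinarith
  calc μ (hitSet M (sliceBox i₀ r))
      = Filter.limsup (fun T => ∫⁻ x, f T x ∂μ) Filter.atTop := by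
        simp_rw [hlint]; exact Filter.limsup_const _ |>.symm
    _ ≤ ∫⁻ x, Filter.limsup (fun T => f T x) Filter.atTop ∂μ :=
        limsup_lintegral_le (fun _ => 1) hfm (fun T => Filter.Eventually.of_forall (hbound T))
          (by simp)
    _ ≤ ∫⁻ x, ENNReal.ofReal (32 ^ d * r ^ d / |M.det|) ∂μ :=
        lintegral_mono fun x => Filter.limsup_le_of_le (by isBoundedDefault) (hev x)
    _ = _ := by simp

/-- Lattices in which some nonzero dual vector is short. -/
def shortSet (M : Matrix (Fin d) (Fin d) ℝ) (r : ℝ) : Set (LatticeSpace d) :=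
  {x | ∃ n : Fin d → ℤ, n ≠ 0 ∧ ‖lv (M * dualMat x.out) n‖ < r}

lemma exists_nat_mul_mem {s r : ℝ} (hs : 0 < s) (hsr : s < r) :
    ∃ k : ℕ, r / 2 ≤ k * s ∧ k * s < r := by
  by_cases h : r / 2 ≤ s
  · exact ⟨1, by simpa using h, by simpa using hsr⟩
  · refine ⟨⌈r / (2 * s)⌉₊, ?_, ?_⟩
    · have := Nat.le_ceil (r / (2 * s))
      rw [div_le_iff₀ (by positivity)] at this
      linarith
    · have := Nat.ceil_lt_add_one (a := r / (2 * s)) (by have := hs.trans hsr; positivity)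
      have h1 : (⌈r / (2 * s)⌉₊ : ℝ) * s < (r / (2 * s) + 1) * s := by gcongr
      have h2 : (r / (2 * s) + 1) * s = r / 2 + s := by field_simp
      linarith

lemma shortSet_subset (hd : 0 < d) {M : Matrix (Fin d) (Fin d) ℝ} (hM : M.det ≠ 0) (r : ℝ) :
    shortSet M r ⊆ ⋃ i₀, hitSet M (sliceBox i₀ r) := by
  rintro x ⟨n, hn, hnr⟩
  set v := lv (M * dualMat x.out) n with hv
  have hv0 : v ≠ 0 := by
    intro h0
    apply hn
    apply lv_injective (h := M * dualMat x.out) (by rwa [Matrix.det_mul, det_dualMat, mul_one])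
    rw [← hv, h0, lv_zero]
  have : Nonempty (Fin d) := ⟨⟨0, hd⟩⟩
  obtain ⟨i₀, hi₀⟩ := Finite.exists_max fun i => |v i|
  have hnorm : ‖v‖ = |v i₀| := by
    refine le_antisymm ((pi_norm_le_iff_of_nonneg (abs_nonneg _)).2 hi₀) (norm_le_pi_norm v i₀)
  obtain ⟨k, hk1, hk2⟩ := exists_nat_mul_mem (norm_pos_iff.2 hv0) hnr
  refine Set.mem_iUnion.2 ⟨i₀, (k : ℤ) • n, ?_⟩
  have h1 : lv (M * dualMat x.out) ((k : ℤ) • n) = (k : ℝ) • v := by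
    rw [hv, lv, lv, ← Matrix.mulVec_smul]
    congr 1; ext i; simp
  rw [h1]
  refine ⟨?_, fun i => ?_⟩
  · rw [Pi.smul_apply, smul_eq_mul, abs_mul, Nat.abs_cast, ← hnorm]
    exact hk1
  · rw [Pi.smul_apply, smul_eq_mul, abs_mul, Nat.abs_cast]
    refine lt_of_le_of_lt ?_ hk2
    rw [hnorm]
    exact mul_le_mul_of_nonneg_left (hi₀ i) (Nat.cast_nonneg k)

/-- Short dual vectors are rare. -/
theorem IsInv.measure_shortSet_le (hd : 2 ≤ d) {μ : Measure (LatticeSpace d)}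
    [IsProbabilityMeasure μ] (hμ : IsInv μ) {M : Matrix (Fin d) (Fin d) ℝ} (hM : M.det ≠ 0) {r : ℝ}
    (hr : 0 < r) : μ (shortSet M r) ≤ ENNReal.ofReal (d * 32 ^ d * r ^ d / |M.det|) := by
  calc μ (shortSet M r) ≤ ∑ i₀, μ (hitSet M (sliceBox i₀ r)) :=
        (measure_mono (shortSet_subset (by omega) hM r)).trans (measure_iUnion_fintype_le _ _)
    _ ≤ ∑ i₀ : Fin d, ENNReal.ofReal (32 ^ d * r ^ d / |M.det|) :=
        Finset.sum_le_sum fun i₀ _ => hμ.measure_sliceBox_le hd hM hr i₀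
    _ = _ := by
      rw [Finset.sum_const, Finset.card_univ, Fintype.card_fin, ← ENNReal.ofReal_nsmul]
      congr 1
      rw [nsmul_eq_mul]
      ring

lemma measurableSet_shortSet {M : Matrix (Fin d) (Fin d) ℝ} (hM : M.det ≠ 0) (r : ℝ) :
    MeasurableSet (shortSet M r) := by
  have : shortSet M r = hitSet M (Metric.ball 0 r \ {0}) := by
    ext x
    refine exists_congr fun n => ?_
    have hinj := lv_injective (h := M * dualMat x.out)
      (by rwa [Matrix.det_mul, det_dualMat, mul_one])
    rw [Set.mem_sdiff, mem_ball_zero_iff, Set.mem_singleton_iff, ← lv_zero (M * dualMat x.out),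
      hinj.eq_iff, and_comm]
  rw [this]
  exact measurableSet_hitSet _ (Metric.isOpen_ball.measurableSet.diff (measurableSet_singleton 0))

end

lemma two_pow_min_le (d z m : ℕ) :
    (2 : ℝ≥0∞) ^ (d * min z m) ≤
      1 + ∑ i ∈ Finset.range m, 2 ^ (d * (i + 1)) * (if i < z then 1 else 0) := by
  rcases Nat.eq_zero_or_pos (min z m) with h | h
  · rw [h, mul_zero, pow_zero]; exact le_self_add
  · obtain ⟨j, hj⟩ := Nat.exists_eq_succ_of_ne_zero h.ne'
    have hjm : j < m := by omega
    have hjz : j < z := by omega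
    refine le_trans ?_ le_add_self
    refine le_trans ?_ (Finset.single_le_sum (f := fun i =>
      (2 : ℝ≥0∞) ^ (d * (i + 1)) * (if i < z then 1 else 0)) (fun _ _ => zero_le)
      (Finset.mem_range.2 hjm))
    simp [hj, hjz]

lemma tsum_inv_succ_sq_ne_top : ∑' J : ℕ, (((J : ℝ≥0∞) + 1) ^ 2)⁻¹ ≠ ∞ := by
  have h1 : Summable fun J : ℕ => (((J : ℝ) + 1) ^ 2)⁻¹ := by
    have := (summable_nat_add_iff 1).2 (Real.summable_nat_pow_inv (p := 2).2 (by norm_num))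
    simpa using this
  have := h1.tsum_ofReal_ne_top
  convert this using 3 with J
  rw [ENNReal.ofReal_inv_of_pos (by positivity), ENNReal.ofReal_pow (by positivity),
    ENNReal.ofReal_add (by positivity) (by norm_num)]
  simp

/-- Borel–Cantelli estimate for exponential sums of random levels with geometric tails. -/
lemma ae_exists_sum_two_pow_le {Ω ι : Type*} [MeasurableSpace Ω] {μ : Measure Ω}
    [IsProbabilityMeasure μ] {d e k : ℕ} (hed : e + 1 ≤ d) {c : ℝ≥0∞} (hc : c ≠ ∞)
    (S : ℕ → Finset ι) (hS : ∀ J, (S J).card ≤ k * 2 ^ (J * e)) (Z : ι → Ω → ℕ)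
    (hZm : ∀ a i, MeasurableSet {ω | i < Z a ω})
    (hZ : ∀ a i, μ {ω | i < Z a ω} ≤ c * (2 ^ (d * i))⁻¹) :
    ∀ᵐ ω ∂μ, ∃ C > (0 : ℝ), ∀ J : ℕ,
      ∑ a ∈ S J, (2 : ℝ) ^ (d * Z a ω) ≤ C * ((J + 1) ^ 3 * 2 ^ (J * e)) := by
  have h2 : ∀ n : ℕ, (2 : ℝ≥0∞) ^ n ≠ 0 := fun n => by simp
  have h2t : ∀ n : ℕ, (2 : ℝ≥0∞) ^ n ≠ ∞ := fun n => by simp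
  have hScard : ∀ J, ((S J).card : ℝ≥0∞) ≤ k * 2 ^ (J * e) := fun J => by exact_mod_cast hS J
  let Y : ℕ → Ω → ℝ≥0∞ := fun J ω => ∑ a ∈ S J,
    (1 + ∑ i ∈ Finset.range (2 * J), 2 ^ (d * (i + 1)) * {ω | i < Z a ω}.indicator 1 ω)
  let w : ℕ → ℝ≥0∞ := fun J => (((J : ℝ≥0∞) + 1) ^ 3 * 2 ^ (J * e))⁻¹
  have hY1m : ∀ a m, Measurable fun ω : Ω =>
      ∑ i ∈ Finset.range m, (2 : ℝ≥0∞) ^ (d * (i + 1)) * {ω | i < Z a ω}.indicator 1 ω := fun a m =>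
    Finset.measurable_sum _ fun i _ => (measurable_one.indicator (hZm a i)).const_mul _
  have hYm : ∀ J, Measurable (Y J) := fun J =>
    Finset.measurable_sum _ fun a _ => (hY1m a _).const_add 1
  set K : ℝ≥0∞ := k * (1 + 2 * (2 ^ d * c)) with hK
  have hKt : K ≠ ∞ := by
    rw [hK]
    exact ENNReal.mul_ne_top (by simp) (ENNReal.add_ne_top.2 ⟨by simp, ENNReal.mul_ne_top (by simp)
      (ENNReal.mul_ne_top (by simp) hc)⟩)
  have hYint : ∀ J, ∫⁻ ω, Y J ω ∂μ ≤ K * ((J + 1) * 2 ^ (J * e)) := by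
    intro J
    have h1 : ∀ a, ∫⁻ ω, (1 + ∑ i ∈ Finset.range (2 * J),
        (2 : ℝ≥0∞) ^ (d * (i + 1)) * {ω | i < Z a ω}.indicator 1 ω) ∂μ ≤
        (1 + 2 * (2 ^ d * c)) * (J + 1) := by
      intro a
      rw [lintegral_add_left measurable_const, lintegral_finsetSum _ fun i _ =>
        (measurable_one.indicator (hZm a i)).const_mul _]
      have h3 : ∀ i ∈ Finset.range (2 * J), ∫⁻ ω, (2 : ℝ≥0∞) ^ (d * (i + 1)) *
          {ω | i < Z a ω}.indicator 1 ω ∂μ ≤ 2 ^ d * c := by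
        intro i _
        rw [lintegral_const_mul _ (measurable_one.indicator (hZm a i)),
          lintegral_indicator_one (hZm a i)]
        calc (2 : ℝ≥0∞) ^ (d * (i + 1)) * μ {ω | i < Z a ω}
            ≤ 2 ^ (d * (i + 1)) * (c * (2 ^ (d * i))⁻¹) := by gcongr; exact hZ a i
          _ = 2 ^ d * c * (2 ^ (d * i) * (2 ^ (d * i))⁻¹) := by
            rw [mul_add, mul_one, pow_add]; ring
          _ = _ := by rw [ENNReal.mul_inv_cancel (h2 _) (h2t _), mul_one]
      have h4 := Finset.sum_le_card_nsmul _ _ _ h3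
      rw [Finset.card_range, nsmul_eq_mul] at h4
      calc _ ≤ 1 + ((2 * J : ℕ) : ℝ≥0∞) * (2 ^ d * c) := by
            gcongr
            simp
        _ ≤ _ := by
            push_cast
            have e1 : (1 + 2 * (2 ^ d * c)) * ((J : ℝ≥0∞) + 1) =
              1 + 2 * J * (2 ^ d * c) + (J + 2 * (2 ^ d * c)) := by ring
            rw [e1]
            exact le_self_add
    rw [lintegral_finsetSum _ fun a _ => (hY1m a _).const_add 1]
    refine (Finset.sum_le_card_nsmul _ _ _ fun a _ => h1 a).trans ?_
    rw [nsmul_eq_mul]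
    calc _ ≤ (k * 2 ^ (J * e) : ℝ≥0∞) * ((1 + 2 * (2 ^ d * c)) * (J + 1)) := by
          gcongr
          exact hScard J
      _ = _ := by rw [hK]; ring
  have hsum : ∫⁻ ω, ∑' J, w J * Y J ω ∂μ ≠ ∞ := by
    rw [lintegral_tsum fun J => ((hYm J).const_mul _).aemeasurable]
    have h1 : ∀ J, ∫⁻ ω, w J * Y J ω ∂μ ≤ K * (((J : ℝ≥0∞) + 1) ^ 2)⁻¹ := by
      intro J
      rw [lintegral_const_mul _ (hYm J)]
      calc w J * ∫⁻ ω, Y J ω ∂μ ≤ w J * (K * ((J + 1) * 2 ^ (J * e))) := by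
            gcongr
            exact hYint J
        _ = K * (((J : ℝ≥0∞) + 1) ^ 2)⁻¹ := by
          have hJ : ((J : ℝ≥0∞) + 1) ≠ 0 := by simp
          have hJt : ((J : ℝ≥0∞) + 1) ≠ ∞ := by simp
          simp only [w]
          rw [ENNReal.mul_inv (Or.inl (pow_ne_zero _ hJ)) (Or.inr (h2 _)), pow_succ _ 2,
            ENNReal.mul_inv (Or.inl (pow_ne_zero _ hJ)) (Or.inr hJ)]
          calc _ = K * (((J : ℝ≥0∞) + 1) ^ 2)⁻¹ * (((J : ℝ≥0∞) + 1)⁻¹ * (J + 1)) *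
                ((2 ^ (J * e))⁻¹ * 2 ^ (J * e)) := by ring
            _ = _ := by
              rw [ENNReal.inv_mul_cancel hJ hJt, ENNReal.inv_mul_cancel (h2 _) (h2t _), mul_one,
                mul_one]
    refine ne_top_of_le_ne_top ?_ (ENNReal.tsum_le_tsum h1)
    rw [ENNReal.tsum_mul_left]
    exact ENNReal.mul_ne_top hKt tsum_inv_succ_sq_ne_top
  have hbad : ∑' J, μ (⋃ a ∈ S J, {ω | 2 * J < Z a ω}) ≠ ∞ := by
    have h1 : ∀ J, μ (⋃ a ∈ S J, {ω | 2 * J < Z a ω}) ≤ k * c * (2⁻¹) ^ J := by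
      intro J
      refine (measure_biUnion_finset_le _ _).trans ?_
      refine (Finset.sum_le_card_nsmul _ _ _ fun a _ => hZ a (2 * J)).trans ?_
      rw [nsmul_eq_mul]
      calc _ ≤ (k * 2 ^ (J * e) : ℝ≥0∞) * (c * (2 ^ (J * e) * 2 ^ J)⁻¹) := by
            gcongr
            · exact hScard J
            · rw [← pow_add]
              refine pow_le_pow_right₀ (by norm_num) ?_
              nlinarith
        _ = k * c * (2⁻¹) ^ J * (2 ^ (J * e) * (2 ^ (J * e))⁻¹) := by
            rw [ENNReal.mul_inv (Or.inl (h2 _)) (Or.inr (h2 _)), ← ENNReal.inv_pow (n := J)]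
            ring
        _ = _ := by rw [ENNReal.mul_inv_cancel (h2 _) (h2t _), mul_one]
    refine ne_top_of_le_ne_top ?_ (ENNReal.tsum_le_tsum h1)
    rw [ENNReal.tsum_mul_left]
    refine ENNReal.mul_ne_top (ENNReal.mul_ne_top (by simp) hc) ?_
    rw [ENNReal.tsum_geometric]
    simp
  filter_upwards [ae_lt_top' (AEMeasurable.tsum fun J =>
    ((hYm J).const_mul (w J)).aemeasurable) hsum, ae_eventually_notMem hbad] with ω hω hev
  set t := (∑' J, w J * Y J ω).toReal with ht
  have hevb : ∀ᶠ J in Filter.atTop, (∑ a ∈ S J, (2 : ℝ) ^ (d * Z a ω)) /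
      ((J + 1) ^ 3 * 2 ^ (J * e)) ≤ t := by
    filter_upwards [hev] with J hJ
    have hle : ∀ a ∈ S J, Z a ω ≤ 2 * J := by
      intro a ha
      by_contra! hlt
      exact hJ (Set.mem_biUnion (show a ∈ (S J : Set ι) from ha) hlt)
    have h1 : ∑ a ∈ S J, (2 : ℝ≥0∞) ^ (d * Z a ω) ≤ Y J ω := by
      refine Finset.sum_le_sum fun a ha => ?_
      have := two_pow_min_le d (Z a ω) (2 * J)
      rw [min_eq_left (hle a ha)] at this
      simpa only [Set.indicator_apply, Set.mem_ofPred_eq, Pi.one_apply] using this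
    have h3 : w J * ∑ a ∈ S J, (2 : ℝ≥0∞) ^ (d * Z a ω) ≤ ∑' J, w J * Y J ω := by
      refine le_trans ?_ (ENNReal.le_tsum J)
      gcongr
    have h4 := ENNReal.toReal_mono hω.ne h3
    refine le_trans (le_of_eq ?_) h4
    rw [ENNReal.toReal_mul, ENNReal.toReal_sum fun a _ => h2t _, div_eq_inv_mul]
    congr 1
    · simp only [w, ENNReal.toReal_inv, ENNReal.toReal_mul, ENNReal.toReal_pow]
      rw [ENNReal.toReal_add (by simp) (by simp)]
      simp
  obtain ⟨B, hB⟩ := Filter.IsBoundedUnder.bddAbove_range ⟨t, by simpa using hevb⟩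
  refine ⟨max B 1, by positivity, fun J => ?_⟩
  have := hB ⟨J, rfl⟩
  rw [div_le_iff₀ (by positivity)] at this
  refine this.trans ?_
  gcongr
  exact le_max_left _ _

section
variable {d : ℕ}

/-- A level `i` with covering radius at most `2 ^ i`. -/
def lev (h : Matrix (Fin d) (Fin d) ℝ) : ℕ :=
  sInf {i | ∀ n : Fin d → ℤ, n ≠ 0 → 2 ^ d / 2 ^ i ≤ ‖lv h⁻¹ᵀ n‖}

lemma lev_nonempty {h : Matrix (Fin d) (Fin d) ℝ} (hh : h.det ≠ 0) :
    {i | ∀ n : Fin d → ℤ, n ≠ 0 → (2 : ℝ) ^ d / 2 ^ i ≤ ‖lv h⁻¹ᵀ n‖}.Nonempty := by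
  obtain ⟨m, hm, hb⟩ := exists_le_norm_lv (det_inv_transpose_ne_zero hh)
  obtain ⟨i, hi⟩ := pow_unbounded_of_one_lt (2 ^ d / m) (one_lt_two (α := ℝ))
  refine ⟨i, fun n hn => le_trans ?_ (hb n hn)⟩
  rw [div_lt_iff₀ hm] at hi
  rw [div_le_iff₀ (by positivity)]
  linarith

lemma covers_lev {h : Matrix (Fin d) (Fin d) ℝ} (hh : h.det ≠ 0) : Covers h (2 ^ lev h) := by
  have h1 := Nat.sInf_mem (lev_nonempty hh)
  have := covers_of_dual hh (by positivity) h1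
  convert this using 1
  change (2 : ℝ) ^ lev h = 2 ^ d / (2 ^ d / 2 ^ lev h)
  field_simp

lemma lt_lev_iff {h : Matrix (Fin d) (Fin d) ℝ} (hh : h.det ≠ 0) (i : ℕ) :
    i < lev h ↔ ∃ n : Fin d → ℤ, n ≠ 0 ∧ ‖lv h⁻¹ᵀ n‖ < 2 ^ d / 2 ^ i := by
  rw [← not_le, ← not_iff_not]
  push Not
  constructor
  · intro hi n hn
    refine le_trans ?_ (Nat.sInf_mem (lev_nonempty hh) n hn)
    gcongr
    · norm_num
    · exact hi
  · exact fun H => Nat.sInf_le H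

lemma setOf_lt_lev {A : Matrix (Fin d) (Fin d) ℝ} (hA : A.det ≠ 0) (i : ℕ) :
    {x : LatticeSpace d | i < lev (A * x.out.1)} = shortSet A⁻¹ᵀ (2 ^ d / 2 ^ i) := by
  ext x
  rw [Set.mem_ofPred_eq, lt_lev_iff (by rwa [Matrix.det_mul, x.out.2, mul_one])]
  simp only [shortSet, Set.mem_ofPred_eq, dualMat, Matrix.mul_inv_rev, Matrix.transpose_mul]

/-- Almost surely the levels along families of matrices of size `O(2 ^ (J (d - 1)))` have
controlled exponential sums. -/
theorem IsInv.ae_sum_lev_le (hd : 2 ≤ d) {μ : Measure (LatticeSpace d)}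
    [IsProbabilityMeasure μ] (hμ : IsInv μ) {ι : Type*} (A : ι → Matrix (Fin d) (Fin d) ℝ)
    {δ : ℝ} (hA0 : ∀ a, (A a).det ≠ 0) (hAδ : ∀ a, |(A a).det| ≤ δ) {k : ℕ} (S : ℕ → Finset ι)
    (hS : ∀ J, (S J).card ≤ k * 2 ^ (J * (d - 1))) :
    ∀ᵐ x ∂μ, ∃ C > (0 : ℝ), ∀ J : ℕ, ∑ a ∈ S J, (2 : ℝ) ^ (d * lev (A a * x.out.1)) ≤
      C * ((J + 1) ^ 3 * 2 ^ (J * (d - 1))) := by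
  refine ae_exists_sum_two_pow_le (c := ENNReal.ofReal (d * 32 ^ d * (2 ^ d) ^ d * δ))
    (by omega) (by simp) S hS (fun a (x : LatticeSpace d) => lev (A a * x.out.1)) ?_ ?_
  · intro a i
    rw [setOf_lt_lev (hA0 a)]
    exact measurableSet_shortSet (det_inv_transpose_ne_zero (hA0 a)) _
  · intro a i
    rw [setOf_lt_lev (hA0 a)]
    refine (hμ.measure_shortSet_le hd (det_inv_transpose_ne_zero (hA0 a)) (by positivity)).trans ?_
    have e1 : (2 : ℝ≥0∞) ^ (d * i) = ENNReal.ofReal (2 ^ (d * i)) := by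
      rw [ENNReal.ofReal_pow (by norm_num)]; simp
    rw [e1, ← ENNReal.ofReal_inv_of_pos (by positivity), ← ENNReal.ofReal_mul (by
      have := (abs_nonneg _).trans (hAδ a); positivity)]
    refine ENNReal.ofReal_le_ofReal ?_
    rw [Matrix.det_transpose, Matrix.det_nonsing_inv, Ring.inverse_eq_inv, abs_inv, div_inv_eq_mul,
      div_pow, ← pow_mul, ← pow_mul, mul_comm i d]
    calc (d : ℝ) * 32 ^ d * (2 ^ (d * d) / 2 ^ (d * i)) * |(A a).det|
        ≤ d * 32 ^ d * (2 ^ (d * d) / 2 ^ (d * i)) * δ := by gcongr; exact hAδ a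
      _ = _ := by ring

end

section
variable {d : ℕ}

lemma DiffBdd.of_iteratedFDeriv {E : Type*} [NormedAddCommGroup E] [NormedSpace ℝ E]
    (Λ : (Fin d → ℝ) →+ E) {ρ σ : ℝ} (hΛ : ∀ y, ‖y‖ ≤ ρ → ‖Λ y‖ ≤ σ) (v : E) (M : ℕ) :
    ∀ {G : E → ℝ} {C : ℝ}, ContDiff ℝ M G → (∀ x, ‖iteratedFDeriv ℝ M G x‖ ≤ C) →
      DiffBdd ρ (C * σ ^ M) M fun x => G (v + Λ x) := by
  induction M with
  | zero =>
    intro G C _ hC x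
    simpa using hC (v + Λ x)
  | succ M ih =>
    intro G C hG hC y hy
    have hGM : ContDiff ℝ M G := hG.of_le (by norm_cast; omega)
    have hs : ContDiff ℝ M fun w => G (w - Λ y) := hGM.comp (contDiff_id.sub contDiff_const)
    have h1 := ih (G := fun w => G w - G (w - Λ y)) (C := C * σ) (hGM.sub hs) fun x => by
      have e : (fun w => G w - G (w - Λ y)) = G - fun w => G (w - Λ y) := rfl
      rw [e, iteratedFDeriv_sub_apply hGM.contDiffAt hs.contDiffAt, iteratedFDeriv_comp_sub]
      have hdiff : Differentiable ℝ (iteratedFDeriv ℝ M G) :=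
        hG.differentiable_iteratedFDeriv (by norm_cast; omega)
      have hC0 : 0 ≤ C := (norm_nonneg _).trans (hC 0)
      have := Convex.norm_image_sub_le_of_norm_fderiv_le (𝕜 := ℝ) (s := Set.univ)
        (f := iteratedFDeriv ℝ M G) (C := C) (x := x - Λ y) (y := x) (fun z _ => hdiff z)
        (fun z _ => by rw [norm_fderiv_iteratedFDeriv]; exact hC z) convex_univ trivial trivial
      refine this.trans ?_
      rw [sub_sub_cancel]
      gcongr
      exact hΛ y hy
    rw [pow_succ']
    have e2 : (fun x => G (v + Λ x) - G (v + Λ (x - y))) =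
        fun x => (fun w => G w - G (w - Λ y)) (v + Λ x) := by
      ext x
      simp [add_sub_assoc]
    rw [e2, ← mul_assoc]
    exact h1

lemma exists_iteratedFDeriv_bound {E : Type*} [NormedAddCommGroup E] [NormedSpace ℝ E] {G : E → ℝ}
    (M : ℕ) (hG : ContDiff ℝ M G) (hc : HasCompactSupport G) :
    ∃ C, ∀ x, ‖iteratedFDeriv ℝ M G x‖ ≤ C :=
  (hc.iteratedFDeriv M).exists_bound_of_continuous (hG.continuous_iteratedFDeriv le_rfl)

/-- Linear changes of variables scale the discrepancy by the determinant. -/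
lemma latErr_mul (A h : Matrix (Fin d) (Fin d) ℝ) (hA : A.det ≠ 0) (f : (Fin d → ℝ) → ℝ) :
    latErr (A * h) (fun x => f (A⁻¹.mulVec x)) = |A.det| * latErr h f := by
  have hu : IsUnit A.det := hA.isUnit
  have h1 : ∫ x, f (A⁻¹.mulVec x) = |A.det| * ∫ x, f x := by
    have hd : LinearMap.det (Matrix.toLin' A⁻¹) ≠ 0 := by
      rw [LinearMap.det_toLin', Matrix.det_nonsing_inv]
      simpa using hA
    have hm := Measure.map_linearMap_addHaar_eq_smul_addHaar
      (μ := (volume : Measure (Fin d → ℝ))) hd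
    have hemb : MeasurableEmbedding (Matrix.toLin' A⁻¹) :=
      ((LinearEquiv.ofIsUnitDet (f := Matrix.toLin' A⁻¹) (v := Pi.basisFun ℝ (Fin d))
        (v' := Pi.basisFun ℝ (Fin d)) (by
          rw [← Matrix.toLin_eq_toLin', LinearMap.toMatrix_toLin, Matrix.det_nonsing_inv]
          simpa using hA)).toContinuousLinearEquiv.toHomeomorph.measurableEmbedding)
    have := hemb.integral_map (μ := volume) f
    rw [hm, LinearMap.det_toLin', Matrix.det_nonsing_inv, integral_smul_measure] at this
    simp only [Matrix.toLin'_apply] at this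
    rw [← this, ENNReal.toReal_ofReal (abs_nonneg _)]
    simp
  unfold latErr
  rw [h1, Matrix.det_mul, abs_mul]
  simp only [lv_mul, Matrix.mulVec_mulVec, Matrix.nonsing_inv_mul _ hu, Matrix.one_mulVec]
  ring

lemma BddInt.of_bdd {f : (Fin d → ℝ) → ℝ} (hm : Measurable f) {C : ℝ} (hC : ∀ x, |f x| ≤ C)
    {p : Fin d → ℝ} {R : ℝ} (hR : ∀ x, R < ‖x - p‖ → f x = 0) : BddInt f := by
  refine ⟨?_, ⟨C, hC⟩, ⟨R + ‖p‖, fun x hx => hR x ?_⟩⟩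
  · have h1 : IntegrableOn f (Metric.closedBall p R) := by
      refine Measure.integrableOn_of_bounded (M := C) measure_closedBall_lt_top.ne
        hm.aestronglyMeasurable (Filter.Eventually.of_forall hC)
    refine (integrableOn_iff_integrable_of_support_subset fun x hx => ?_).1 h1
    by_contra hn
    exact hx (hR x (by rwa [mem_closedBall_iff_norm, not_le] at hn))
  · have := norm_sub_norm_le x p
    linarith

lemma latErr_sum {h : Matrix (Fin d) (Fin d) ℝ} (hh : h.det ≠ 0) {ι : Type*} (S : Finset ι)
    {f : ι → (Fin d → ℝ) → ℝ} (hf : ∀ i ∈ S, BddInt (f i)) :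
    latErr h (fun x => ∑ i ∈ S, f i x) = ∑ i ∈ S, latErr h (f i) := by
  unfold latErr
  rw [Finset.sum_sub_distrib, integral_finsetSum _ fun i hi => (hf i hi).integrable,
    ← Finset.mul_sum, Summable.tsum_finsetSum fun i hi => (hf i hi).summable hh]

end

/-- A smooth step from `0` on `(-∞, 1]` to `1` on `[2, ∞)`. -/
def smoothStep (s : ℝ) : ℝ := Real.smoothTransition (s - 1)

/-- A smooth bump supported in `[1/2, 2]`. -/
def dyBump (s : ℝ) : ℝ := smoothStep (2 * s) - smoothStep s

/-- The dyadic pieces of the indicator of `[0, ∞)`, starting at scale `2 ^ lo`. -/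
def dyPiece (lo a : ℤ) (s : ℝ) : ℝ :=
  if a = lo then if 0 ≤ s then 1 - smoothStep (s / 2 ^ lo) else 0 else dyBump (s / 2 ^ a)

lemma smoothStep_mono {s t : ℝ} (h : s ≤ t) : smoothStep s ≤ smoothStep t :=
  Real.smoothTransition.monotone (by linarith)

lemma smoothStep_le_one (s : ℝ) : smoothStep s ≤ 1 := Real.smoothTransition.le_one _

lemma smoothStep_eq_zero {s : ℝ} (h : s ≤ 1) : smoothStep s = 0 :=
  Real.smoothTransition.zero_of_nonpos (by linarith)

lemma smoothStep_eq_one {s : ℝ} (h : 2 ≤ s) : smoothStep s = 1 :=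
  Real.smoothTransition.one_of_one_le (by linarith)

lemma contDiff_smoothStep {n : ℕ∞} : ContDiff ℝ n smoothStep :=
  Real.smoothTransition.contDiff.comp (contDiff_id.sub contDiff_const)

lemma contDiff_dyBump {n : ℕ∞} : ContDiff ℝ n dyBump :=
  (contDiff_smoothStep.comp (contDiff_const.mul contDiff_id)).sub contDiff_smoothStep

lemma dyBump_ne_zero {s : ℝ} (h : dyBump s ≠ 0) : 1 / 2 ≤ s ∧ s ≤ 2 := by
  constructor
  · by_contra! hs
    apply h
    rw [dyBump, smoothStep_eq_zero (by linarith), smoothStep_eq_zero (by linarith), sub_zero]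
  · by_contra! hs
    apply h
    rw [dyBump, smoothStep_eq_one (by linarith), smoothStep_eq_one (by linarith), sub_self]

lemma dyBump_nonneg (s : ℝ) : 0 ≤ dyBump s := by
  by_cases h : dyBump s = 0
  · exact h.ge
  · have := dyBump_ne_zero h
    exact sub_nonneg.2 (smoothStep_mono (by linarith))

lemma dyPiece_nonneg (lo a : ℤ) (s : ℝ) : 0 ≤ dyPiece lo a s := by
  unfold dyPiece
  split_ifs
  · exact sub_nonneg.2 (smoothStep_le_one _)
  · rfl
  · exact dyBump_nonneg _

lemma dyPiece_ne_zero {lo a : ℤ} {s : ℝ} (h : dyPiece lo a s ≠ 0) : 0 ≤ s ∧ s ≤ 2 * 2 ^ a := by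
  have h2 : (0 : ℝ) < 2 ^ a := by positivity
  unfold dyPiece at h
  split_ifs at h with h1 h3
  · refine ⟨h3, ?_⟩
    by_contra! hs
    apply h
    rw [smoothStep_eq_one, sub_self]
    rw [← h1, le_div_iff₀ h2]
    exact hs.le
  · exact absurd rfl h
  · obtain ⟨h4, h5⟩ := dyBump_ne_zero h
    rw [le_div_iff₀ h2] at h4
    rw [div_le_iff₀ h2] at h5
    exact ⟨by linarith, h5⟩

lemma dyPiece_ne_zero_of_ne {lo a : ℤ} (ha : a ≠ lo) {s : ℝ} (h : dyPiece lo a s ≠ 0) :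
    2 ^ a / 2 ≤ s := by
  have h2 : (0 : ℝ) < 2 ^ a := by positivity
  rw [dyPiece, if_neg ha] at h
  have h4 := (dyBump_ne_zero h).1
  rw [le_div_iff₀ h2] at h4
  linarith

lemma measurable_dyPiece (lo a : ℤ) : Measurable (dyPiece lo a) := by
  have h1 : Measurable smoothStep := (contDiff_smoothStep (n := 0)).continuous.measurable
  have h2 : Measurable dyBump := (contDiff_dyBump (n := 0)).continuous.measurable
  unfold dyPiece
  split_ifs
  · exact Measurable.ite measurableSet_Ici (by fun_prop) measurable_const
  · fun_prop

lemma sum_dyPiece {lo hi : ℤ} (h : lo ≤ hi) (s : ℝ) :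
    ∑ a ∈ Finset.Icc lo hi, dyPiece lo a s = if 0 ≤ s then 1 - smoothStep (s / 2 ^ hi) else 0 := by
  induction hi, h using Int.leInduction with
  | base => simp [dyPiece]
  | succ n hn ih =>
    have e : Finset.Icc lo (n + 1) = insert (n + 1) (Finset.Icc lo n) := by
      ext z; simp; omega
    rw [e, Finset.sum_insert (by simp), ih, dyPiece, if_neg (by omega), dyBump]
    have e2 : 2 * (s / 2 ^ (n + 1)) = s / (2 : ℝ) ^ n := by
      rw [zpow_add_one₀ (by norm_num)]
      field_simp
    rw [e2]
    split_ifs with hs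
    · ring
    · have h3 : (0 : ℝ) < 2 ^ n := by positivity
      have h4 : (0 : ℝ) < 2 ^ (n + 1) := by positivity
      rw [smoothStep_eq_zero, smoothStep_eq_zero]
      · simp
      · exact (div_nonpos_of_nonpos_of_nonneg (by linarith) h4.le).trans zero_le_one
      · exact (div_nonpos_of_nonpos_of_nonneg (by linarith) h3.le).trans zero_le_one

lemma sum_dyPiece_of_le {lo hi : ℤ} (h : lo ≤ hi) {s : ℝ} (hs : s ≤ 2 ^ hi) :
    ∑ a ∈ Finset.Icc lo hi, dyPiece lo a s = if 0 ≤ s then 1 else 0 := by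
  rw [sum_dyPiece h, smoothStep_eq_zero, sub_zero]
  exact (div_le_one (by positivity)).2 hs

/-- The smooth bump on `ℝ ^ ι`. -/
lemma exists_prod_dyBump_bound (ι : Type*) [Fintype ι] (M : ℕ) :
    ContDiff ℝ M (fun w : ι → ℝ => ∏ j, dyBump (w j)) ∧
      ∃ C, ∀ x, ‖iteratedFDeriv ℝ M (fun w : ι → ℝ => ∏ j, dyBump (w j)) x‖ ≤ C := by
  have h1 : ContDiff ℝ M (fun w : ι → ℝ => ∏ j, dyBump (w j)) :=
    contDiff_prod fun j _ => (contDiff_dyBump (n := M)).comp (contDiff_apply ℝ ℝ j)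
  refine ⟨h1, exists_iteratedFDeriv_bound M h1 ?_⟩
  refine HasCompactSupport.intro (K := Metric.closedBall 0 2) (isCompact_closedBall _ _) ?_
  intro w hw
  by_contra hn
  apply hw
  rw [mem_closedBall_zero_iff, pi_norm_le_iff_of_nonneg (by norm_num)]
  intro j
  have := dyBump_ne_zero (Finset.prod_ne_zero_iff.1 hn j (Finset.mem_univ j))
  rw [Real.norm_eq_abs, abs_le]
  constructor <;> linarith

/-- The matrix whose rows are selected from the family `ℓ`. -/
def rowMat {d : ℕ} {ι : Type*} (ℓ : ι → Fin d → ℝ) (B : Fin d → ι) : Matrix (Fin d) (Fin d) ℝ :=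
  Matrix.of fun r => ℓ (B r)

/-- The coordinates of `ℓ j` with respect to the basis `ℓ ∘ B`. -/
def rowCoef {d : ℕ} {ι : Type*} (ℓ : ι → Fin d → ℝ) (B : Fin d → ι) (j : ι) : Fin d → ℝ :=
  Matrix.vecMul (ℓ j) (rowMat ℓ B)⁻¹

lemma sum_rowCoef {d : ℕ} {ι : Type*} {ℓ : ι → Fin d → ℝ} {B : Fin d → ι}
    (hB : (rowMat ℓ B).det ≠ 0) (j : ι) : ∑ r, rowCoef ℓ B j r • ℓ (B r) = ℓ j := by
  have h : Matrix.vecMul (rowCoef ℓ B j) (rowMat ℓ B) = ℓ j := by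
    rw [rowCoef, Matrix.vecMul_vecMul, Matrix.nonsing_inv_mul _ hB.isUnit, Matrix.vecMul_one]
  refine Eq.trans ?_ h
  ext i
  simp [Matrix.vecMul, dotProduct, rowMat]

/-- A basis minimizing the total weight: every vector only involves basis vectors of smaller
weight. -/
lemma exists_greedy {d : ℕ} {ι : Type*} [Finite ι] {ℓ : ι → Fin d → ℝ}
    (hℓ : ∃ B, (rowMat ℓ B).det ≠ 0) (a : ι → ℤ) :
    ∃ B, (rowMat ℓ B).det ≠ 0 ∧ ∀ j r, rowCoef ℓ B j r ≠ 0 → a (B r) ≤ a j := by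
  classical
  obtain ⟨B, hB, hmin⟩ := Set.exists_min_image {B | (rowMat ℓ B).det ≠ 0}
    (fun B => ∑ r, a (B r)) (Set.toFinite _) hℓ
  refine ⟨B, hB, fun j r hr => ?_⟩
  have h1 : rowMat ℓ (Function.update B r j) =
      (rowMat ℓ B).updateRow r (∑ i, rowCoef ℓ B j i • (rowMat ℓ B) i) := by
    have e : ∑ i, rowCoef ℓ B j i • (rowMat ℓ B) i = ℓ j := sum_rowCoef hB j
    rw [e]
    ext i k
    by_cases hi : i = r
    · subst hi; simp [rowMat]
    · simp [rowMat, hi]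
  have h2 := hmin (Function.update B r j) (by
    rw [Set.mem_ofPred_eq, h1, Matrix.det_updateRow_sum]
    exact smul_ne_zero hr hB)
  have h3 : ∀ B' : Fin d → ι, ∑ i, a (B' i) = a (B' r) + ∑ i ∈ Finset.univ.erase r, a (B' i) :=
    fun B' => (Finset.add_sum_erase _ _ (Finset.mem_univ r)).symm
  simp only [h3] at h2
  have h4 : ∑ i ∈ Finset.univ.erase r, a (Function.update B r j i) =
      ∑ i ∈ Finset.univ.erase r, a (B i) :=
    Finset.sum_congr rfl fun i hi => by rw [Function.update_of_ne (Finset.ne_of_mem_erase hi)]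
  rw [h4, Function.update_self] at h2
  exact le_of_add_le_add_right h2

lemma exists_rowMat_det_ne_zero {d : ℕ} {ι : Type*} [Finite ι] {ℓ : ι → Fin d → ℝ}
    (hℓ : ∀ v : Fin d → ℝ, (∀ j, ℓ j ⬝ᵥ v = 0) → v = 0) : ∃ B, (rowMat ℓ B).det ≠ 0 := by
  have hspan : Submodule.span ℝ (Set.range ℓ) = ⊤ := by
    by_contra hne
    obtain ⟨f, hf, hle⟩ := Submodule.exists_le_ker_of_lt_top _ (lt_top_iff_ne_top.2 hne)
    apply hf
    have h0 : (fun i => f (Pi.single i 1)) = 0 := by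
      apply hℓ
      intro j
      have := hle (Submodule.subset_span ⟨j, rfl⟩)
      rw [LinearMap.mem_ker, LinearMap.pi_apply_eq_sum_univ f] at this
      simp only [smul_eq_mul] at this
      rw [← this]
      refine Finset.sum_congr rfl fun i _ => ?_
      refine congrArg (fun z => ℓ j i * f z) ?_
      ext k
      simp [Pi.single_apply, eq_comm]
    ext i
    simpa using congrFun h0 i
  have hfin : Module.finrank ℝ (Submodule.span ℝ (Set.range ℓ)) = d := by
    rw [hspan]; simp
  obtain ⟨f, hf, _, hli⟩ := Submodule.exists_fun_fin_finrank_span_eq ℝ (Set.range ℓ)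
  choose B hB using hf
  refine ⟨fun r => B (Fin.cast hfin.symm r), ?_⟩
  have : LinearIndependent ℝ (rowMat ℓ fun r => B (Fin.cast hfin.symm r)).row := by
    have h2 := hli.comp (Fin.cast hfin.symm) (Fin.cast_injective _)
    have e : (rowMat ℓ fun r => B (Fin.cast hfin.symm r)).row = f ∘ Fin.cast hfin.symm := by
      ext r i
      simp [rowMat, hB]
    rw [e]
    exact h2
  rw [Matrix.linearIndependent_rows_iff_isUnit, Matrix.isUnit_iff_isUnit_det] at this
  exact this.ne_zero

/-- Dyadic scales of numbers `s` near a fixed `τ`, bounded below by the error scale, take boundedly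
many values. -/
lemma exists_card_scale_le (C : ℝ) : ∃ W : ℕ, ∀ (τ : ℝ) (m : ℤ) (S : Finset ℤ),
    (∀ z ∈ S, m ≤ z ∧ ∃ s : ℝ, 2 ^ z / 2 ≤ s ∧ s ≤ 2 * 2 ^ z ∧ |s - τ| ≤ C * 2 ^ m) →
      S.card ≤ W := by
  obtain ⟨w, hw⟩ := pow_unbounded_of_one_lt (4 * C) (one_lt_two (α := ℝ))
  refine ⟨(w + 1) + 9, fun τ m S hS => ?_⟩
  have h1 : (S.filter (· ≤ m + w)).card ≤ w + 1 := by
    have : S.filter (· ≤ m + w) ⊆ Finset.Icc m (m + w) := fun z hz => by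
      rw [Finset.mem_filter] at hz
      exact Finset.mem_Icc.2 ⟨(hS z hz.1).1, hz.2⟩
    refine (Finset.card_le_card this).trans ?_
    simp
    omega
  have hkey : ∀ z ∈ S.filter (¬ · ≤ m + w), (2 : ℝ) ^ z / 4 < τ ∧ τ < 4 * 2 ^ z := by
    intro z hz
    rw [Finset.mem_filter] at hz
    obtain ⟨-, s, hs1, hs2, hs3⟩ := hS z hz.1
    have h2 : (2 : ℝ) ^ (m + w) ≤ 2 ^ z := zpow_le_zpow_right₀ (by norm_num) (by omega)
    rw [zpow_add₀ (by norm_num), zpow_natCast] at h2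
    have h3 : (0 : ℝ) < 2 ^ m := by positivity
    have h4 : 4 * C * 2 ^ m < 2 ^ z := by nlinarith
    rw [abs_le] at hs3
    have : (0 : ℝ) < 2 ^ z := by positivity
    constructor <;> linarith
  have h5 : (S.filter (¬ · ≤ m + w)).card ≤ 9 := by
    rcases (S.filter (¬ · ≤ m + w)).eq_empty_or_nonempty with h | ⟨z₀, hz₀⟩
    · rw [h]; simp
    · have hlt : ∀ z ∈ S.filter (¬ · ≤ m + w), ∀ z' ∈ S.filter (¬ · ≤ m + w), z ≤ z' + 4 := by
        intro z hz z' hz'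
        have h6 : (2 : ℝ) ^ z < 2 ^ (z' + 4) := by
          rw [zpow_add₀ (by norm_num)]
          have := (hkey z hz).1.trans (hkey z' hz').2
          norm_num
          linarith
        exact ((zpow_lt_zpow_iff_right₀ (by norm_num)).1 h6).le
      have : S.filter (¬ · ≤ m + w) ⊆ Finset.Icc (z₀ - 4) (z₀ + 4) := fun z hz => by
        have := hlt z hz z₀ hz₀
        have := hlt z₀ hz₀ z hz
        exact Finset.mem_Icc.2 ⟨by omega, by omega⟩
      refine (Finset.card_le_card this).trans ?_
      simp
      omega
  have := Finset.card_filter_add_card_filter_not (s := S) (· ≤ m + w)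
  omega

lemma sum_two_zpow_le_one (l : ℤ) (S : Finset ℤ) (hS : ∀ z ∈ S, l < z) :
    ∑ z ∈ S, (2 : ℝ) ^ (l - z) ≤ 1 := by
  have h1 : ∀ H, l ≤ H → ∑ z ∈ Finset.Ioc l H, (2 : ℝ) ^ (l - z) = 1 - 2 ^ (l - H) := by
    intro H hH
    induction H, hH using Int.leInduction with
    | base => simp
    | succ n hn ih =>
      have e : Finset.Ioc l (n + 1) = insert (n + 1) (Finset.Ioc l n) := by
        ext z; simp; omega
      rw [e, Finset.sum_insert (by simp), ih]
      have : (2 : ℝ) ^ (l - n) = 2 * 2 ^ (l - (n + 1)) := by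
        rw [← zpow_one_add₀ (by norm_num)]
        congr 1
        ring
      rw [this]
      ring
  rcases S.eq_empty_or_nonempty with h | h
  · rw [h]; simp
  · have hsub : S ⊆ Finset.Ioc l (S.max' h) := fun z hz =>
      Finset.mem_Ioc.2 ⟨hS z hz, S.le_max' z hz⟩
    refine (Finset.sum_le_sum_of_subset_of_nonneg hsub fun _ _ _ => by positivity).trans ?_
    rw [h1 _ (hS _ (S.max'_mem h)).le]
    have : (0 : ℝ) < 2 ^ (l - S.max' h) := by positivity
    linarith

lemma sum_two_zpow_le_of_card_fiber {α : Type*} (l : ℤ) (T : Finset α) (f : α → ℤ) {N : ℕ}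
    (hf : ∀ a ∈ T, l < f a) (hN : ∀ z, (T.filter (f · = z)).card ≤ N) :
    ∑ a ∈ T, (2 : ℝ) ^ (l - f a) ≤ N := by
  rw [← Finset.sum_fiberwise_of_maps_to (t := T.image f) fun a ha => Finset.mem_image_of_mem f ha]
  calc ∑ z ∈ T.image f, ∑ a ∈ T with f a = z, (2 : ℝ) ^ (l - f a)
      ≤ ∑ z ∈ T.image f, N * (2 : ℝ) ^ (l - z) := by
        refine Finset.sum_le_sum fun z _ => ?_
        rw [Finset.sum_congr rfl (g := fun _ => (2 : ℝ) ^ (l - z)) fun a ha => by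
          rw [(Finset.mem_filter.1 ha).2], Finset.sum_const, nsmul_eq_mul]
        gcongr
        exact hN z
    _ = N * ∑ z ∈ T.image f, (2 : ℝ) ^ (l - z) := by rw [Finset.mul_sum]
    _ ≤ N * 1 := by
        gcongr
        refine sum_two_zpow_le_one l _ fun z hz => ?_
        obtain ⟨a, ha, rfl⟩ := Finset.mem_image.1 hz
        exact hf a ha
    _ = N := mul_one _

section
variable {d : ℕ} {ι : Type*}

/-- The rows `ℓ ∘ B`, rescaled by `2 ^ (-s)`. -/
def shapeMat (ℓ : ι → Fin d → ℝ) (B : Fin d → ι) (s : Fin d → ℤ) : Matrix (Fin d) (Fin d) ℝ :=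
  Matrix.diagonal (fun r => (2 : ℝ) ^ (-s r)) * rowMat ℓ B

/-- The part of the polytope `{x | ∀ j, ℓ j ⬝ᵥ x ≤ v j}` at dyadic distances `2 ^ a j` from the
bounding hyperplanes. -/
def piece [Fintype ι] (ℓ : ι → Fin d → ℝ) (v : ι → ℝ) (lo : ℤ) (a : ι → ℤ) (x : Fin d → ℝ) : ℝ :=
  ∏ j, dyPiece lo (a j) (v j - ℓ j ⬝ᵥ x)

lemma shapeMat_mulVec (ℓ : ι → Fin d → ℝ) (B : Fin d → ι) (s : Fin d → ℤ) (x : Fin d → ℝ)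
    (r : Fin d) : (shapeMat ℓ B s).mulVec x r = 2 ^ (-s r) * (ℓ (B r) ⬝ᵥ x) := by
  rw [shapeMat, ← Matrix.mulVec_mulVec, Matrix.mulVec_diagonal]
  rfl

lemma det_shapeMat (ℓ : ι → Fin d → ℝ) (B : Fin d → ι) (s : Fin d → ℤ) :
    (shapeMat ℓ B s).det = 2 ^ (-∑ r, s r) * (rowMat ℓ B).det := by
  rw [shapeMat, Matrix.det_mul, Matrix.det_diagonal, ← Finset.sum_neg_distrib]
  congr 1
  induction (Finset.univ : Finset (Fin d)) using Finset.induction_on with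
  | empty => simp
  | insert i T hi ih =>
    rw [Finset.prod_insert hi, Finset.sum_insert hi, ih, zpow_add₀ (by norm_num)]

lemma dotProduct_eq_sum_rowCoef {ℓ : ι → Fin d → ℝ} {B : Fin d → ι} (hB : (rowMat ℓ B).det ≠ 0)
    (j : ι) (x : Fin d → ℝ) : ℓ j ⬝ᵥ x = ∑ r, rowCoef ℓ B j r * (ℓ (B r) ⬝ᵥ x) := by
  conv_lhs => rw [← sum_rowCoef hB j]
  rw [sum_dotProduct]
  simp

lemma dotProduct_inv_shapeMat {ℓ : ι → Fin d → ℝ} {B : Fin d → ι}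
    {s : Fin d → ℤ} (hA : (shapeMat ℓ B s).det ≠ 0) (r : Fin d) (z : Fin d → ℝ) :
    ℓ (B r) ⬝ᵥ (shapeMat ℓ B s)⁻¹.mulVec z = 2 ^ s r * z r := by
  have h := shapeMat_mulVec ℓ B s ((shapeMat ℓ B s)⁻¹.mulVec z) r
  rw [Matrix.mulVec_mulVec, Matrix.mul_nonsing_inv _ hA.isUnit, Matrix.one_mulVec] at h
  rw [h, ← mul_assoc, ← zpow_add₀ (by norm_num)]
  simp

lemma dotProduct_inv_shapeMat' {ℓ : ι → Fin d → ℝ} {B : Fin d → ι} (hB : (rowMat ℓ B).det ≠ 0)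
    {s : Fin d → ℤ} (hA : (shapeMat ℓ B s).det ≠ 0) (j : ι) (z : Fin d → ℝ) :
    ℓ j ⬝ᵥ (shapeMat ℓ B s)⁻¹.mulVec z = ∑ r, rowCoef ℓ B j r * (2 ^ s r * z r) := by
  rw [dotProduct_eq_sum_rowCoef hB]
  simp only [dotProduct_inv_shapeMat hA]

variable [Fintype ι] {ℓ : ι → Fin d → ℝ} {v : ι → ℝ} {lo : ℤ} {a : ι → ℤ} {B : Fin d → ι}
  {s : Fin d → ℤ} {q : ℤ}

lemma piece_nonneg (x : Fin d → ℝ) : 0 ≤ piece ℓ v lo a x :=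
  Finset.prod_nonneg fun _ _ => dyPiece_nonneg _ _ _

lemma piece_ne_zero {x : Fin d → ℝ} (h : piece ℓ v lo a x ≠ 0) (j : ι) :
    dyPiece lo (a j) (v j - ℓ j ⬝ᵥ x) ≠ 0 :=
  Finset.prod_ne_zero_iff.1 h j (Finset.mem_univ j)

lemma measurable_piece : Measurable (piece ℓ v lo a) := by
  refine Finset.measurable_prod _ fun j _ => (measurable_dyPiece _ _).comp ?_
  simp only [dotProduct]
  fun_prop

lemma piece_inv_eq_zero (hA : (shapeMat ℓ B s).det ≠ 0)
    (hq : ∀ r, a (B r) = s r + q) {z : Fin d → ℝ}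
    (hz : 2 * 2 ^ q < ‖z - fun r => (2 : ℝ) ^ (-s r) * v (B r)‖) :
    piece ℓ v lo a ((shapeMat ℓ B s)⁻¹.mulVec z) = 0 := by
  by_contra hne
  refine hz.not_ge ((pi_norm_le_iff_of_nonneg (by positivity)).2 fun r => ?_)
  have h := dyPiece_ne_zero (piece_ne_zero hne (B r))
  rw [dotProduct_inv_shapeMat hA, hq, zpow_add₀ (by norm_num)] at h
  have h2 : (0 : ℝ) < 2 ^ s r := by positivity
  rw [Pi.sub_apply, Real.norm_eq_abs, abs_sub_comm, zpow_neg]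
  have e : ((2 : ℝ) ^ s r)⁻¹ * v (B r) - z r = (2 ^ s r)⁻¹ * (v (B r) - 2 ^ s r * z r) := by
    field_simp
  rw [e, abs_of_nonneg (mul_nonneg (by positivity) h.1), inv_mul_le_iff₀ h2]
  linarith [h.2]

/-- Discrepancy of a single smooth piece, in coordinates adapted to its shape. -/
lemma exists_piece_bound (hB : (rowMat ℓ B).det ≠ 0) : ∃ C ≥ (0 : ℝ),
    ∀ (v : ι → ℝ) (lo q : ℤ) (a : ι → ℤ) (s : Fin d → ℤ) (g : Matrix (Fin d) (Fin d) ℝ),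
      g.det ≠ 0 → (∀ j r, rowCoef ℓ B j r ≠ 0 → a (B r) ≤ a j) → (∀ r, a (B r) = s r + q) →
      (∀ j, a j ≠ lo) → BddInt (fun z => piece ℓ v lo a ((shapeMat ℓ B s)⁻¹.mulVec z)) →
      (lev (shapeMat ℓ B s * g) : ℤ) < q →
      |latErr (shapeMat ℓ B s * g) fun z => piece ℓ v lo a ((shapeMat ℓ B s)⁻¹.mulVec z)| ≤
        C * 2 ^ (d * lev (shapeMat ℓ B s * g)) * 2 ^ ((lev (shapeMat ℓ B s * g) : ℤ) - q) := by
  obtain ⟨hG, CG, hCG⟩ := exists_prod_dyBump_bound ι (d + 1)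
  set K : ℝ := ∑ j, ∑ r, |rowCoef ℓ B j r| with hK
  have hK0 : 0 ≤ K := by positivity
  have hCG0 : 0 ≤ CG := (norm_nonneg _).trans (hCG 0)
  refine ⟨2 * (CG * K ^ (d + 1)) * (2 * (d + 4)) ^ d, by positivity, ?_⟩
  intro v lo q a s g hg hgr hq hlo hbi hl
  have hA : (shapeMat ℓ B s).det ≠ 0 := by
    rw [det_shapeMat]
    exact mul_ne_zero (by positivity) hB
  set h := shapeMat ℓ B s * g with hh
  have hdet : h.det ≠ 0 := by rw [hh, Matrix.det_mul]; exact mul_ne_zero hA hg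
  set l := lev h
  set Λ : (Fin d → ℝ) →+ (ι → ℝ) := AddMonoidHom.mk'
    (fun z j => -(2 ^ (-a j) * (ℓ j ⬝ᵥ (shapeMat ℓ B s)⁻¹.mulVec z))) (by
      intro x y
      ext j
      simp only [Matrix.mulVec_add, dotProduct_add, Pi.add_apply]
      ring) with hΛ
  have hΛb : ∀ y, ‖y‖ ≤ (2 : ℝ) ^ l → ‖Λ y‖ ≤ K * 2 ^ ((l : ℤ) - q) := by
    intro y hy
    rw [pi_norm_le_iff_of_nonneg (by positivity)]
    intro j
    change ‖-(2 ^ (-a j) * (ℓ j ⬝ᵥ (shapeMat ℓ B s)⁻¹.mulVec y))‖ ≤ _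
    rw [dotProduct_inv_shapeMat' hB hA, norm_neg, Finset.mul_sum]
    calc ‖∑ r, (2 : ℝ) ^ (-a j) * (rowCoef ℓ B j r * (2 ^ s r * y r))‖
        ≤ ∑ r, |rowCoef ℓ B j r| * 2 ^ ((l : ℤ) - q) := by
          refine norm_sum_le_of_le _ fun r _ => ?_
          by_cases hc : rowCoef ℓ B j r = 0
          · simp [hc]
          · have h1 : (2 : ℝ) ^ (-a j) * 2 ^ s r ≤ 2 ^ (-q) := by
              rw [← zpow_add₀ (by norm_num)]
              refine zpow_le_zpow_right₀ (by norm_num) ?_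
              have := hgr j r hc
              rw [hq] at this
              omega
            have h2 : |y r| ≤ 2 ^ l := (norm_le_pi_norm y r).trans hy
            rw [Real.norm_eq_abs, abs_mul, abs_mul, abs_mul,
              abs_of_pos (show (0 : ℝ) < 2 ^ (-a j) by positivity),
              abs_of_pos (show (0 : ℝ) < 2 ^ s r by positivity)]
            have e : (2 : ℝ) ^ ((l : ℤ) - q) = 2 ^ (-q) * 2 ^ l := by
              rw [sub_eq_neg_add, zpow_add₀ (by norm_num), zpow_natCast]
            rw [e]
            calc (2 : ℝ) ^ (-a j) * (|rowCoef ℓ B j r| * (2 ^ s r * |y r|))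
                = |rowCoef ℓ B j r| * ((2 ^ (-a j) * 2 ^ s r) * |y r|) := by ring
              _ ≤ _ := by gcongr
      _ = (∑ r, |rowCoef ℓ B j r|) * 2 ^ ((l : ℤ) - q) := by rw [Finset.sum_mul]
      _ ≤ K * 2 ^ ((l : ℤ) - q) := by
          gcongr
          exact Finset.single_le_sum (f := fun j => ∑ r, |rowCoef ℓ B j r|)
            (fun _ _ => by positivity) (Finset.mem_univ j)
  have hdb := DiffBdd.of_iteratedFDeriv Λ hΛb (fun j => 2 ^ (-a j) * v j) (d + 1) hG hCG
  have e1 : (fun x => (fun w : ι → ℝ => ∏ j, dyBump (w j)) ((fun j => 2 ^ (-a j) * v j) + Λ x)) =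
      fun z => piece ℓ v lo a ((shapeMat ℓ B s)⁻¹.mulVec z) := by
    ext z
    refine Finset.prod_congr rfl fun j _ => ?_
    rw [dyPiece, if_neg (hlo j)]
    congr 1
    change 2 ^ (-a j) * v j + -(2 ^ (-a j) * (ℓ j ⬝ᵥ (shapeMat ℓ B s)⁻¹.mulVec z)) = _
    rw [zpow_neg, div_eq_inv_mul]
    ring
  rw [e1] at hdb
  have hmain := abs_latErr_le_of_diffBdd hdet (covers_lev hdet) (by positivity) (d + 1)
    (R := 2 * 2 ^ q) (by positivity) hbi hdb fun z hz => piece_inv_eq_zero hA hq hz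
  refine hmain.trans ?_
  have hlq : (2 : ℝ) ^ l ≤ 2 ^ q := by
    rw [← zpow_natCast]
    exact zpow_le_zpow_right₀ (by norm_num) hl.le
  have e2 : (2 : ℝ) ^ ((l : ℤ) - q) = 2 ^ l * (2 ^ q)⁻¹ := by
    rw [sub_eq_add_neg, zpow_add₀ (by norm_num), zpow_natCast, zpow_neg]
  have h2q : (0 : ℝ) < 2 ^ q := by positivity
  calc 2 * (CG * (K * 2 ^ ((l : ℤ) - q)) ^ (d + 1)) *
        (2 * (2 * 2 ^ q + (((d + 1 : ℕ) : ℝ) + 1) * 2 ^ l)) ^ d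
      ≤ 2 * (CG * (K * 2 ^ ((l : ℤ) - q)) ^ (d + 1)) *
        (2 * (2 * 2 ^ q + (((d + 1 : ℕ) : ℝ) + 1) * 2 ^ q)) ^ d := by gcongr
    _ = 2 * (CG * K ^ (d + 1)) * (2 * (d + 4)) ^ d *
        ((2 ^ ((l : ℤ) - q) * 2 ^ q) ^ d * 2 ^ ((l : ℤ) - q)) := by
        push_cast
        rw [mul_pow K,
          show (2 : ℝ) * (2 * 2 ^ q + (d + 1 + 1) * 2 ^ q) = (2 * (d + 4)) * 2 ^ q by ring,
          mul_pow _ ((2 : ℝ) ^ q), mul_pow _ ((2 : ℝ) ^ q)]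
        ring
    _ = _ := by
        rw [e2, inv_mul_cancel_right₀ h2q.ne', ← pow_mul, mul_comm l d]
        ring

/-- Boundedly many nonzero pieces share their scales along a greedy basis. -/
lemma exists_card_piece_le (hB : (rowMat ℓ B).det ≠ 0) (hℓ : ∀ j, ℓ j ≠ 0) : ∃ N : ℕ,
    ∀ (v : ι → ℝ) (lo : ℤ) (α : Fin d → ℤ) (T : Finset (ι → ℤ)),
      (∀ a ∈ T, ∀ r, a (B r) = α r) →
      (∀ a ∈ T, ∀ j r, rowCoef ℓ B j r ≠ 0 → a (B r) ≤ a j) →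
      (∀ a ∈ T, (∀ j, a j ≠ lo) ∧ ∃ x, piece ℓ v lo a x ≠ 0) → T.card ≤ N := by
  classical
  set K : ℝ := ∑ j, ∑ r, |rowCoef ℓ B j r| with hK
  obtain ⟨W, hW⟩ := exists_card_scale_le (K * 2)
  refine ⟨W ^ Fintype.card ι, fun v lo α T hα hgr hT => ?_⟩
  have hsub : T ⊆ Fintype.piFinset fun j => T.image fun a => a j := fun a ha =>
    Fintype.mem_piFinset.2 fun j => Finset.mem_image_of_mem (fun a => a j) ha
  refine (Finset.card_le_card hsub).trans ?_
  rw [Fintype.card_piFinset]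
  refine (Finset.prod_le_pow_card _ _ W fun j _ => ?_).trans_eq (by rw [Finset.card_univ])
  have hne : (Finset.univ.filter fun r => rowCoef ℓ B j r ≠ 0).Nonempty := by
    by_contra hem
    rw [Finset.not_nonempty_iff_eq_empty, Finset.filter_eq_empty_iff] at hem
    apply hℓ j
    rw [← sum_rowCoef hB j]
    exact Finset.sum_eq_zero fun r hr => by rw [not_not.1 (hem hr), zero_smul]
  obtain ⟨r₀, hr₀, hmax⟩ := Finset.exists_max_image _ α hne
  refine hW (v j - ∑ r, rowCoef ℓ B j r * v (B r)) (α r₀) _ fun z hz => ?_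
  obtain ⟨a, ha, rfl⟩ := Finset.mem_image.1 hz
  obtain ⟨hlo, x, hx⟩ := hT a ha
  refine ⟨?_, v j - ℓ j ⬝ᵥ x, dyPiece_ne_zero_of_ne (hlo j) (piece_ne_zero hx j),
    (dyPiece_ne_zero (piece_ne_zero hx j)).2, ?_⟩
  · rw [← hα a ha]
    exact hgr a ha j r₀ (Finset.mem_filter.1 hr₀).2
  · have e : v j - ℓ j ⬝ᵥ x - (v j - ∑ r, rowCoef ℓ B j r * v (B r)) =
        ∑ r, rowCoef ℓ B j r * (v (B r) - ℓ (B r) ⬝ᵥ x) := by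
      rw [dotProduct_eq_sum_rowCoef hB]
      simp only [mul_sub, Finset.sum_sub_distrib]
      ring
    rw [e, mul_assoc]
    calc |∑ r, rowCoef ℓ B j r * (v (B r) - ℓ (B r) ⬝ᵥ x)|
        ≤ ∑ r, |rowCoef ℓ B j r| * (2 * 2 ^ α r₀) := by
          refine (Finset.abs_sum_le_sum_abs _ _).trans (Finset.sum_le_sum fun r _ => ?_)
          by_cases hc : rowCoef ℓ B j r = 0
          · simp [hc]
          · have h1 := dyPiece_ne_zero (piece_ne_zero hx (B r))
            rw [abs_mul, abs_of_nonneg h1.1]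
            have h2 : (2 : ℝ) ^ a (B r) ≤ 2 ^ α r₀ := by
              rw [hα a ha]
              exact zpow_le_zpow_right₀ (by norm_num) (hmax r (by simpa using hc))
            gcongr
            linarith [h1.2]
      _ = (∑ r, |rowCoef ℓ B j r|) * (2 * 2 ^ α r₀) := by rw [Finset.sum_mul]
      _ ≤ K * (2 * 2 ^ α r₀) := by
          gcongr
          exact Finset.single_le_sum (f := fun j => ∑ r, |rowCoef ℓ B j r|)
            (fun _ _ => by positivity) (Finset.mem_univ j)

end

section
variable {d : ℕ} {ι : Type*} [Fintype ι] {ℓ : ι → Fin d → ℝ} {B : Fin d → ι}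

/-- Discrepancy of the sum of all pieces of a given shape. -/
lemma exists_shape_bound (hB : (rowMat ℓ B).det ≠ 0) (hℓ : ∀ j, ℓ j ≠ 0) : ∃ C ≥ (0 : ℝ),
    ∀ (v : ι → ℝ) (lo : ℤ) (g : Matrix (Fin d) (Fin d) ℝ) (s : Fin d → ℤ) (q : (ι → ℤ) → ℤ)
      (S : Finset (ι → ℤ)), g.det ≠ 0 → ∑ r, s r ≤ d →
      (∀ a ∈ S, ∀ j r, rowCoef ℓ B j r ≠ 0 → a (B r) ≤ a j) →
      (∀ a ∈ S, ∀ r, a (B r) = s r + q a) →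
      (∀ x, ∑ a ∈ S, piece ℓ v lo a x ≤ 1) → (∀ a ∈ S, 0 < q a → ∀ j, a j ≠ lo) →
      |latErr g fun x => ∑ a ∈ S, piece ℓ v lo a x| ≤
        C * 2 ^ (d * lev (shapeMat ℓ B s * g)) := by
  classical
  obtain ⟨C₁, hC₁, hbig⟩ := exists_piece_bound hB
  obtain ⟨N, hN⟩ := exists_card_piece_le hB hℓ
  refine ⟨(2 * 6 ^ d + C₁ * N) * (2 ^ d / |(rowMat ℓ B).det|), by positivity, ?_⟩
  intro v lo g s q S hg hs hgr hq h1 hlo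
  have hA : (shapeMat ℓ B s).det ≠ 0 := by
    rw [det_shapeMat]
    exact mul_ne_zero (by positivity) hB
  have hAd : |(rowMat ℓ B).det| / 2 ^ d ≤ |(shapeMat ℓ B s).det| := by
    rw [det_shapeMat, abs_mul, abs_of_pos (show (0 : ℝ) < 2 ^ (-∑ r, s r) by positivity),
      div_eq_inv_mul, ← zpow_natCast, ← zpow_neg]
    gcongr
    · norm_num
  set h := shapeMat ℓ B s * g with hh
  have hdet : h.det ≠ 0 := by rw [hh, Matrix.det_mul]; exact mul_ne_zero hA hg
  set l := lev h
  set f : (ι → ℤ) → (Fin d → ℝ) → ℝ := fun a z => piece ℓ v lo a ((shapeMat ℓ B s)⁻¹.mulVec z)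
    with hf
  have hle : ∀ T ⊆ S, ∀ x, |∑ a ∈ T, piece ℓ v lo a x| ≤ 1 := by
    intro T hT x
    rw [abs_of_nonneg (Finset.sum_nonneg fun a _ => piece_nonneg x)]
    exact (Finset.sum_le_sum_of_subset_of_nonneg hT fun a _ _ => piece_nonneg x).trans (h1 x)
  have hfb : ∀ a ∈ S, ∀ z, |f a z| ≤ 1 := by
    intro a ha z
    have := hle {a} (by simpa using ha) ((shapeMat ℓ B s)⁻¹.mulVec z)
    simpa using this
  have hfs : ∀ a ∈ S, ∀ z, 2 * 2 ^ q a < ‖z - fun r => (2 : ℝ) ^ (-s r) * v (B r)‖ → f a z = 0 :=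
    fun a ha z hz => piece_inv_eq_zero hA (hq a ha) hz
  have hmeas : ∀ a, Measurable (f a) := fun a =>
    measurable_piece.comp (Continuous.matrix_mulVec continuous_const continuous_id).measurable
  have hbi : ∀ a ∈ S, BddInt (f a) := fun a ha =>
    BddInt.of_bdd (hmeas a) (hfb a ha) (hfs a ha)
  have hsmall : |∑ a ∈ S with ¬ (l : ℤ) < q a, latErr h (f a)| ≤ 2 * 6 ^ d * 2 ^ (d * l) := by
    rw [← latErr_sum hdet _ fun a ha => hbi a (Finset.mem_filter.1 ha).1]
    have := abs_latErr_le_of_bdd (f := fun z => ∑ a ∈ S with ¬ (l : ℤ) < q a, f a z) hdet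
      (covers_lev hdet) (by positivity) (R := 2 * 2 ^ l) (c := 1)
      (p := fun r => (2 : ℝ) ^ (-s r) * v (B r)) (by positivity)
      (fun z => hle _ (Finset.filter_subset _ _) _) (fun z hz => by
        refine Finset.sum_eq_zero fun a ha => hfs a (Finset.mem_filter.1 ha).1 z (hz.trans_le' ?_)
        have h2 := not_lt.1 (Finset.mem_filter.1 ha).2
        rw [← zpow_natCast]
        gcongr
        norm_num)
    refine this.trans_eq ?_
    rw [show (2 : ℝ) * (2 * 2 ^ l + 2 ^ l) = 6 * 2 ^ l by ring, mul_pow, ← pow_mul, mul_comm l d]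
    ring
  have hbigs : |∑ a ∈ S with (l : ℤ) < q a, latErr h (f a)| ≤ C₁ * N * 2 ^ (d * l) := by
    set T := S.filter fun a => (l : ℤ) < q a ∧ ∃ x, piece ℓ v lo a x ≠ 0 with hT
    have hTm : ∀ a ∈ T, a ∈ S ∧ (l : ℤ) < q a ∧ ∃ x, piece ℓ v lo a x ≠ 0 := by
      intro a ha; simpa [hT] using ha
    have hsub : ∑ a ∈ S with (l : ℤ) < q a, latErr h (f a) = ∑ a ∈ T, latErr h (f a) := by
      symm
      refine Finset.sum_subset (fun a ha => ?_) fun a ha hna => ?_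
      · exact Finset.mem_filter.2 ⟨(hTm a ha).1, (hTm a ha).2.1⟩
      · have h0 : ∀ x, piece ℓ v lo a x = 0 := by
          by_contra! hne
          rw [Finset.mem_filter] at ha
          exact hna (Finset.mem_filter.2 ⟨ha.1, ha.2, hne⟩)
        simp [latErr, hf, h0]
    rw [hsub]
    calc |∑ a ∈ T, latErr h (f a)| ≤ ∑ a ∈ T, C₁ * 2 ^ (d * l) * 2 ^ ((l : ℤ) - q a) := by
          refine (Finset.abs_sum_le_sum_abs _ _).trans (Finset.sum_le_sum fun a ha => ?_)
          obtain ⟨haS, hal, -⟩ := hTm a ha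
          exact hbig v lo (q a) a s g hg (hgr a haS) (hq a haS) (hlo a haS (by omega))
            (hbi a haS) hal
      _ = C₁ * 2 ^ (d * l) * ∑ a ∈ T, (2 : ℝ) ^ ((l : ℤ) - q a) := by rw [Finset.mul_sum]
      _ ≤ C₁ * 2 ^ (d * l) * N := by
          gcongr
          refine sum_two_zpow_le_of_card_fiber l T q (fun a ha => (hTm a ha).2.1) fun z => ?_
          refine hN v lo (fun r => s r + z) _ (fun a ha r => ?_) (fun a ha => ?_) fun a ha => ?_
          · rw [Finset.mem_filter] at ha
            rw [hq a (hTm a ha.1).1, ha.2]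
          · exact hgr a (hTm a (Finset.mem_filter.1 ha).1).1
          · have := hTm a (Finset.mem_filter.1 ha).1
            exact ⟨hlo a this.1 (by omega), this.2.2⟩
      _ = C₁ * N * 2 ^ (d * l) := by ring
  have htot : |latErr h fun z => ∑ a ∈ S, f a z| ≤ (2 * 6 ^ d + C₁ * N) * 2 ^ (d * l) := by
    rw [latErr_sum hdet S hbi,
      ← Finset.sum_filter_add_sum_filter_not S (fun a => (l : ℤ) < q a)]
    refine (abs_add_le _ _).trans ?_
    linarith
  have hmul := latErr_mul (shapeMat ℓ B s) g hA fun x => ∑ a ∈ S, piece ℓ v lo a x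
  have hpos : 0 < |(rowMat ℓ B).det| := abs_pos.2 hB
  have h3 : |(rowMat ℓ B).det| / 2 ^ d * |latErr g fun x => ∑ a ∈ S, piece ℓ v lo a x| ≤
      (2 * 6 ^ d + C₁ * N) * 2 ^ (d * l) := by
    refine (mul_le_mul_of_nonneg_right hAd (abs_nonneg _)).trans ?_
    rw [← abs_abs (Matrix.det _), ← abs_mul, ← hmul]
    exact htot
  rw [div_mul_eq_mul_div, div_le_iff₀ (by positivity)] at h3
  rw [mul_div_assoc', div_mul_eq_mul_div, le_div_iff₀ hpos]
  linarith

/-- Shapes of size at most `N`. -/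
def shapeSet (d : ℕ) (N : ℤ) : Finset (Fin d → ℤ) :=
  (Fintype.piFinset fun _ => Finset.Icc (-N) N).filter fun s => 0 ≤ ∑ r, s r ∧ ∑ r, s r ≤ d

open Classical in
/-- Discrepancy of a polytope in terms of the levels of the lattice along all shapes. -/
theorem exists_polytope_bound (hd : 0 < d) (hℓ : ∀ j, ℓ j ≠ 0)
    (hex : ∃ B, (rowMat ℓ B).det ≠ 0) : ∃ C > (0 : ℝ),
    ∀ (v : ι → ℝ) (κ : ℕ) (g : Matrix (Fin d) (Fin d) ℝ), g.det ≠ 0 →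
      (∃ R, ∀ x, (∀ j, ℓ j ⬝ᵥ x ≤ v j) → ‖x‖ ≤ R) →
      (∀ x, (∀ j, ℓ j ⬝ᵥ x ≤ v j) → ∀ j, v j - ℓ j ⬝ᵥ x ≤ 2 ^ κ) →
      |latErr g (Set.indicator {x | ∀ j, ℓ j ⬝ᵥ x ≤ v j} 1)| ≤
        C * ∑ p ∈ (Finset.univ.filter fun B => (rowMat ℓ B).det ≠ 0) ×ˢ shapeSet d (2 * d * κ),
          (2 : ℝ) ^ (d * lev (shapeMat ℓ p.1 p.2 * g)) := by
  have hcon : ∀ B : Fin d → ι, ∃ C ≥ (0 : ℝ), (rowMat ℓ B).det ≠ 0 →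
    ∀ (v : ι → ℝ) (lo : ℤ) (g : Matrix (Fin d) (Fin d) ℝ) (s : Fin d → ℤ) (q : (ι → ℤ) → ℤ)
      (S : Finset (ι → ℤ)), g.det ≠ 0 → ∑ r, s r ≤ d →
      (∀ a ∈ S, ∀ j r, rowCoef ℓ B j r ≠ 0 → a (B r) ≤ a j) →
      (∀ a ∈ S, ∀ r, a (B r) = s r + q a) →
      (∀ x, ∑ a ∈ S, piece ℓ v lo a x ≤ 1) → (∀ a ∈ S, 0 < q a → ∀ j, a j ≠ lo) →
      |latErr g fun x => ∑ a ∈ S, piece ℓ v lo a x| ≤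
        C * 2 ^ (d * lev (shapeMat ℓ B s * g)) := by
    intro B
    by_cases hB : (rowMat ℓ B).det ≠ 0
    · obtain ⟨C, hC, h⟩ := exists_shape_bound hB hℓ
      exact ⟨C, hC, fun _ => h⟩
    · exact ⟨0, le_rfl, fun h => absurd h hB⟩
  choose C hC0 hC using hcon
  choose B hB hgr using exists_greedy hex
  refine ⟨∑ B, C B + 1, by
    have := Finset.sum_nonneg fun B (_ : B ∈ Finset.univ) => hC0 B
    linarith, ?_⟩
  intro v κ g hg ⟨R, hR⟩ hκ
  set lo : ℤ := -(d * κ) with hlo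
  set Q : (Fin d → ι) → (ι → ℤ) → ℤ := fun B a => (∑ r, a (B r)) / d with hQ
  set S : Finset (ι → ℤ) := Fintype.piFinset fun _ => Finset.Icc lo κ with hS
  have hSm : ∀ a ∈ S, ∀ j, lo ≤ a j ∧ a j ≤ κ := fun a ha j =>
    Finset.mem_Icc.1 (Fintype.mem_piFinset.1 ha j)
  have hloκ : lo ≤ κ := by
    have : (0 : ℤ) ≤ d * κ := by positivity
    omega
  have hind : ∀ x, Set.indicator {x | ∀ j, ℓ j ⬝ᵥ x ≤ v j} (1 : (Fin d → ℝ) → ℝ) x =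
      ∑ a ∈ S, piece ℓ v lo a x := by
    intro x
    have hp : ∑ a ∈ S, piece ℓ v lo a x =
        ∏ j, ∑ z ∈ Finset.Icc lo (κ : ℤ), dyPiece lo z (v j - ℓ j ⬝ᵥ x) := by
      rw [Finset.prod_univ_sum]
      rfl
    rw [hp]
    by_cases hx : ∀ j, ℓ j ⬝ᵥ x ≤ v j
    · rw [Set.indicator_of_mem (by exact hx), Pi.one_apply]
      refine (Finset.prod_eq_one fun j _ => ?_).symm
      rw [sum_dyPiece_of_le hloκ (by rw [zpow_natCast]; exact hκ x hx j),
        if_pos (sub_nonneg.2 (hx j))]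
    · rw [Set.indicator_of_notMem (by exact hx)]
      push Not at hx
      obtain ⟨j, hj⟩ := hx
      refine (Finset.prod_eq_zero (Finset.mem_univ j) ?_).symm
      rw [sum_dyPiece hloκ, if_neg (by linarith)]
  have hle : ∀ T ⊆ S, ∀ x, ∑ a ∈ T, piece ℓ v lo a x ≤ 1 := by
    intro T hT x
    refine (Finset.sum_le_sum_of_subset_of_nonneg hT fun a _ _ => piece_nonneg x).trans ?_
    rw [← hind]
    exact Set.indicator_le_self' (fun _ _ => zero_le_one) x
  have hsupp : ∀ a x, piece ℓ v lo a x ≠ 0 → ‖x‖ ≤ R := fun a x hx =>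
    hR x fun j => sub_nonneg.1 (dyPiece_ne_zero (piece_ne_zero hx j)).1
  have hbi : ∀ T ⊆ S, BddInt fun x => ∑ a ∈ T, piece ℓ v lo a x := fun T hT =>
    BddInt.of_bdd (C := 1) (p := 0) (R := R) (Finset.measurable_sum _ fun a _ => measurable_piece)
      (fun x => by
        rw [abs_of_nonneg (Finset.sum_nonneg fun a _ => piece_nonneg x)]
        exact hle T hT x)
      fun x hx => Finset.sum_eq_zero fun a _ => by
        by_contra hne
        rw [sub_zero] at hx
        exact hx.not_ge (hsupp a x hne)
  set G : (ι → ℤ) → (Fin d → ι) × (Fin d → ℤ) := fun a => (B a, fun r => a (B a r) - Q (B a) a)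
    with hG
  set I := (Finset.univ.filter fun B : Fin d → ι => (rowMat ℓ B).det ≠ 0) ×ˢ
    shapeSet d (2 * d * κ) with hI
  have hd' : (0 : ℤ) < d := by exact_mod_cast hd
  have hsum : ∀ a, ∑ r, (a (B a r) - Q (B a) a) = (∑ r, a (B a r)) % d := by
    intro a
    rw [Finset.sum_sub_distrib, Finset.sum_const, Finset.card_univ, Fintype.card_fin, nsmul_eq_mul,
      Int.emod_def]
  have hmaps : ∀ a ∈ S, G a ∈ I := by
    intro a ha
    have h1 := hSm a ha
    have hdκ : (κ : ℤ) ≤ d * κ := le_mul_of_one_le_left (by positivity) (by omega)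
    have hq1 : Q (B a) a ≤ d * κ := by
      refine (Int.ediv_le_ediv hd' (Finset.sum_le_card_nsmul _ _ (d * κ : ℤ) fun r _ =>
        (h1 (B a r)).2.trans hdκ)).trans_eq ?_
      rw [Finset.card_univ, Fintype.card_fin, nsmul_eq_mul, Int.mul_ediv_cancel_left _ hd'.ne']
    have hq2 : lo ≤ Q (B a) a := by
      refine le_trans (le_of_eq ?_) (Int.ediv_le_ediv hd' (Finset.card_nsmul_le_sum Finset.univ
        (fun r => a (B a r)) lo fun r _ => (h1 (B a r)).1))
      rw [Finset.card_univ, Fintype.card_fin, nsmul_eq_mul, Int.mul_ediv_cancel_left _ hd'.ne']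
    rw [hI, Finset.mem_product]
    refine ⟨by simpa using hB a, Finset.mem_filter.2 ⟨Fintype.mem_piFinset.2 fun r => ?_, ?_, ?_⟩⟩
    · have := h1 (B a r)
      rw [Finset.mem_Icc]
      simp only [hG]
      rw [mul_assoc]
      constructor <;> omega
    · simp only [hG, hsum]
      exact Int.emod_nonneg _ hd'.ne'
    · simp only [hG, hsum]
      exact (Int.emod_lt_of_pos _ hd').le
  have hsplit : Set.indicator {x | ∀ j, ℓ j ⬝ᵥ x ≤ v j} (1 : (Fin d → ℝ) → ℝ) =
      fun x => ∑ p ∈ I, ∑ a ∈ S with G a = p, piece ℓ v lo a x := by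
    ext x
    rw [hind, Finset.sum_fiberwise_of_maps_to hmaps]
  rw [hsplit, latErr_sum hg I fun p _ => hbi _ (Finset.filter_subset _ _), Finset.mul_sum]
  refine (Finset.abs_sum_le_sum_abs _ _).trans (Finset.sum_le_sum fun p hp => ?_)
  rw [hI, Finset.mem_product, Finset.mem_filter] at hp
  have hps := (Finset.mem_filter.1 hp.2).2
  have hfib : ∀ a ∈ S.filter (G · = p), a ∈ S ∧ B a = p.1 ∧
      (∀ r, a (p.1 r) - Q p.1 a = p.2 r) := by
    intro a ha
    rw [Finset.mem_filter] at ha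
    obtain ⟨ha, rfl⟩ := ha
    exact ⟨ha, rfl, fun r => rfl⟩
  refine (hC p.1 hp.1.2 v lo g p.2 (Q p.1) (S.filter (G · = p)) hg hps.2 ?_ ?_
    (hle _ (Finset.filter_subset _ _)) ?_).trans ?_
  · intro a ha
    rw [← (hfib a ha).2.1]
    exact hgr a
  · intro a ha r
    rw [← (hfib a ha).2.2 r]
    ring
  · intro a ha hqa j hj
    obtain ⟨haS, hBa, -⟩ := hfib a ha
    obtain ⟨r, hr⟩ : ∃ r, rowCoef ℓ p.1 j r ≠ 0 := by
      by_contra! hall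
      apply hℓ j
      rw [← sum_rowCoef hp.1.2 j]
      exact Finset.sum_eq_zero fun r _ => by rw [hall r, zero_smul]
    have h1 : a (p.1 r) ≤ lo := by
      rw [← hj, ← hBa]
      exact hgr a j r (by rwa [hBa])
    have h2 : ∑ r, a (p.1 r) ≤ 0 := by
      rw [← Finset.add_sum_erase _ _ (Finset.mem_univ r)]
      have h3 := Finset.sum_le_card_nsmul (Finset.univ.erase r) (fun r => a (p.1 r)) (κ : ℤ)
        fun r _ => (hSm a haS _).2
      rw [Finset.card_erase_of_mem (Finset.mem_univ r), Finset.card_univ, Fintype.card_fin,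
        nsmul_eq_mul, Nat.cast_sub hd] at h3
      push_cast at h3
      nlinarith
    have h4 : Q p.1 a ≤ 0 := (Int.ediv_le_ediv hd' h2).trans_eq (by simp)
    omega
  · gcongr
    have := Finset.single_le_sum (f := C) (fun B _ => hC0 B) (Finset.mem_univ p.1)
    linarith

end

/-- Finitely generated cones are finite intersections of half-spaces. -/
lemma exists_halfspaces_cone {V : Type*} [AddCommGroup V] [Module ℝ V] [FiniteDimensional ℝ V]
    (T : Finset V) : ∃ F : Finset (V →ₗ[ℝ] ℝ), ∀ x,
      (∃ c : V → ℝ, (∀ y ∈ T, 0 ≤ c y) ∧ ∑ y ∈ T, c y • y = x) ↔ ∀ f ∈ F, 0 ≤ f x := by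
  classical
  induction T using Finset.induction_on with
  | empty =>
    set b := Module.finBasis ℝ V
    refine ⟨Finset.univ.image (fun i => b.coord i) ∪ Finset.univ.image (fun i => -b.coord i),
      fun x => ?_⟩
    simp only [Finset.notMem_empty, false_imp_iff, implies_true, Finset.sum_empty, true_and,
      exists_const]
    constructor
    · rintro rfl f _
      simp
    · intro h
      symm
      rw [← b.forall_coord_eq_zero_iff]
      intro i
      have h1 := h (b.coord i) (by simp)
      have h2 := h (-b.coord i) (by simp)
      rw [LinearMap.neg_apply] at h2
      linarith
  | insert w T hw ih =>
    obtain ⟨F, hF⟩ := ih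
    refine ⟨F.filter (fun f => 0 ≤ f w) ∪
      ((F.filter fun f => 0 < f w) ×ˢ F.filter fun f => f w < 0).image
        (fun p => p.1 w • p.2 - p.2 w • p.1), fun x => ?_⟩
    have hstep : (∃ c : V → ℝ, (∀ y ∈ insert w T, 0 ≤ c y) ∧ ∑ y ∈ insert w T, c y • y = x) ↔
        ∃ l : ℝ, 0 ≤ l ∧ ∀ f ∈ F, l * f w ≤ f x := by
      constructor
      · rintro ⟨c, hc, rfl⟩
        refine ⟨c w, hc w (Finset.mem_insert_self _ _), fun f hf => ?_⟩
        have := (hF (∑ y ∈ T, c y • y)).1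
          ⟨c, fun y hy => hc y (Finset.mem_insert_of_mem hy), rfl⟩ f hf
        rw [Finset.sum_insert hw, map_add, map_smul, smul_eq_mul]
        linarith
      · rintro ⟨l, hl, h⟩
        obtain ⟨c, hc, hx⟩ := (hF (x - l • w)).2 fun f hf => by
          rw [map_sub, map_smul, smul_eq_mul]
          linarith [h f hf]
        refine ⟨Function.update c w l, fun y hy => ?_, ?_⟩
        · by_cases hyw : y = w
          · subst hyw; simpa using hl
          · rw [Function.update_of_ne hyw]
            exact hc y ((Finset.mem_insert.1 hy).resolve_left hyw)
        · rw [Finset.sum_insert hw, Function.update_self]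
          have h2 : ∑ y ∈ T, Function.update c w l y • y = ∑ y ∈ T, c y • y :=
            Finset.sum_congr rfl fun y hy => by
              rw [Function.update_of_ne (ne_of_mem_of_not_mem hy hw)]
          rw [h2, hx]
          simp
    rw [hstep]
    constructor
    · rintro ⟨l, hl, h⟩ f hf
      rcases Finset.mem_union.1 hf with hf | hf
      · rw [Finset.mem_filter] at hf
        exact (mul_nonneg hl hf.2).trans (h f hf.1)
      · obtain ⟨⟨p, q⟩, hpq, rfl⟩ := Finset.mem_image.1 hf
        simp only [Finset.mem_product, Finset.mem_filter] at hpq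
        obtain ⟨⟨hp, hp0⟩, hq, hq0⟩ := hpq
        simp only [LinearMap.sub_apply, LinearMap.smul_apply, smul_eq_mul]
        have h1 := h p hp
        have h2 := h q hq
        nlinarith
    · intro h
      have hA : ∀ f ∈ F, 0 ≤ f w → 0 ≤ f x := fun f hf h0 =>
        h f (Finset.mem_union_left _ (Finset.mem_filter.2 ⟨hf, h0⟩))
      have hB : ∀ p ∈ F, 0 < p w → ∀ q ∈ F, q w < 0 → 0 ≤ p w * q x - q w * p x := by
        intro p hp hp0 q hq hq0
        exact h _ (Finset.mem_union_right _ (Finset.mem_image.2 ⟨(p, q), by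
          simp [hp, hp0, hq, hq0], rfl⟩))
      have hmax : ∃ l : ℝ, 0 ≤ l ∧ (∀ q ∈ F, q w < 0 → q x / q w ≤ l) ∧
          (l = 0 ∨ ∃ q ∈ F, q w < 0 ∧ l = q x / q w) := by
        rcases (F.filter fun f => f w < 0).eq_empty_or_nonempty with he | hne
        · refine ⟨0, le_rfl, fun q hq hq0 => ?_, Or.inl rfl⟩
          exact absurd (Finset.mem_filter.2 ⟨hq, hq0⟩) (he ▸ Finset.notMem_empty q)
        · obtain ⟨q, hq, hqm⟩ := Finset.exists_max_image _ (fun f => f x / f w) hne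
          rw [Finset.mem_filter] at hq
          refine ⟨max 0 (q x / q w), le_max_left _ _, fun p hp hp0 => ?_, ?_⟩
          · exact (hqm p (Finset.mem_filter.2 ⟨hp, hp0⟩)).trans (le_max_right _ _)
          · rcases max_choice 0 (q x / q w) with h' | h'
            · exact Or.inl h'
            · exact Or.inr ⟨q, hq.1, hq.2, h'⟩
      obtain ⟨l, hl, hlq, hl'⟩ := hmax
      refine ⟨l, hl, fun f hf => ?_⟩
      rcases lt_trichotomy (f w) 0 with h0 | h0 | h0
      · exact (div_le_iff_of_neg h0).1 (hlq f hf h0) |>.trans_eq' rfl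
      · rw [h0, mul_zero]
        exact hA f hf h0.ge
      · rcases hl' with rfl | ⟨q, hq, hq0, rfl⟩
        · rw [zero_mul]
          exact hA f hf h0.le
        · have h1 := hB f hf h0 q hq hq0
          rw [div_mul_eq_mul_div, div_le_iff_of_neg hq0]
          linarith

/-- Convex hulls of finite sets are finite intersections of half-spaces. -/
lemma exists_halfspaces_convexHull {d : ℕ} (T : Finset (Fin d → ℝ)) :
    ∃ F : Finset ((Fin d → ℝ) × ℝ), ∀ x,
      x ∈ convexHull ℝ (T : Set (Fin d → ℝ)) ↔ ∀ p ∈ F, p.1 ⬝ᵥ x ≤ p.2 := by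
  classical
  have hinj : Function.Injective fun y : Fin d → ℝ => (y, (1 : ℝ)) := fun y z h =>
    congrArg Prod.fst h
  obtain ⟨F, hF⟩ := exists_halfspaces_cone (T.image fun y => (y, (1 : ℝ)))
  refine ⟨F.image fun f => (fun i => -f (Pi.single i 1, 0), f (0, 1)), fun x => ?_⟩
  have h1 : x ∈ convexHull ℝ (T : Set (Fin d → ℝ)) ↔ ∀ f ∈ F, 0 ≤ f (x, 1) := by
    rw [← hF, Finset.mem_convexHull']
    constructor
    · rintro ⟨w, hw, hw1, rfl⟩
      refine ⟨fun p => w p.1, fun y hy => ?_, ?_⟩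
      · obtain ⟨z, hz, rfl⟩ := Finset.mem_image.1 hy
        exact hw z hz
      · rw [Finset.sum_image hinj.injOn]
        ext1
        · simp [Prod.fst_sum]
        · simp [Prod.snd_sum, hw1]
    · rintro ⟨c, hc, hx⟩
      rw [Finset.sum_image hinj.injOn] at hx
      refine ⟨fun y => c (y, 1), fun y hy => hc _ (Finset.mem_image_of_mem _ hy), ?_, ?_⟩
      · simpa [Prod.snd_sum] using congrArg Prod.snd hx
      · simpa [Prod.fst_sum] using congrArg Prod.fst hx
  rw [h1, Finset.forall_mem_image]
  refine forall₂_congr fun f _ => ?_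
  have h2 : f (x, 1) = f (0, 1) + ∑ i, x i * f (Pi.single i 1, 0) := by
    have h3 : f (x, 0) = ∑ i, x i * f (Pi.single i 1, 0) := by
      have := LinearMap.pi_apply_eq_sum_univ (f ∘ₗ LinearMap.inl ℝ (Fin d → ℝ) ℝ) x
      simp only [LinearMap.comp_apply, LinearMap.inl_apply, smul_eq_mul] at this
      rw [this]
      refine Finset.sum_congr rfl fun i _ => ?_
      refine congrArg (fun z => x i * f (z, 0)) ?_
      ext k
      simp [Pi.single_apply, eq_comm]
    rw [← h3, ← map_add]
    simp
  rw [h2]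
  simp only [dotProduct, neg_mul, Finset.sum_neg_distrib]
  simp only [mul_comm (f _)]
  constructor <;> intro h <;> linarith

section
variable {d : ℕ}

lemma card_shapeSet_le (m : ℕ) {N : ℕ} (hN : 1 ≤ N) :
    (shapeSet (m + 1) N).card ≤ (3 * N) ^ m * (m + 2) := by
  have hinj : Set.InjOn (fun s : Fin (m + 1) → ℤ => (Fin.tail s, ∑ r, s r))
      (shapeSet (m + 1) N) := by
    intro s _ s' _ h
    simp only [Prod.mk.injEq] at h
    obtain ⟨h1, h2⟩ := h
    have h3 : ∀ i : Fin m, s i.succ = s' i.succ := fun i => congrFun h1 i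
    simp only [Fin.sum_univ_succ, h3] at h2
    ext i
    refine Fin.cases ?_ h3 i
    linarith
  have hmaps : Set.MapsTo (fun s : Fin (m + 1) → ℤ => (Fin.tail s, ∑ r, s r))
      (shapeSet (m + 1) N)
      ((Fintype.piFinset fun _ : Fin m => Finset.Icc (-(N : ℤ)) N) ×ˢ
        Finset.Icc (0 : ℤ) (m + 1) : Finset _) := by
    intro s hs
    have hs' := Finset.mem_filter.1 (Finset.mem_coe.1 hs)
    rw [Finset.mem_coe, Finset.mem_product]
    refine ⟨Fintype.mem_piFinset.2 fun i => Fintype.mem_piFinset.1 hs'.1 i.succ, ?_⟩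
    rw [Finset.mem_Icc]
    exact_mod_cast hs'.2
  refine (Finset.card_le_card_of_injOn _ hmaps hinj).trans ?_
  rw [Finset.card_product, Fintype.card_piFinset, Finset.prod_const, Finset.card_univ,
    Fintype.card_fin, Int.card_Icc, Int.card_Icc]
  gcongr
  · omega
  · omega

open Classical in
/-- Shape matrices, replaced by the identity for inadmissible parameters. -/
def shapeMat' {ι : Type*} (ℓ : ι → Fin d → ℝ) (p : (Fin d → ι) × (Fin d → ℤ)) :
    Matrix (Fin d) (Fin d) ℝ :=
  if (rowMat ℓ p.1).det ≠ 0 ∧ 0 ≤ ∑ r, p.2 r then shapeMat ℓ p.1 p.2 else 1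

lemma shapeMat'_det_ne_zero {ι : Type*} (ℓ : ι → Fin d → ℝ) (p : (Fin d → ι) × (Fin d → ℤ)) :
    (shapeMat' ℓ p).det ≠ 0 := by
  unfold shapeMat'
  split_ifs with h
  · rw [det_shapeMat]
    exact mul_ne_zero (by positivity) h.1
  · simp

lemma shapeMat'_det_le {ι : Type*} [Fintype ι] (ℓ : ι → Fin d → ℝ)
    (p : (Fin d → ι) × (Fin d → ℤ)) :
    |(shapeMat' ℓ p).det| ≤ 1 + ∑ B : Fin d → ι, |(rowMat ℓ B).det| := by
  have h0 : 0 ≤ ∑ B : Fin d → ι, |(rowMat ℓ B).det| := by positivity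
  unfold shapeMat'
  split_ifs with h
  · rw [det_shapeMat, abs_mul, abs_of_pos (by positivity)]
    have h1 : (2 : ℝ) ^ (-∑ r, p.2 r) ≤ 1 := zpow_le_one_of_nonpos₀ (by norm_num) (by omega)
    have h2 := Finset.single_le_sum (f := fun B : Fin d → ι => |(rowMat ℓ B).det|)
      (fun _ _ => abs_nonneg _) (Finset.mem_univ p.1)
    refine (mul_le_of_le_one_left (abs_nonneg _) h1).trans ?_
    linarith
  · simpa using h0

open Classical in
/-- Almost surely the level sums over all shapes of size at most `2 ^ J` are controlled. -/
lemma IsInv.ae_sum_shape_le (hd : 2 ≤ d) {μ : Measure (LatticeSpace d)} [IsProbabilityMeasure μ]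
    (hμ : IsInv μ) {ι : Type*} [Fintype ι] (ℓ : ι → Fin d → ℝ) :
    ∀ᵐ x ∂μ, ∃ C > (0 : ℝ), ∀ J : ℕ,
      ∑ p ∈ (Finset.univ.filter fun B => (rowMat ℓ B).det ≠ 0) ×ˢ shapeSet d ((2 ^ J : ℕ) : ℤ),
          (2 : ℝ) ^ (d * lev (shapeMat ℓ p.1 p.2 * x.out.1)) ≤
        C * ((J + 1) ^ 3 * 2 ^ (J * (d - 1))) := by
  obtain ⟨m, rfl⟩ : ∃ m, d = m + 1 := ⟨d - 1, by omega⟩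
  have h := hμ.ae_sum_lev_le hd (shapeMat' ℓ) (shapeMat'_det_ne_zero ℓ) (shapeMat'_det_le ℓ)
    (k := Fintype.card (Fin (m + 1) → ι) * (3 ^ m * (m + 2)))
    (fun J => (Finset.univ.filter fun B => (rowMat ℓ B).det ≠ 0) ×ˢ
      shapeSet (m + 1) ((2 ^ J : ℕ) : ℤ)) fun J => by
    rw [Finset.card_product]
    have h1 := card_shapeSet_le m (N := 2 ^ J) Nat.one_le_two_pow
    have h2 := Finset.card_le_univ (Finset.univ.filter fun B => (rowMat ℓ B).det ≠ 0)
    refine (Nat.mul_le_mul h2 h1).trans_eq ?_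
    rw [mul_pow, Nat.add_sub_cancel, pow_mul]
    ring
  filter_upwards [h] with x ⟨C, hC, hx⟩
  refine ⟨C, hC, fun J => (Finset.sum_congr rfl fun p hp => ?_).trans_le (hx J)⟩
  rw [Finset.mem_product, Finset.mem_filter] at hp
  rw [shapeMat', if_pos ⟨hp.1.2, (Finset.mem_filter.1 hp.2).2.1⟩]

/-- Nonempty convex hulls of finite sets are intersections of proper half-spaces. -/
lemma exists_proper_halfspaces (T : Finset (Fin d → ℝ)) (hT : T.Nonempty) :
    ∃ F : Finset ((Fin d → ℝ) × ℝ), (∀ p ∈ F, p.1 ≠ 0) ∧ ∀ x,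
      x ∈ convexHull ℝ (T : Set (Fin d → ℝ)) ↔ ∀ p ∈ F, p.1 ⬝ᵥ x ≤ p.2 := by
  classical
  obtain ⟨F, hF⟩ := exists_halfspaces_convexHull T
  obtain ⟨y, hy⟩ := hT
  refine ⟨F.filter fun p => p.1 ≠ 0, fun p hp => (Finset.mem_filter.1 hp).2, fun x => ?_⟩
  rw [hF]
  refine ⟨fun h p hp => h p (Finset.mem_filter.1 hp).1, fun h p hp => ?_⟩
  by_cases h0 : p.1 = 0
  · have := (hF y).1 (subset_convexHull ℝ _ hy) p hp
    rw [h0, zero_dotProduct] at this ⊢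
    exact this
  · exact h p (Finset.mem_filter.2 ⟨hp, h0⟩)

lemma exists_sub_dotProduct_le {ι : Type*} [Finite ι] (ℓ : ι → Fin d → ℝ) (b : ι → ℝ)
    {K : Set (Fin d → ℝ)} (hK : IsCompact K) :
    ∃ C ≥ (2 : ℝ), ∀ x ∈ K, ∀ j, b j - ℓ j ⬝ᵥ x ≤ C := by
  have : Fintype ι := Fintype.ofFinite ι
  have hcont : Continuous fun x : Fin d → ℝ => fun j => b j - ℓ j ⬝ᵥ x := by
    refine continuous_pi fun j => ?_
    simp only [dotProduct]
    fun_prop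
  obtain ⟨C, hC⟩ := hK.exists_bound_of_continuousOn hcont.continuousOn
  refine ⟨max 2 C, le_max_left _ _, fun x hx j => ?_⟩
  exact (le_abs_self _).trans (((norm_le_pi_norm _ j).trans (hC x hx)).trans (le_max_right _ _))

lemma mem_image_smul_add_iff {ι : Type*} {ℓ : ι → Fin d → ℝ} {b : ι → ℝ} {K : Set (Fin d → ℝ)}
    (hK : ∀ x, x ∈ K ↔ ∀ j, ℓ j ⬝ᵥ x ≤ b j) {t : ℝ} (ht : 0 < t) (X x : Fin d → ℝ) :
    x ∈ (fun p => t • p + X) '' K ↔ ∀ j, ℓ j ⬝ᵥ x ≤ t * b j + ℓ j ⬝ᵥ X := by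
  constructor
  · rintro ⟨p, hp, rfl⟩ j
    rw [dotProduct_add, dotProduct_smul, smul_eq_mul]
    have := mul_le_mul_of_nonneg_left ((hK p).1 hp j) ht.le
    linarith
  · intro h
    refine ⟨t⁻¹ • (x - X), (hK _).2 fun j => ?_, ?_⟩
    · rw [dotProduct_smul, smul_eq_mul, inv_mul_le_iff₀ ht, dotProduct_sub]
      linarith [h j]
    · simp only
      rw [smul_inv_smul₀ ht.ne', sub_add_cancel]

lemma exists_polylog_le (d : ℕ) {ε : ℝ} (hε : 0 < ε) : ∃ D > (0 : ℝ), ∀ J : ℕ,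
    ((J : ℝ) + 1) ^ 3 * 2 ^ (J * (d - 1)) ≤ D * ((2 : ℝ) ^ J) ^ (((d - 1 : ℕ) : ℝ) + ε) := by
  have hr : (1 : ℝ) < 2 ^ ε := Real.one_lt_rpow (by norm_num) hε
  obtain ⟨D, hD⟩ := (tendsto_pow_const_div_const_pow_of_one_lt 3 hr).bddAbove_range
  refine ⟨max D 1 * 2 ^ ε, by positivity, fun J => ?_⟩
  have h1 := hD ⟨J + 1, rfl⟩
  simp only at h1
  rw [div_le_iff₀ (by positivity)] at h1
  rw [Real.rpow_add (by positivity), Real.rpow_natCast, ← pow_mul]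
  have e : ((2 : ℝ) ^ J) ^ ε = (2 ^ ε) ^ J := by
    rw [← Real.rpow_natCast, ← Real.rpow_mul (by norm_num), mul_comm, Real.rpow_mul (by norm_num),
      Real.rpow_natCast]
  rw [e]
  have h2 : ((J : ℝ) + 1) ^ 3 ≤ max D 1 * (2 ^ ε) ^ (J + 1) := by
    push_cast at h1
    refine h1.trans ?_
    gcongr
    exact le_max_left _ _
  calc ((J : ℝ) + 1) ^ 3 * 2 ^ (J * (d - 1))
      ≤ (max D 1 * (2 ^ ε) ^ (J + 1)) * 2 ^ (J * (d - 1)) := by gcongr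
    _ = _ := by rw [pow_succ]; ring

lemma exists_dyadic_log {C₀ : ℝ} (hC₀ : 2 ≤ C₀) (hd : 0 < d) : ∃ c > (0 : ℝ), ∀ t : ℝ, 2 ≤ t →
    ∃ κ J : ℕ, C₀ * t ≤ 2 ^ κ ∧ 2 * d * κ ≤ 2 ^ J ∧ (2 : ℝ) ^ J ≤ c * Real.log t := by
  have hlog2 : 0 < Real.log 2 := Real.log_pos (by norm_num)
  have hlogC : 0 < Real.log C₀ := Real.log_pos (by linarith)
  refine ⟨4 * d * ((Real.log C₀ / Real.log 2 + 1) / Real.log 2 + 1 / Real.log 2), by positivity,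
    fun t ht => ?_⟩
  have hlogt : Real.log 2 ≤ Real.log t := Real.log_le_log (by norm_num) ht
  set κ := ⌈Real.logb 2 (C₀ * t)⌉₊ with hκ
  have hlb : 0 < Real.logb 2 (C₀ * t) := Real.logb_pos (by norm_num) (by nlinarith)
  have hκ1 : 1 ≤ κ := Nat.one_le_iff_ne_zero.2 (Nat.ceil_pos.2 hlb).ne'
  have hκ2 : (κ : ℝ) ≤
      ((Real.log C₀ / Real.log 2 + 1) / Real.log 2 + 1 / Real.log 2) * Real.log t := by
    have h1 : (κ : ℝ) ≤ Real.logb 2 (C₀ * t) + 1 := (Nat.ceil_lt_add_one hlb.le).le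
    rw [Real.logb, Real.log_mul (by positivity) (by positivity)] at h1
    refine h1.trans ?_
    have h2 : Real.log C₀ ≤ Real.log C₀ / Real.log 2 * Real.log t := by
      rw [div_mul_eq_mul_div, le_div_iff₀ hlog2]
      gcongr
    have h3 : 1 ≤ 1 / Real.log 2 * Real.log t := by
      rw [div_mul_eq_mul_div, one_mul, le_div_iff₀ hlog2]
      linarith
    have h4 : (Real.log C₀ + Real.log t) / Real.log 2 ≤
        (Real.log C₀ / Real.log 2 + 1) / Real.log 2 * Real.log t := by
      rw [div_mul_eq_mul_div]
      gcongr
      linarith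
    linarith
  refine ⟨κ, Nat.clog 2 (2 * d * κ), ?_, Nat.le_pow_clog (by norm_num) _, ?_⟩
  · calc C₀ * t = 2 ^ Real.logb 2 (C₀ * t) :=
          (Real.rpow_logb (by norm_num) (by norm_num) (by positivity)).symm
      _ ≤ 2 ^ (κ : ℝ) := Real.rpow_le_rpow_of_exponent_le (by norm_num) (Nat.le_ceil _)
      _ = 2 ^ κ := Real.rpow_natCast _ _
  · have h1 : 1 < 2 * d * κ := by
      have : 1 ≤ d * κ := Nat.mul_pos hd hκ1
      nlinarith
    have h2 := Nat.pow_pred_clog_lt_self (b := 2) (by norm_num) h1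
    have h3 : 0 < Nat.clog 2 (2 * d * κ) := Nat.clog_pos (by norm_num) h1
    have h4 : 2 ^ Nat.clog 2 (2 * d * κ) ≤ 4 * d * κ := by
      have e : Nat.clog 2 (2 * d * κ) = (Nat.clog 2 (2 * d * κ)).pred + 1 :=
        (Nat.succ_pred_eq_of_pos h3).symm
      rw [e, pow_succ]
      linarith
    have h5 : (2 : ℝ) ^ Nat.clog 2 (2 * d * κ) ≤ 4 * d * κ := by exact_mod_cast h4
    refine h5.trans ?_
    rw [mul_assoc (4 * (d : ℝ))]
    gcongr

lemma shapeSet_mono {M N : ℤ} (h : M ≤ N) : shapeSet d M ⊆ shapeSet d N := by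
  intro s hs
  rw [shapeSet, Finset.mem_filter, Fintype.mem_piFinset] at hs ⊢
  refine ⟨fun i => ?_, hs.2⟩
  have := hs.1 i
  rw [Finset.mem_Icc] at this ⊢
  constructor <;> omega

/-- Almost sure polylogarithmic discrepancy for polytopes in coordinates. -/
theorem IsInv.ae_abs_latErr_le (hd : 2 ≤ d) {μ : Measure (LatticeSpace d)}
    [IsProbabilityMeasure μ] (hμ : IsInv μ) (T : Finset (Fin d → ℝ)) (hT : T.Nonempty) :
    ∀ᵐ x ∂μ, ∀ ε > (0 : ℝ), ∃ C > (0 : ℝ), ∀ t : ℝ, 2 ≤ t → ∀ X : Fin d → ℝ,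
      |latErr x.out.1 (Set.indicator
          ((fun p => t • p + X) '' convexHull ℝ (T : Set (Fin d → ℝ))) 1)| ≤
        C * Real.log t ^ ((d : ℝ) - 1 + ε) := by
  classical
  set K := convexHull ℝ (T : Set (Fin d → ℝ)) with hKdef
  have hKc : IsCompact K := T.finite_toSet.isCompact_convexHull ℝ
  obtain ⟨F, hF0, hF⟩ := exists_proper_halfspaces T hT
  set ℓ : F → Fin d → ℝ := fun j => j.1.1
  set b : F → ℝ := fun j => j.1.2
  have hK : ∀ x, x ∈ K ↔ ∀ j, ℓ j ⬝ᵥ x ≤ b j := by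
    intro x
    rw [hF]
    exact ⟨fun h j => h j.1 j.2, fun h p hp => h ⟨p, hp⟩⟩
  obtain ⟨R, hR⟩ := hKc.isBounded.exists_norm_le
  obtain ⟨y, hy⟩ := hT
  have hyK : y ∈ K := subset_convexHull ℝ _ hy
  have hex : ∃ B, (rowMat ℓ B).det ≠ 0 := by
    refine exists_rowMat_det_ne_zero fun v hv => ?_
    by_contra hne
    obtain ⟨n, hn⟩ := exists_nat_gt ((R + ‖y‖) / ‖v‖)
    rw [div_lt_iff₀ (norm_pos_iff.2 hne)] at hn
    have h1 : y + (n : ℝ) • v ∈ K := by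
      rw [hK]
      intro j
      rw [dotProduct_add, dotProduct_smul, hv j, smul_zero, add_zero]
      exact (hK y).1 hyK j
    have h2 := hR _ h1
    have h3 := norm_sub_norm_le ((n : ℝ) • v) (-y)
    rw [sub_neg_eq_add, add_comm _ y, norm_smul, norm_neg, Real.norm_natCast] at h3
    linarith
  obtain ⟨C₀, hC₀, hsl⟩ := exists_sub_dotProduct_le ℓ b hKc
  obtain ⟨C₁, hC₁, hpoly⟩ := exists_polytope_bound (ℓ := ℓ) (by omega) (fun j => hF0 j.1 j.2) hex
  obtain ⟨c, hc, hdy⟩ := exists_dyadic_log (d := d) hC₀ (by omega)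
  filter_upwards [hμ.ae_sum_shape_le hd ℓ] with x ⟨C₂, hC₂, hx⟩ ε hε
  obtain ⟨D, hD, hpl⟩ := exists_polylog_le d hε
  refine ⟨C₁ * (C₂ * (D * c ^ ((d : ℝ) - 1 + ε))), by positivity, fun t ht X => ?_⟩
  obtain ⟨κ, J, h1, h2, h3⟩ := hdy t ht
  have hQ : (fun p => t • p + X) '' K = {z | ∀ j, ℓ j ⬝ᵥ z ≤ t * b j + ℓ j ⬝ᵥ X} :=
    Set.ext fun z => mem_image_smul_add_iff hK (by linarith) X z
  have hdet : (x.out.1 : Matrix (Fin d) (Fin d) ℝ).det ≠ 0 := by rw [x.out.2]; exact one_ne_zero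
  have hmem : ∀ z, (∀ j, ℓ j ⬝ᵥ z ≤ t * b j + ℓ j ⬝ᵥ X) → ∃ p ∈ K, t • p + X = z := fun z hz => by
    have : z ∈ (fun p => t • p + X) '' K := by rw [hQ]; exact hz
    exact this
  have hb := hpoly (fun j => t * b j + ℓ j ⬝ᵥ X) κ x.out.1 hdet
    ⟨t * R + ‖X‖, fun z hz => by
      obtain ⟨p, hp, rfl⟩ := hmem z hz
      refine (norm_add_le _ _).trans ?_
      rw [norm_smul, Real.norm_of_nonneg (by linarith)]
      gcongr
      exact hR p hp⟩
    (fun z hz j => by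
      obtain ⟨p, hp, rfl⟩ := hmem z hz
      rw [dotProduct_add, dotProduct_smul, smul_eq_mul]
      have h4 := mul_le_mul_of_nonneg_left (hsl p hp j) (show 0 ≤ t by linarith)
      linarith)
  rw [hQ]
  refine hb.trans ?_
  rw [mul_assoc C₁]
  refine mul_le_mul_of_nonneg_left ?_ hC₁.le
  have hlog : 0 ≤ Real.log t := Real.log_nonneg (by linarith)
  have hexp : (((d - 1 : ℕ) : ℝ) + ε) = (d : ℝ) - 1 + ε := by
    rw [Nat.cast_sub (by omega)]
    simp
  have hexp0 : 0 ≤ (d : ℝ) - 1 + ε := by rw [← hexp]; positivity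
  calc _ ≤ ∑ p ∈ (Finset.univ.filter fun B => (rowMat ℓ B).det ≠ 0) ×ˢ
            shapeSet d ((2 ^ J : ℕ) : ℤ), (2 : ℝ) ^ (d * lev (shapeMat ℓ p.1 p.2 * x.out.1)) :=
        Finset.sum_le_sum_of_subset_of_nonneg
          (Finset.product_subset_product_right (shapeSet_mono (by exact_mod_cast h2)))
          fun _ _ _ => by positivity
    _ ≤ C₂ * ((J + 1) ^ 3 * 2 ^ (J * (d - 1))) := hx J
    _ ≤ C₂ * (D * ((2 : ℝ) ^ J) ^ ((d : ℝ) - 1 + ε)) := by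
        rw [← hexp]
        exact mul_le_mul_of_nonneg_left (hpl J) hC₂.le
    _ ≤ C₂ * (D * (c * Real.log t) ^ ((d : ℝ) - 1 + ε)) := by gcongr
    _ = C₂ * (D * c ^ ((d : ℝ) - 1 + ε)) * Real.log t ^ ((d : ℝ) - 1 + ε) := by
        rw [Real.mul_rpow hc.le hlog]
        ring

lemma latErr_indicator {h : Matrix (Fin d) (Fin d) ℝ} (hh : h.det = 1) {Q : Set (Fin d → ℝ)}
    (hQ : IsCompact Q) :
    latErr h (Q.indicator 1) = {n : Fin d → ℤ | lv h n ∈ Q}.ncard - (volume Q).toReal := by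
  have hh0 : h.det ≠ 0 := by rw [hh]; exact one_ne_zero
  obtain ⟨R, hR⟩ := hQ.isBounded.exists_norm_le
  have hfin : {n : Fin d → ℤ | lv h n ∈ Q}.Finite :=
    (finite_lv_norm_le hh0 0 R).subset fun n hn => by simpa using hR _ hn
  unfold latErr
  rw [hh, abs_one, one_mul, integral_indicator_one hQ.measurableSet, Measure.real]
  congr 1
  rw [tsum_eq_sum (s := hfin.toFinset), Set.ncard_eq_toFinset_card _ hfin,
    Finset.sum_congr rfl (g := fun _ => (1 : ℝ))]
  · simp
  · intro n hn
    rw [Set.indicator_of_mem (show lv h n ∈ Q from hfin.mem_toFinset.1 hn), Pi.one_apply]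
  · intro n hn
    exact Set.indicator_of_notMem (show lv h n ∉ Q from fun hm => hn (hfin.mem_toFinset.2 hm)) _

open scoped Pointwise in
lemma volume_image_smul_add {t : ℝ} (ht : 0 ≤ t) (X : Fin d → ℝ) (K : Set (Fin d → ℝ)) :
    (volume ((fun p => t • p + X) '' K)).toReal = t ^ d * (volume K).toReal := by
  have e : (fun p => t • p + X) '' K = (fun p => p + X) '' (t • K) := by
    rw [← Set.image_smul, Set.image_image]
  rw [e, Set.image_add_right, measure_preimage_add_right, Measure.addHaar_smul, ENNReal.toReal_mul,
    Module.finrank_fin_fun, ENNReal.toReal_ofReal (abs_nonneg _), abs_of_nonneg (by positivity)]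

end

end

/-- Skriganov's theorem: for a convex polytope `P ⊂ ℝ^d` (`d ≥ 2`) with nonempty
interior and `μ_d`-almost every unimodular lattice `L ∈ 𝒮_d` (with respect to any
`SL_d(ℝ)`-invariant Borel probability measure), for every `ε > 0` there are `C > 0` and
`t₀ ≥ 2` such that for all `t ≥ t₀`,
`sup_X |card(L ∩ (tP + X)) − t^d·Vol(P)| ≤ C·(log t)^{d−1+ε}`. -/
theorem stmt17 (d : ℕ) (hd : 2 ≤ d)
    (P : Set (EuclideanSpace ℝ (Fin d)))
    (hP : ∃ s : Finset (EuclideanSpace ℝ (Fin d)), P = convexHull ℝ (s : Set (EuclideanSpace ℝ (Fin d))))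
    (hPint : (interior P).Nonempty)
    (μ : Measure (LatticeSpace d)) [IsProbabilityMeasure μ]
    (hinv : ∀ (g : SLR d) (s : Set (LatticeSpace d)), μ ((g • ·) ⁻¹' s) = μ s) :
    ∀ᵐ x ∂μ, ∀ ε > (0 : ℝ), ∃ C > (0 : ℝ), ∃ t₀ : ℝ, 2 ≤ t₀ ∧
      ∀ t : ℝ, t₀ ≤ t → ∀ X : EuclideanSpace ℝ (Fin d),
        |((gLat (Quotient.out x) ∩ ((fun p => t • p + X) '' P)).ncard : ℝ) -
            t ^ d * (volume P).toReal|
          ≤ C * Real.log t ^ ((d : ℝ) - 1 + ε) := by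
  obtain ⟨S, rfl⟩ := hP
  have hne : S.Nonempty := by
    rw [← Finset.coe_nonempty, ← convexHull_nonempty_iff (𝕜 := ℝ)]
    exact hPint.mono interior_subset
  classical
  set e : EuclideanSpace ℝ (Fin d) →ₗ[ℝ] (Fin d → ℝ) :=
    (WithLp.linearEquiv 2 ℝ (Fin d → ℝ)).toLinearMap with he
  have heinj : Function.Injective e := (WithLp.linearEquiv 2 ℝ (Fin d → ℝ)).injective
  set P := convexHull ℝ (S : Set (EuclideanSpace ℝ (Fin d))) with hPdef
  have himg : e '' P = convexHull ℝ ((S.image e : Finset (Fin d → ℝ)) : Set (Fin d → ℝ)) := by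
    rw [hPdef, LinearMap.image_convexHull, Finset.coe_image]
  have hinv' : IsInv μ := hinv
  have hvol : volume (e '' P) = volume P := by
    have hPc : IsCompact P := S.finite_toSet.isCompact_convexHull ℝ
    have hpre : e ⁻¹' (e '' P) = P := heinj.preimage_image P
    conv_rhs => rw [← hpre]
    refine ((PiLp.volume_preserving_ofLp (Fin d)).measure_preimage ?_).symm
    rw [himg]
    exact ((Finset.finite_toSet _).isCompact_convexHull ℝ).measurableSet.nullMeasurableSet
  filter_upwards [hinv'.ae_abs_latErr_le hd (S.image e) (hne.image e)] with x hx ε hε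
  obtain ⟨C, hC, h⟩ := hx ε hε
  refine ⟨C, hC, 2, le_rfl, fun t ht X => ?_⟩
  have h1 := h t ht (e X)
  rw [← himg] at h1
  have hcpt : IsCompact ((fun p => t • p + e X) '' (e '' P)) := by
    rw [himg]
    exact ((Finset.finite_toSet _).isCompact_convexHull ℝ).image (by fun_prop)
  rw [latErr_indicator x.out.2 hcpt, volume_image_smul_add (by linarith), hvol] at h1
  have hdet : (x.out.1 : Matrix (Fin d) (Fin d) ℝ).det ≠ 0 := by rw [x.out.2]; exact one_ne_zero
  have hlv : ∀ n, e (latVec x.out n) = lv x.out.1 n := fun n => rfl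
  have hset : gLat x.out ∩ (fun p => t • p + X) '' P =
      latVec x.out '' {n | lv x.out.1 n ∈ (fun p => t • p + e X) '' (e '' P)} := by
    ext z
    constructor
    · rintro ⟨⟨n, rfl⟩, p, hp, hpe⟩
      refine ⟨n, ⟨e p, ⟨p, hp, rfl⟩, ?_⟩, rfl⟩
      simp only at hpe ⊢
      rw [← hlv, ← hpe, map_add, map_smul]
    · rintro ⟨n, ⟨_, ⟨p, hp, rfl⟩, hpe⟩, rfl⟩
      refine ⟨⟨n, rfl⟩, p, hp, heinj ?_⟩
      simp only at hpe ⊢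
      rw [hlv, ← hpe, map_add, map_smul]
  have hinj : Function.Injective (latVec (d := d) x.out) := fun m n hmn =>
    lv_injective hdet (congrArg e hmn)
  rw [hset, Set.ncard_image_of_injective _ hinj]
  exact h1
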